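/- Assume the dilations are isotropic, a_j = α_j I with α_j real nonzero, and take an analyzer φ which is a Schwartz function with φ̂ supported in C₀ b^{-1}; let ν be the cut-off used to define the discrete Riesz kernel z. Then for each j > 0 the analysis operator maps H¹(ℝ^d) boundedly into h¹, with norm estimate ‖T_j f‖_{h¹} ≤ ‖P|φ|‖_∞ ‖ν̌‖₁ ‖f‖_{H¹} for all f ∈ H¹, where ν̌ denotes the inverse Fourier transform of ν. -/

import Mathlib

open MeasureTheory Filter Matrix Set
open scoped ENNReal NNReal Topology

noncomputable section

namespace AffinePaper

/-- Embed an integer lattice point `k ∈ ℤ^d` into `ℝ^d`. -/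
def intVec {d : ℕ} (k : Fin d → ℤ) : Fin d → ℝ := fun i => (k i : ℝ)

/-- Euclidean norm `|x|` on `ℝ^d`. -/
def eucNorm {d : ℕ} (x : Fin d → ℝ) : ℝ := Real.sqrt (∑ i, x i ^ 2)

/-- The constant `C_d = Γ((d+1)/2) π^{-(d+1)/2}` of the Riesz kernel. -/
def rieszConst (d : ℕ) : ℝ :=
  Real.Gamma (((d : ℝ) + 1) / 2) / Real.pi ^ (((d : ℝ) + 1) / 2)

/-- The (vector-valued) Riesz kernel `Z(x) = C_d x / |x|^{d+1}`, with `Z(0) = 0`. -/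
def rieszKernel (d : ℕ) (x : Fin d → ℝ) : Fin d → ℝ :=
  if x = 0 then 0 else fun i => rieszConst d * x i / eucNorm x ^ (d + 1)

/-- The truncated singular integral `∫_{|y| > ε} f(x-y) Z(y) dy` (vector-valued). -/
def truncRiesz {d : ℕ} (f : (Fin d → ℝ) → ℂ) (x : Fin d → ℝ) (ε : ℝ) : Fin d → ℂ :=
  ∫ y in {y : Fin d → ℝ | ε < eucNorm y}, (fun i => f (x - y) * ((rieszKernel d y i : ℝ) : ℂ))

/-- `g` is the Riesz transform `Rf = f * Z` of `f`, in the principal value sense: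
for a.e. `x` the truncated integrals converge to `g(x)` as `ε → 0+`. -/
def HasRiesz {d : ℕ} (f : (Fin d → ℝ) → ℂ) (g : (Fin d → ℝ) → Fin d → ℂ) : Prop :=
  ∀ᵐ x : Fin d → ℝ, Tendsto (fun ε : ℝ => truncRiesz f x ε) (𝓝[>] 0) (𝓝 (g x))

/-- Membership in the Hardy space `H¹(ℝ^d) = { f ∈ L¹ : Rf ∈ L¹ }`. -/
def MemH1 {d : ℕ} (f : (Fin d → ℝ) → ℂ) : Prop :=
  Integrable f volume ∧ ∃ g : (Fin d → ℝ) → Fin d → ℂ, Integrable g volume ∧ HasRiesz f g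

/-- The Hardy norm `‖f‖_{H¹} = ‖f‖₁ + ‖Rf‖₁`, as a value in `[0,∞]` (equal to `∞` when
`f` admits no integrable Riesz transform; the Riesz transform is a.e. unique, so the
infimum below is over a set of at most one value). -/
def hardyNorm {d : ℕ} (f : (Fin d → ℝ) → ℂ) : ℝ≥0∞ :=
  ENNReal.ofReal (∫ x : Fin d → ℝ, ‖f x‖) +
    sInf {r : ℝ≥0∞ | ∃ g : (Fin d → ℝ) → Fin d → ℂ,
      Integrable g volume ∧ HasRiesz f g ∧ r = ENNReal.ofReal (∫ x : Fin d → ℝ, ‖g x‖)}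

/-- The centered open unit cube `C₀ = (-1/2, 1/2)^d`. -/
def centeredCube (d : ℕ) : Set (Fin d → ℝ) :=
  Set.univ.pi fun _ => Set.Ioo (-(1/2) : ℝ) (1/2)

/-- `ν` is a smooth cut-off function: supported in the centered unit cube `C₀` and
identically `1` near the origin. -/
structure IsCutoff (d : ℕ) (ν : (Fin d → ℝ) → ℝ) : Prop where
  smooth : ContDiff ℝ (⊤ : ℕ∞) ν
  supp : tsupport ν ⊆ centeredCube d
  one_near_zero : ∀ᶠ ξ in 𝓝 0, ν ξ = 1

/-- The periodic function `ζ(ξ) = -i (ξ b⁻¹ / |ξ b⁻¹|) ν(ξ)` (vector-valued), whose Fourier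
coefficients define the discrete Riesz kernel. -/
def zetaFn {d : ℕ} (b : Matrix (Fin d) (Fin d) ℝ) (ν : (Fin d → ℝ) → ℝ)
    (ξ : Fin d → ℝ) : Fin d → ℂ :=
  fun i => -Complex.I * ((((ξ ᵥ* b⁻¹) i / eucNorm (ξ ᵥ* b⁻¹) : ℝ)) : ℂ) * ((ν ξ : ℝ) : ℂ)

/-- The discrete Riesz kernel `z = {z_k}`, defined through its Fourier series
`Σ_k z_k e^{-2πi ξ k} = ζ(ξ)`, `ξ ∈ C₀`; that is, `z_k = ∫_{C₀} ζ(ξ) e^{2πi ξ k} dξ`. -/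
def zKernel {d : ℕ} (b : Matrix (Fin d) (Fin d) ℝ) (ν : (Fin d → ℝ) → ℝ)
    (k : Fin d → ℤ) : Fin d → ℂ :=
  ∫ ξ in centeredCube d,
    Complex.exp (((2 * Real.pi * ∑ i, ξ i * (k i : ℝ) : ℝ)) * Complex.I) • zetaFn b ν ξ

/-- Discrete convolution `(s * z)_k = Σ_l s_{k-l} z_l` of a scalar sequence with the
(vector-valued) kernel `z`, in the `k`-index. -/
def dConv {d : ℕ} (s : (Fin d → ℤ) → ℂ) (z : (Fin d → ℤ) → Fin d → ℂ)
    (k : Fin d → ℤ) : Fin d → ℂ :=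
  ∑' l : Fin d → ℤ, s (k - l) • z l

/-- The discrete Hardy norm `‖s‖_{h¹} = ‖s‖_{ℓ¹} + ‖s * z‖_{ℓ¹}` (value in `[0,∞]`). -/
def h1Norm {d : ℕ} (b : Matrix (Fin d) (Fin d) ℝ) (ν : (Fin d → ℝ) → ℝ)
    (s : (Fin d → ℤ) → ℂ) : ℝ≥0∞ :=
  (∑' k : Fin d → ℤ, (‖s k‖₊ : ℝ≥0∞)) +
    ∑' k : Fin d → ℤ, (‖dConv s (zKernel b ν) k‖₊ : ℝ≥0∞)

/-- The mixed norm `‖c‖_{ℓ¹(h¹)} = Σ_j ‖c_j‖_{h¹}` (value in `[0,∞]`). -/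
def l1h1Norm {d : ℕ} (b : Matrix (Fin d) (Fin d) ℝ) (ν : (Fin d → ℝ) → ℝ)
    (c : ℕ → (Fin d → ℤ) → ℂ) : ℝ≥0∞ :=
  ∑' j : ℕ, h1Norm b ν (c j)

/-- `ψ_{j,k}(x) = |det a_j| ψ(a_j x - bk)` for isotropic dilations `a_j = α_j I`
(Hardy-space normalization, `p = 1`). -/
def rescH {d : ℕ} (α : ℕ → ℝ) (b : Matrix (Fin d) (Fin d) ℝ) (ψ : (Fin d → ℝ) → ℂ)
    (j : ℕ) (k : Fin d → ℤ) (x : Fin d → ℝ) : ℂ :=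
  ((|α j| ^ d : ℝ) : ℂ) * ψ (α j • x - b *ᵥ intVec k)

/-- The synthesis series `Sc = Σ_j Σ_k c_{j,k} ψ_{j,k}` converges to `f` in `H¹`:
for each `j` the sum over `k` converges absolutely in `L¹` to a function belonging to
`H¹`, and the sum over `j` converges absolutely in `H¹`, with limit `f`. -/
def H1SynthesisTo {d : ℕ} (α : ℕ → ℝ) (b : Matrix (Fin d) (Fin d) ℝ)
    (ψ : (Fin d → ℝ) → ℂ) (c : ℕ → (Fin d → ℤ) → ℂ) (f : (Fin d → ℝ) → ℂ) : Prop :=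
  (∀ j : ℕ, Summable fun k : Fin d → ℤ => ∫ x : Fin d → ℝ, ‖c j k * rescH α b ψ j k x‖) ∧
  (∀ j : ℕ, MemH1 (fun x => ∑' k : Fin d → ℤ, c j k * rescH α b ψ j k x)) ∧
  Summable (fun j : ℕ =>
    (hardyNorm (fun x => ∑' k : Fin d → ℤ, c j k * rescH α b ψ j k x)).toReal) ∧
  Tendsto (fun J : ℕ => hardyNorm
      (fun x => f x - ∑ j ∈ Finset.range J, ∑' k : Fin d → ℤ, c j k * rescH α b ψ j k x))
    atTop (𝓝 0)

/-- Analysis operator at scale `j` in the Hardy-space setting (`p = 1`, `q = ∞`):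
`(T_j f)_k = |det b| ⟨f, φ_{j,k}⟩` with `φ_{j,k}(x) = φ(α_j x - bk)`. -/
def TjH {d : ℕ} (α : ℕ → ℝ) (b : Matrix (Fin d) (Fin d) ℝ) (φ : (Fin d → ℝ) → ℂ)
    (f : (Fin d → ℝ) → ℂ) (j : ℕ) (k : Fin d → ℤ) : ℂ :=
  ((|b.det| : ℝ) : ℂ) *
    ∫ x : Fin d → ℝ, f x * (starRingEnd ℂ) (φ (α j • x - b *ᵥ intVec k))

/-- Dot product of row vector `ξ` and column vector `x`. -/
def dotP {d : ℕ} (ξ x : Fin d → ℝ) : ℝ := ∑ i, ξ i * x i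

/-- Fourier transform `f̂(ξ) = ∫ f(x) e^{-2πi ξ x} dx`. -/
def ft {d : ℕ} (f : (Fin d → ℝ) → ℂ) (ξ : Fin d → ℝ) : ℂ :=
  ∫ x : Fin d → ℝ, Complex.exp ((-(2 * Real.pi * dotP ξ x) : ℝ) * Complex.I) * f x

/-- Inverse Fourier transform `ǧ(x) = ∫ g(ξ) e^{2πi ξ x} dξ`. -/
def ftInv {d : ℕ} (g : (Fin d → ℝ) → ℂ) (x : Fin d → ℝ) : ℂ :=
  ∫ ξ : Fin d → ℝ, Complex.exp (((2 * Real.pi * dotP ξ x) : ℝ) * Complex.I) * g ξ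

/-- `f` is a Schwartz function. -/
def IsSchwartz {d : ℕ} (f : (Fin d → ℝ) → ℂ) : Prop :=
  ∃ Φ : SchwartzMap (Fin d → ℝ) ℂ, ∀ x, f x = Φ x

/-- Convolution `(f * g)(x) = ∫ f(y) g(x - y) dy`. -/
def conv {d : ℕ} (f g : (Fin d → ℝ) → ℂ) (x : Fin d → ℝ) : ℂ :=
  ∫ y : Fin d → ℝ, f y * g (x - y)

/-- The periodization `Pg(x) = |det b| Σ_{k ∈ ℤ^d} g(x - bk)` of a real-valued function. -/
def periodization {d : ℕ} (b : Matrix (Fin d) (Fin d) ℝ) (g : (Fin d → ℝ) → ℝ)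
    (x : Fin d → ℝ) : ℝ :=
  |b.det| * ∑' k : Fin d → ℤ, g (x - b *ᵥ intVec k)

/-- The multi-index of the dyadic cube of side `2⁻ⁿ` containing `x`. -/
def dyadicIndex {d : ℕ} (n : ℕ) (x : Fin d → ℝ) : Fin d → ℤ := fun i => ⌊2 ^ n * x i⌋

/-- The half-open dyadic cube of side `2⁻ⁿ` with multi-index `k`. -/
def dyadicCube {d : ℕ} (n : ℕ) (k : Fin d → ℤ) : Set (Fin d → ℝ) := {x | dyadicIndex n x = k}

/-- The centre of a dyadic cube. -/
def dyadicCenter {d : ℕ} (n : ℕ) (k : Fin d → ℤ) : Fin d → ℝ :=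
  fun i => ((k i : ℝ) + 1 / 2) / 2 ^ n

lemma dyadicCube_eq_pi {d : ℕ} (n : ℕ) (k : Fin d → ℤ) :
    dyadicCube n k =
      Set.univ.pi fun i => Ico ((k i : ℝ) / 2 ^ n) (((k i : ℝ) + 1) / 2 ^ n) := by
  ext x
  simp only [dyadicCube, dyadicIndex, mem_ofPred_eq, funext_iff, Set.mem_pi, mem_univ, true_imp_iff,
    mem_Ico, Int.floor_eq_iff]
  refine forall_congr' fun i => ?_
  rw [div_le_iff₀ (by positivity), lt_div_iff₀ (by positivity), mul_comm]

lemma closedBall_dyadicCenter {d : ℕ} (n : ℕ) (k : Fin d → ℤ) :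
    Metric.closedBall (dyadicCenter n k) (1 / 2 / 2 ^ n) =
      Icc (fun i => (k i : ℝ) / 2 ^ n) (fun i => ((k i : ℝ) + 1) / 2 ^ n) := by
  rw [closedBall_pi _ (by positivity), ← Set.pi_univ_Icc]
  congr 1
  funext i
  rw [Real.closedBall_eq_Icc, dyadicCenter]
  congr 1 <;> ring

lemma measurableSet_dyadicCube {d : ℕ} (n : ℕ) (k : Fin d → ℤ) :
    MeasurableSet (dyadicCube n k) := by
  rw [dyadicCube_eq_pi]
  exact MeasurableSet.univ_pi fun _ => measurableSet_Ico

lemma dyadicCube_ae_eq_closedBall {d : ℕ} (n : ℕ) (k : Fin d → ℤ) :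
    dyadicCube n k =ᵐ[volume] Metric.closedBall (dyadicCenter n k) (1 / 2 / 2 ^ n) := by
  rw [closedBall_dyadicCenter, dyadicCube_eq_pi]
  exact Measure.univ_pi_Ico_ae_eq_Icc

lemma dyadicCube_subset_closedBall {d : ℕ} (n : ℕ) (k : Fin d → ℤ) :
    dyadicCube n k ⊆ Metric.closedBall (dyadicCenter n k) (1 / 2 / 2 ^ n) := by
  rw [closedBall_dyadicCenter, dyadicCube_eq_pi]
  intro x hx
  exact ⟨fun i => (hx i trivial).1, fun i => (hx i trivial).2.le⟩

lemma measureReal_dyadicCube {d : ℕ} (n : ℕ) (k : Fin d → ℤ) :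
    volume.real (dyadicCube n k) = ((2 : ℝ) ^ n)⁻¹ ^ d := by
  rw [measureReal_congr (dyadicCube_ae_eq_closedBall n k), Measure.real,
    Real.volume_pi_closedBall _ (by positivity), ENNReal.toReal_ofReal (by positivity),
    Fintype.card_fin]
  congr 1
  ring

lemma dyadicIndex_eq_of_le {d : ℕ} {m n : ℕ} (h : m ≤ n) {x y : Fin d → ℝ}
    (hxy : dyadicIndex n x = dyadicIndex n y) : dyadicIndex m x = dyadicIndex m y := by
  induction n, h using Nat.le_induction with
  | base => exact hxy
  | succ n _ ih =>
    refine ih ?_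
    funext i
    have h2 : ∀ t : ℝ, ⌊t⌋ = ⌊2 * t⌋ / 2 := fun t => by
      rw [Int.floor_eq_iff]
      have h1 := Int.floor_le (2 * t)
      have h3 := Int.lt_floor_add_one (2 * t)
      have h4 : 2 * (⌊2 * t⌋ / 2) ≤ ⌊2 * t⌋ := by omega
      have h5 : ⌊2 * t⌋ ≤ 2 * (⌊2 * t⌋ / 2) + 1 := by omega
      have h4' : (2 : ℝ) * ((⌊2 * t⌋ / 2 : ℤ) : ℝ) ≤ ⌊2 * t⌋ := by exact_mod_cast h4
      have h5' : (⌊2 * t⌋ : ℝ) ≤ 2 * ((⌊2 * t⌋ / 2 : ℤ) : ℝ) + 1 := by exact_mod_cast h5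
      constructor <;> linarith
    have := congrFun hxy i
    simp only [dyadicIndex] at this ⊢
    rw [h2 (2 ^ n * x i), h2 (2 ^ n * y i), ← mul_assoc, ← mul_assoc, ← pow_succ', this]

lemma dyadicCenter_mem {d : ℕ} (n : ℕ) (k : Fin d → ℤ) : dyadicCenter n k ∈ dyadicCube n k := by
  rw [dyadicCube_eq_pi]
  intro i _
  constructor <;> simp only [dyadicCenter] <;> gcongr <;> linarith

/-- Calderón–Zygmund stopping-time cubes at height `l ≥ ‖f‖₁`. -/
theorem exists_calderonZygmund_cubes {d : ℕ} {f : (Fin d → ℝ) → ℂ} (hf : Integrable f)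
    {l : ℝ} (hfl : ∫ x, ‖f x‖ ≤ l) :
    ∃ (ι : Type) (_ : Countable ι) (Q : ι → Set (Fin d → ℝ)) (c : ι → Fin d → ℝ) (r : ι → ℝ),
      (∀ i, 0 < r i) ∧ (∀ i, MeasurableSet (Q i)) ∧ Pairwise (Function.onFun Disjoint Q) ∧
      (∀ i, Q i ⊆ Metric.closedBall (c i) (r i)) ∧
      (∀ i, 0 < volume.real (Q i)) ∧
      (∀ i, volume.real (Metric.closedBall (c i) (2 * r i)) = 2 ^ d * volume.real (Q i)) ∧
      (∀ i, l * volume.real (Q i) ≤ ∫ x in Q i, ‖f x‖) ∧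
      (∀ i, ∫ x in Q i, ‖f x‖ ≤ 2 ^ d * l * volume.real (Q i)) ∧
      ∀ᵐ x, x ∉ ⋃ i, Q i → ‖f x‖ ≤ l := by
  let big : ℕ → (Fin d → ℤ) → Prop := fun n k =>
    l * volume.real (dyadicCube n k) < ∫ x in dyadicCube n k, ‖f x‖
  let S : Set (ℕ × (Fin d → ℤ)) := {p | big p.1 p.2 ∧
    ∀ m < p.1, ∀ x ∈ dyadicCube p.1 p.2, ¬ big m (dyadicIndex m x)}
  refine ⟨S, inferInstance, fun p => dyadicCube p.1.1 p.1.2, fun p => dyadicCenter p.1.1 p.1.2,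
    fun p => 1 / 2 / 2 ^ p.1.1, fun p => by positivity, fun p => measurableSet_dyadicCube _ _,
    ?_, fun p => dyadicCube_subset_closedBall _ _, fun p => ?_, fun p => ?_,
    fun p => p.2.1.le, ?_, ?_⟩
  · rintro ⟨⟨n, k⟩, hp⟩ ⟨⟨n', k'⟩, hp'⟩ hne
    rw [Function.onFun, Set.disjoint_left]
    rintro x (hx : dyadicIndex n x = k) (hx' : dyadicIndex n' x = k')
    rcases lt_trichotomy n n' with h | h | h
    · exact hp'.2 n h x hx' (hx ▸ hp.1)
    · subst h
      exact hne (by simp [← hx, ← hx'])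
    · exact hp.2 n' h x hx (hx' ▸ hp'.1)
  · simp only [measureReal_dyadicCube]
    positivity
  · simp only [measureReal_dyadicCube]
    rw [Measure.real, Real.volume_pi_closedBall _ (by positivity),
      ENNReal.toReal_ofReal (by positivity), Fintype.card_fin, ← mul_pow]
    congr 1
    ring
  · rintro ⟨⟨n, k⟩, hp⟩
    rcases n with _ | n
    · exfalso
      have h1 := hp.1
      have h2 : ∫ x in dyadicCube 0 k, ‖f x‖ ≤ ∫ x, ‖f x‖ :=
        setIntegral_le_integral hf.norm (Eventually.of_forall fun x => norm_nonneg _)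
      simp only [big, measureReal_dyadicCube] at h1
      simp at h1
      linarith
    · have h1 := hp.2 n (Nat.lt_succ_self n) _ (dyadicCenter_mem _ _)
      simp only [big, not_lt] at h1
      refine (setIntegral_mono_set hf.norm.integrableOn
        (Eventually.of_forall fun x => norm_nonneg _)
        (LE.le.eventuallyLE ?_)).trans (h1.trans (le_of_eq ?_))
      · intro x hx
        exact dyadicIndex_eq_of_le (Nat.le_succ n) (hx.trans (dyadicCenter_mem _ _).symm)
      · simp only [measureReal_dyadicCube]
        rw [mul_right_comm, mul_comm l, ← mul_pow]
        congr 2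
        rw [pow_succ]
        field_simp
  · have hfn : LocallyIntegrable (fun x => ‖f x‖) := hf.norm.locallyIntegrable
    filter_upwards [IsUnifLocDoublingMeasure.ae_tendsto_average volume hfn 1] with x hx hxQ
    have hδ : Tendsto (fun n : ℕ => (1 / 2 / 2 ^ n : ℝ)) atTop (𝓝[>] 0) := by
      refine tendsto_nhdsWithin_iff.2 ⟨?_, Eventually.of_forall fun n => by
        simp only [mem_Ioi]; positivity⟩
      have := (tendsto_pow_atTop_nhds_zero_of_lt_one (r := (1 / 2 : ℝ)) (by norm_num)
        (by norm_num)).const_mul (1 / 2)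
      simpa [div_eq_mul_inv] using this
    have := hx (fun n => dyadicCenter n (dyadicIndex n x)) (fun n => 1 / 2 / 2 ^ n) hδ
      (Eventually.of_forall fun n => by
        rw [one_mul]; exact dyadicCube_subset_closedBall n _ rfl)
    refine le_of_tendsto this (Eventually.of_forall fun n => ?_)
    have hnb : ∀ n, ¬ big n (dyadicIndex n x) := by
      by_contra! hcon
      classical
      refine hxQ (mem_iUnion.2 ⟨⟨(Nat.find hcon, dyadicIndex (Nat.find hcon) x),
        Nat.find_spec hcon, fun m hm y hy => ?_⟩, rfl⟩)
      rw [dyadicIndex_eq_of_le hm.le hy]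
      exact Nat.find_min hcon hm
    have h1 := hnb n
    simp only [big, not_lt] at h1
    rw [setAverage_eq, ← setIntegral_congr_set (dyadicCube_ae_eq_closedBall n _),
      ← measureReal_congr (dyadicCube_ae_eq_closedBall n _), smul_eq_mul, inv_mul_le_iff₀]
    · linarith
    · rw [measureReal_dyadicCube]; positivity

/-- Calderón–Zygmund decomposition: `f = (f - B) + B` where `f - B` is bounded by `2ᵈ l` and `B`
is supported on disjoint cubes `Q i`, with mean zero on each of them. -/
theorem exists_calderonZygmund_decomposition {d : ℕ} {f : (Fin d → ℝ) → ℂ} (hf : Integrable f)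
    {l : ℝ} (hl : 0 < l) (hfl : ∫ x, ‖f x‖ ≤ l) :
    ∃ (ι : Type) (_ : Countable ι) (Q : ι → Set (Fin d → ℝ)) (c : ι → Fin d → ℝ) (r : ι → ℝ)
      (B : (Fin d → ℝ) → ℂ),
      (∀ i, 0 < r i) ∧ (∀ i, MeasurableSet (Q i)) ∧ Pairwise (Function.onFun Disjoint Q) ∧
      (∀ i, Q i ⊆ Metric.closedBall (c i) (r i)) ∧
      Integrable B ∧ (∀ i, ∫ x in Q i, B x = 0) ∧ (∀ x, x ∉ ⋃ i, Q i → B x = 0) ∧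
      ∫ x, ‖B x‖ ≤ 2 * ∫ x in ⋃ i, Q i, ‖f x‖ ∧
      (∀ᵐ x, ‖f x - B x‖ ≤ 2 ^ d * l) ∧
      volume (⋃ i, Metric.closedBall (c i) (2 * r i)) ≤
        ENNReal.ofReal (2 ^ d / l * ∫ x in ⋃ i, Q i, ‖f x‖) ∧
      volume (⋃ i, Q i) ≤ ENNReal.ofReal ((∫ x, ‖f x‖) / l) := by
  obtain ⟨ι, hι, Q, c, r, hr, hQm, hQd, hQc, hQpos, hQ2, hQl, hQu, hae⟩ :=
    exists_calderonZygmund_cubes hf hfl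
  have hQfin : ∀ i, volume (Q i) ≠ ∞ := fun i =>
    ((measure_mono (hQc i)).trans_lt (isCompact_closedBall _ _).measure_lt_top).ne
  let avg : ι → ℂ := fun i => (∫ x in Q i, f x) / volume.real (Q i)
  let B : (Fin d → ℝ) → ℂ := fun x => ∑' i, (Q i).indicator (fun x => f x - avg i) x
  have hBQ : ∀ i, ∀ x ∈ Q i, B x = f x - avg i := by
    intro i x hx
    have : ∀ j, j ≠ i → (Q j).indicator (fun x => f x - avg j) x = 0 := fun j hj =>
      indicator_of_notMem (fun hxj => Set.disjoint_left.1 (hQd hj) hxj hx) _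
    simp only [B]
    rw [tsum_eq_single i this, indicator_of_mem hx]
  have hB0 : ∀ x, x ∉ ⋃ i, Q i → B x = 0 := by
    intro x hx
    simp only [mem_iUnion, not_exists] at hx
    simp only [B]
    rw [tsum_congr fun i => indicator_of_notMem (hx i) _, tsum_zero]
  have havg : ∀ i, ‖avg i‖ * volume.real (Q i) ≤ ∫ x in Q i, ‖f x‖ := by
    intro i
    simp only [avg]
    rw [norm_div, Complex.norm_real, Real.norm_of_nonneg measureReal_nonneg,
      div_mul_cancel₀ _ (hQpos i).ne']
    exact norm_integral_le_integral_norm _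
  have hconst : ∀ i, IntegrableOn (fun _ => avg i) (Q i) := fun i =>
    integrableOn_const (hQfin i)
  have hBint : ∀ i, IntegrableOn B (Q i) := fun i =>
    (hf.integrableOn.sub (hconst i)).congr_fun (fun x hx => (hBQ i x hx).symm) (hQm i)
  have hBle : ∀ i, ∫ x in Q i, ‖B x‖ ≤ 2 * ∫ x in Q i, ‖f x‖ := by
    intro i
    calc ∫ x in Q i, ‖B x‖ ≤ ∫ x in Q i, (‖f x‖ + ‖avg i‖) := by
          refine setIntegral_mono_on (hBint i).norm
            (hf.norm.integrableOn.add (integrableOn_const (hQfin i))) (hQm i) fun x hx => ?_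
          rw [hBQ i x hx]
          exact norm_sub_le _ _
      _ = (∫ x in Q i, ‖f x‖) + ‖avg i‖ * volume.real (Q i) := by
          rw [integral_add hf.norm.integrableOn (integrableOn_const (hQfin i)),
            setIntegral_const, smul_eq_mul, mul_comm]
      _ ≤ _ := by linarith [havg i]
  have hfs := hasSum_integral_iUnion hQm hQd (hf.norm.integrableOn (s := ⋃ i, Q i))
  have hBs : Summable fun i => ∫ x in Q i, ‖B x‖ :=
    Summable.of_nonneg_of_le (fun i => integral_nonneg fun x => norm_nonneg _) hBle
      (hfs.summable.mul_left 2)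
  have hBintU : IntegrableOn B (⋃ i, Q i) :=
    integrableOn_iUnion_of_summable_integral_norm hBint hBs
  have hBI : Integrable B := by
    rw [← integrableOn_iff_integrable_of_support_subset (s := ⋃ i, Q i)]
    · exact hBintU
    · intro x hx
      by_contra h
      exact hx (hB0 x h)
  have hvol : ∀ i, volume (Q i) ≤ ENNReal.ofReal ((∫ x in Q i, ‖f x‖) / l) := fun i => by
    rw [← ofReal_measureReal (hQfin i)]
    refine ENNReal.ofReal_le_ofReal ?_
    rw [le_div_iff₀ hl, mul_comm]
    exact hQl i
  have hsumvol : ∑' i, ENNReal.ofReal ((∫ x in Q i, ‖f x‖) / l) =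
      ENNReal.ofReal ((∫ x in ⋃ i, Q i, ‖f x‖) / l) := by
    rw [← (hfs.div_const l).tsum_eq, ENNReal.ofReal_tsum_of_nonneg
      (fun i => div_nonneg (integral_nonneg fun x => norm_nonneg _) hl.le)
      (hfs.div_const l).summable]
  refine ⟨ι, hι, Q, c, r, B, hr, hQm, hQd, hQc, hBI, fun i => ?_, hB0, ?_, ?_, ?_, ?_⟩
  · rw [setIntegral_congr_fun (hQm i) (hBQ i), integral_sub hf.integrableOn (hconst i),
      setIntegral_const, Complex.real_smul]
    simp only [avg]
    rw [mul_div_cancel₀ _ (by exact_mod_cast (hQpos i).ne'), sub_self]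
  · have : ∫ x, ‖B x‖ = ∫ x in ⋃ i, Q i, ‖B x‖ :=
      (setIntegral_eq_integral_of_forall_compl_eq_zero fun x hx => by rw [hB0 x hx, norm_zero]).symm
    rw [this, ← (hasSum_integral_iUnion hQm hQd hBintU.norm).tsum_eq, ← hfs.tsum_eq,
      ← tsum_mul_left]
    exact hBs.tsum_le_tsum hBle (hfs.summable.mul_left 2)
  · filter_upwards [hae] with x hx
    by_cases h : x ∈ ⋃ i, Q i
    · obtain ⟨i, hi⟩ := mem_iUnion.1 h
      rw [hBQ i x hi, sub_sub_cancel]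
      refine le_of_mul_le_mul_right ((havg i).trans (hQu i)) (hQpos i)
    · rw [hB0 x h, sub_zero]
      refine (hx h).trans ?_
      have : (1 : ℝ) ≤ 2 ^ d := one_le_pow₀ (by norm_num)
      nlinarith
  · refine (measure_iUnion_le _).trans ?_
    have : ∀ i, volume (Metric.closedBall (c i) (2 * r i)) ≤
        ENNReal.ofReal (2 ^ d) * ENNReal.ofReal ((∫ x in Q i, ‖f x‖) / l) := fun i => by
      rw [← ofReal_measureReal (isCompact_closedBall (c i) (2 * r i)).measure_lt_top.ne, hQ2,
        ENNReal.ofReal_mul (by positivity), ofReal_measureReal (hQfin i)]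
      gcongr
      exact hvol i
    refine (ENNReal.tsum_le_tsum this).trans (le_of_eq ?_)
    rw [ENNReal.tsum_mul_left, hsumvol, ← ENNReal.ofReal_mul (by positivity)]
    congr 1
    ring
  · refine ((measure_iUnion_le _).trans (ENNReal.tsum_le_tsum hvol)).trans ?_
    rw [hsumvol]
    refine ENNReal.ofReal_le_ofReal ?_
    exact div_le_div_of_nonneg_right
      (setIntegral_le_integral hf.norm (Eventually.of_forall fun x => norm_nonneg _)) hl.le

lemma exists_pos_setIntegral_norm_le {d : ℕ} {f : (Fin d → ℝ) → ℂ} (hf : Integrable f) {η : ℝ}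
    (hη : 0 < η) :
    ∃ δ > 0, ∀ s : Set (Fin d → ℝ), volume s ≤ ENNReal.ofReal δ → ∫ x in s, ‖f x‖ ≤ η := by
  obtain ⟨δ, hδ, h⟩ := exists_pos_setLIntegral_lt_of_measure_lt (μ := volume)
    (f := fun x => ‖f x‖ₑ) hf.2.ne (ε := ENNReal.ofReal η) (by simpa using hη)
  obtain ⟨δ', hδ', hlt⟩ : ∃ δ' : ℝ, 0 < δ' ∧ ENNReal.ofReal δ' < δ := by
    obtain ⟨q, hq0, hq⟩ := ENNReal.lt_iff_exists_real_btwn.1 hδ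
    exact ⟨q, by simpa using hq.1, hq.2⟩
  refine ⟨δ', hδ', fun s hs => ?_⟩
  rw [integral_norm_eq_lintegral_enorm hf.aestronglyMeasurable.restrict]
  exact ENNReal.toReal_le_of_le_ofReal hη.le (h s (hs.trans_lt hlt)).le

theorem exists_calderonZygmund_decomposition_small {d : ℕ} {f g : (Fin d → ℝ) → ℂ}
    (hf : Integrable f) (hg : Integrable g) {η : ℝ} (hη : 0 < η) :
    ∃ (ι : Type) (_ : Countable ι) (Q : ι → Set (Fin d → ℝ)) (c : ι → Fin d → ℝ) (r : ι → ℝ)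
      (B : (Fin d → ℝ) → ℂ) (l : ℝ), 0 < l ∧
      (∀ i, 0 < r i) ∧ (∀ i, MeasurableSet (Q i)) ∧ Pairwise (Function.onFun Disjoint Q) ∧
      (∀ i, Q i ⊆ Metric.closedBall (c i) (r i)) ∧
      Integrable B ∧ (∀ i, ∫ x in Q i, B x = 0) ∧ (∀ x, x ∉ ⋃ i, Q i → B x = 0) ∧
      ∫ x, ‖B x‖ ≤ η ∧
      (∀ᵐ x, ‖f x - B x‖ ≤ l) ∧
      volume (⋃ i, Metric.closedBall (c i) (2 * r i)) ≤ ENNReal.ofReal (η / l) ∧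
      ∫ x in ⋃ i, Metric.closedBall (c i) (2 * r i), ‖g x‖ ≤ η := by
  obtain ⟨δg, hδg, Hg⟩ := exists_pos_setIntegral_norm_le hg hη
  set η' : ℝ := min η δg / 4 ^ (d + 1) with hη'
  have hm : 0 < min η δg := lt_min hη hδg
  have hη'0 : 0 < η' := by positivity
  obtain ⟨δf, hδf, Hf⟩ := exists_pos_setIntegral_norm_le hf hη'0
  set N := ∫ x, ‖f x‖
  have hN : 0 ≤ N := integral_nonneg fun x => norm_nonneg _
  set l : ℝ := max 1 (max N (N / δf))
  have hl1 : 1 ≤ l := le_max_left _ _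
  have hl : 0 < l := by linarith
  have hlN : N ≤ l := (le_max_left _ _).trans (le_max_right _ _)
  have hlN2 : N / δf ≤ l := (le_max_right _ _).trans (le_max_right _ _)
  obtain ⟨ι, hι, Q, c, r, B, hr, hQm, hQd, hQc, hB, hB0, hBs, hBn, hG, hV, hVQ⟩ :=
    exists_calderonZygmund_decomposition hf hl hlN
  have hQf : ∫ x in ⋃ i, Q i, ‖f x‖ ≤ η' := by
    refine Hf _ (hVQ.trans (ENNReal.ofReal_le_ofReal ?_))
    rw [div_le_iff₀ hl]
    rw [div_le_iff₀ hδf] at hlN2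
    linarith
  have h4 : (1 : ℝ) ≤ 4 ^ d := one_le_pow₀ (by norm_num)
  have h2 : (1 : ℝ) ≤ 2 ^ d := one_le_pow₀ (by norm_num)
  have h24 : (2 : ℝ) ^ d * 2 ^ d = 4 ^ d := by rw [← mul_pow]; norm_num
  have key : 4 ^ (d + 1) * η' = min η δg := by rw [hη']; field_simp
  have hmη : min η δg ≤ η := min_le_left _ _
  have hmδ : min η δg ≤ δg := min_le_right _ _
  refine ⟨ι, hι, Q, c, r, B, 2 ^ d * l, by positivity, hr, hQm, hQd, hQc, hB, hB0, hBs, ?_, hG,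
    hV.trans (ENNReal.ofReal_le_ofReal ?_), Hg _ (hV.trans (ENNReal.ofReal_le_ofReal ?_))⟩
  · refine hBn.trans ?_
    rw [pow_succ] at key
    nlinarith
  · rw [le_div_iff₀ (by positivity)]
    have : 2 ^ d / l * (∫ x in ⋃ i, Q i, ‖f x‖) * (2 ^ d * l) =
        4 ^ d * ∫ x in ⋃ i, Q i, ‖f x‖ := by
      rw [← h24]; field_simp
    rw [this]
    rw [pow_succ] at key
    nlinarith
  · have h1 : 2 ^ d / l * ∫ x in ⋃ i, Q i, ‖f x‖ ≤ 2 ^ d * η' := by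
      refine mul_le_mul ?_ hQf (integral_nonneg fun x => norm_nonneg _) (by positivity)
      exact div_le_self (by positivity) hl1
    refine h1.trans ?_
    rw [pow_succ, ← h24] at key
    nlinarith [mul_pos hη'0 (by positivity : (0 : ℝ) < 2 ^ d)]

/-- Convolution of an integrable function with a bounded continuous kernel is continuous. -/
lemma continuous_integral_mul_sub {d : ℕ} {K u : (Fin d → ℝ) → ℂ} (hK : Continuous K) {C : ℝ}
    (hC : ∀ x, ‖K x‖ ≤ C) (hu : Integrable u) :
    Continuous fun x => ∫ y, u y * K (x - y) := by
  refine continuous_of_dominated (bound := fun y => ‖u y‖ * C) (fun x => ?_) (fun x => ?_)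
    (hu.norm.mul_const C) ?_
  · exact hu.aestronglyMeasurable.mul (by fun_prop : Continuous fun y => K (x - y)).aestronglyMeasurable
  · refine Eventually.of_forall fun y => ?_
    rw [norm_mul]
    gcongr
    exact hC _
  · exact Eventually.of_forall fun y => by fun_prop

lemma integrable_mul_sub {d : ℕ} {K u : (Fin d → ℝ) → ℂ} (hK : Continuous K) {C : ℝ}
    (hC : ∀ x, ‖K x‖ ≤ C) (hu : Integrable u) (x : Fin d → ℝ) :
    Integrable fun y => u y * K (x - y) := by
  refine hu.mul_bdd (c := C) (by fun_prop : Continuous fun y => K (x - y)).aestronglyMeasurable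
    (Eventually.of_forall fun y => hC _)

lemma norm_integral_mul_sub_le {d : ℕ} {K u : (Fin d → ℝ) → ℂ} {C : ℝ}
    (hC : ∀ x, ‖K x‖ ≤ C) (hu : Integrable u) (x : Fin d → ℝ) :
    ‖∫ y, u y * K (x - y)‖ ≤ (∫ y, ‖u y‖) * C := by
  rw [← integral_mul_const]
  refine norm_integral_le_of_norm_le (hu.norm.mul_const C) (Eventually.of_forall fun y => ?_)
  rw [norm_mul]
  gcongr
  exact hC _

lemma lintegral_compl_enorm_conv_le {d : ℕ} {K : (Fin d → ℝ) → ℂ} (hK : Continuous K) {C : ℝ}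
    (hC : ∀ x, ‖K x‖ ≤ C) {H : ℝ≥0∞}
    (hH : ∀ r > 0, ∀ h : Fin d → ℝ, ‖h‖ ≤ r →
      ∫⁻ x in {x | 2 * r < ‖x‖}, ‖K (x - h) - K x‖ₑ ≤ H)
    {ι : Type} [Countable ι] {Q : ι → Set (Fin d → ℝ)} {c : ι → Fin d → ℝ} {r : ι → ℝ}
    {B : (Fin d → ℝ) → ℂ} (hr : ∀ i, 0 < r i) (hQm : ∀ i, MeasurableSet (Q i))
    (hQd : Pairwise (Function.onFun Disjoint Q)) (hQc : ∀ i, Q i ⊆ Metric.closedBall (c i) (r i))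
    (hB : Integrable B) (hB0 : ∀ i, ∫ x in Q i, B x = 0) (hBs : ∀ x, x ∉ ⋃ i, Q i → B x = 0) :
    ∫⁻ x in (⋃ i, Metric.closedBall (c i) (2 * r i))ᶜ, ‖∫ y, B y * K (x - y)‖ₑ ≤
      H * ∫⁻ x, ‖B x‖ₑ := by
  set E := (⋃ i, Metric.closedBall (c i) (2 * r i))ᶜ
  have hpt : ∀ x, ‖∫ y, B y * K (x - y)‖ₑ ≤
      ∑' i, ∫⁻ y in Q i, ‖B y‖ₑ * ‖K (x - y) - K (x - c i)‖ₑ := by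
    intro x
    have hi := integrable_mul_sub hK hC hB x
    have h1 : ∫ y, B y * K (x - y) = ∫ y in ⋃ i, Q i, B y * K (x - y) :=
      (setIntegral_eq_integral_of_forall_compl_eq_zero fun y hy => by
        rw [hBs y hy, zero_mul]).symm
    rw [h1, ← (hasSum_integral_iUnion hQm hQd hi.integrableOn).tsum_eq]
    refine (enorm_tsum_le_tsum_enorm).trans (ENNReal.tsum_le_tsum fun i => ?_)
    have h2 : ∫ y in Q i, B y * K (x - y) = ∫ y in Q i, B y * (K (x - y) - K (x - c i)) := by
      simp_rw [mul_sub]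
      rw [integral_sub hi.integrableOn (hB.mul_const _).integrableOn, integral_mul_const, hB0,
        zero_mul, sub_zero]
    rw [h2]
    refine (enorm_integral_le_lintegral_enorm _).trans (le_of_eq ?_)
    simp_rw [enorm_mul]
  have hmeas : ∀ i, AEMeasurable
      (fun p : (Fin d → ℝ) × (Fin d → ℝ) => ‖B p.2‖ₑ * ‖K (p.1 - p.2) - K (p.1 - c i)‖ₑ)
      ((volume.restrict E).prod (volume.restrict (Q i))) := by
    intro i
    have h1 : AEMeasurable (fun p : (Fin d → ℝ) × (Fin d → ℝ) => ‖B p.2‖ₑ)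
        ((volume.restrict E).prod (volume.restrict (Q i))) :=
      (hB.aestronglyMeasurable.restrict.comp_snd).enorm
    exact h1.mul (by fun_prop : Continuous fun p : (Fin d → ℝ) × (Fin d → ℝ) =>
        ‖K (p.1 - p.2) - K (p.1 - c i)‖ₑ).measurable.aemeasurable
  calc ∫⁻ x in E, ‖∫ y, B y * K (x - y)‖ₑ
      ≤ ∫⁻ x in E, ∑' i, ∫⁻ y in Q i, ‖B y‖ₑ * ‖K (x - y) - K (x - c i)‖ₑ :=
        lintegral_mono hpt
    _ = ∑' i, ∫⁻ x in E, ∫⁻ y in Q i, ‖B y‖ₑ * ‖K (x - y) - K (x - c i)‖ₑ :=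
        lintegral_tsum fun i => (hmeas i).lintegral_prod_right'
    _ = ∑' i, ∫⁻ y in Q i, ∫⁻ x in E, ‖B y‖ₑ * ‖K (x - y) - K (x - c i)‖ₑ := by
        congr 1 with i
        exact lintegral_lintegral_swap (hmeas i)
    _ ≤ ∑' i, ∫⁻ y in Q i, H * ‖B y‖ₑ := by
        refine ENNReal.tsum_le_tsum fun i => setLIntegral_mono' (hQm i) fun y hy => ?_
        rw [lintegral_const_mul' _ _ enorm_ne_top, mul_comm]
        gcongr
        have hy' : ‖y - c i‖ ≤ r i := by
          simpa [dist_eq_norm] using hQc i hy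
        refine le_trans ?_ (hH (r i) (hr i) (y - c i) hy')
        have hsub : E ⊆ (fun x => x - c i) ⁻¹' {x | 2 * r i < ‖x‖} := by
          intro x hx
          simp only [E, mem_compl_iff, mem_iUnion, not_exists, Metric.mem_closedBall, not_le,
            dist_eq_norm] at hx
          exact hx i
        refine (lintegral_mono_set hsub).trans (le_of_eq ?_)
        have := (measurePreserving_sub_right (volume : Measure (Fin d → ℝ)) (c i)).setLIntegral_comp_preimage
          (s := {x | 2 * r i < ‖x‖}) (measurableSet_lt measurable_const measurable_norm)
          (f := fun x => ‖K (x - (y - c i)) - K x‖ₑ)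
          (by fun_prop : Continuous fun x => ‖K (x - (y - c i)) - K x‖ₑ).measurable
        rw [← this]
        congr 1 with x
        congr 3
        abel
    _ = H * ∫⁻ y in ⋃ i, Q i, ‖B y‖ₑ := by
        rw [lintegral_iUnion hQm hQd, ← ENNReal.tsum_mul_left]
        congr 1 with i
        rw [lintegral_const_mul'' _ hB.aestronglyMeasurable.restrict.enorm]
    _ ≤ _ := by
        gcongr
        exact Measure.restrict_le_self

lemma integral_norm_sq_le_mul {d : ℕ} {u : (Fin d → ℝ) → ℂ} (hu : Integrable u) {C : ℝ}
    (hC : ∀ᵐ x, ‖u x‖ ≤ C) : ∫ x, ‖u x‖ ^ 2 ≤ C * ∫ x, ‖u x‖ := by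
  rw [← integral_const_mul]
  refine integral_mono_of_nonneg (Eventually.of_forall fun x => by positivity)
    (hu.norm.const_mul C) ?_
  filter_upwards [hC] with x hx
  rw [sq]
  exact mul_le_mul_of_nonneg_right hx (norm_nonneg _)

lemma setIntegral_union_norm_le {d : ℕ} {u : (Fin d → ℝ) → ℂ} (hu : Integrable u)
    {A W : Set (Fin d → ℝ)} (hA : MeasurableSet A) (hW : MeasurableSet W) :
    ∫ x in A ∪ W, ‖u x‖ ≤ (∫ x in A, ‖u x‖) + ∫ x in W, ‖u x‖ := by
  have h := setIntegral_union (s := A) (t := W \ A) (μ := volume) (f := fun x => ‖u x‖)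
    Set.disjoint_sdiff_right (hW.diff hA) hu.norm.integrableOn hu.norm.integrableOn
  rw [union_sdiff_self] at h
  rw [h]
  refine add_le_add le_rfl ?_
  exact setIntegral_mono_set hu.norm.integrableOn
    (Eventually.of_forall fun x => norm_nonneg _) (sdiff_subset).eventuallyLE

/-- Quantitative estimate for pairing a test function with a singular integral, given a
Calderón–Zygmund decomposition `f = (f - B) + B`. -/
lemma norm_integral_mul_conv_sub_le {d : ℕ} {K : (Fin d → ℝ) → ℂ} (hK : Continuous K) {CK : ℝ}
    (hKb : ∀ x, ‖K x‖ ≤ CK)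
    (hL2 : ∀ V G : (Fin d → ℝ) → ℂ, Integrable V → Integrable G → (∃ C, ∀ᵐ x, ‖V x‖ ≤ C) →
      (∃ C, ∀ᵐ x, ‖G x‖ ≤ C) →
      ‖∫ x, V x * ∫ y, G y * K (x - y)‖ ^ 2 ≤ (∫ x, ‖V x‖ ^ 2) * ∫ x, ‖G x‖ ^ 2)
    {H : ℝ≥0} (hH : ∀ r > 0, ∀ h : Fin d → ℝ, ‖h‖ ≤ r →
      ∫⁻ x in {x | 2 * r < ‖x‖}, ‖K (x - h) - K x‖ₑ ≤ H)
    {ψ : (Fin d → ℝ) → ℂ} (hψ : Integrable ψ) {M : ℝ} (hM : ∀ x, ‖ψ x‖ ≤ M) {C : ℝ}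
    (hC : ∀ u : (Fin d → ℝ) → ℂ, Integrable u →
      ‖∫ x, ψ x * ∫ y, u y * K (x - y)‖ ≤ C * ∫ x, ‖u x‖)
    {f g : (Fin d → ℝ) → ℂ} (hf : Integrable f) (hg : Integrable g)
    {ι : Type} [Countable ι] {Q : ι → Set (Fin d → ℝ)} {c : ι → Fin d → ℝ} {r : ι → ℝ}
    {B : (Fin d → ℝ) → ℂ} (hr : ∀ i, 0 < r i) (hQm : ∀ i, MeasurableSet (Q i))
    (hQd : Pairwise (Function.onFun Disjoint Q)) (hQc : ∀ i, Q i ⊆ Metric.closedBall (c i) (r i))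
    (hB : Integrable B) (hB0 : ∀ i, ∫ x in Q i, B x = 0) (hBs : ∀ x, x ∉ ⋃ i, Q i → B x = 0)
    {l : ℝ} (hl : 0 < l) (hG : ∀ᵐ x, ‖f x - B x‖ ≤ l)
    (hV : volume (⋃ i, Metric.closedBall (c i) (2 * r i)) ≠ ∞)
    {A : Set (Fin d → ℝ)} (hA : MeasurableSet A) {δ : ℝ} (hδ : 0 ≤ δ)
    (hAδ : ∀ x ∉ A, ‖(∫ y, f y * K (x - y)) - g x‖ ≤ δ) :
    ‖(∫ x, ψ x * ∫ y, f y * K (x - y)) - ∫ x, ψ x * g x‖ ≤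
      δ * (∫ x, ‖ψ x‖) + (M * (∫ x in ⋃ i, Metric.closedBall (c i) (2 * r i), ‖g x‖) +
        ∫ x in A, ‖ψ x * g x‖) +
      √((M * (M * volume.real (⋃ i, Metric.closedBall (c i) (2 * r i)) + ∫ x in A, ‖ψ x‖)) *
        (l * ((∫ x, ‖f x‖) + ∫ x, ‖B x‖))) + C * (∫ x, ‖B x‖) + M * (H * ∫ x, ‖B x‖) := by
  set W := ⋃ i, Metric.closedBall (c i) (2 * r i)
  have hW : MeasurableSet W := MeasurableSet.iUnion fun i => measurableSet_closedBall
  have hM0 : 0 ≤ M := (norm_nonneg _).trans (hM 0)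
  set F := A ∪ W
  have hF : MeasurableSet F := hA.union hW
  have hGi : Integrable fun x => f x - B x := hf.sub hB
  have hint : ∀ u : (Fin d → ℝ) → ℂ, Integrable u →
      Integrable fun x => ψ x * ∫ y, u y * K (x - y) := fun u hu =>
    hψ.mul_bdd (continuous_integral_mul_sub hK hKb hu).aestronglyMeasurable
      (Eventually.of_forall fun x => norm_integral_mul_sub_le hKb hu x)
  have hψg : Integrable fun x => ψ x * g x :=
    hg.bdd_mul hψ.aestronglyMeasurable (Eventually.of_forall hM)
  have hsplit : ∀ x, ∫ y, f y * K (x - y) =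
      (∫ y, (f y - B y) * K (x - y)) + ∫ y, B y * K (x - y) := fun x => by
    rw [← integral_add (integrable_mul_sub hK hKb hGi x) (integrable_mul_sub hK hKb hB x)]
    congr 1 with y
    ring
  have hid : (∫ x, ψ x * ∫ y, f y * K (x - y)) - ∫ x, ψ x * g x =
      (∫ x in Fᶜ, ψ x * ((∫ y, f y * K (x - y)) - g x)) - (∫ x in F, ψ x * g x) +
      (∫ x, F.indicator ψ x * ∫ y, (f y - B y) * K (x - y)) +
      (∫ x, ψ x * ∫ y, B y * K (x - y)) - ∫ x in Fᶜ, ψ x * ∫ y, B y * K (x - y) := by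
    have e1 := integral_add_compl hF (hint f hf)
    have e2 := integral_add_compl hF hψg
    have e3 := integral_add_compl hF (hint B hB)
    have e4 : ∫ x in Fᶜ, ψ x * ((∫ y, f y * K (x - y)) - g x) =
        (∫ x in Fᶜ, ψ x * ∫ y, f y * K (x - y)) - ∫ x in Fᶜ, ψ x * g x := by
      rw [← integral_sub (hint f hf).integrableOn hψg.integrableOn]
      simp_rw [mul_sub]
    have e5 : ∫ x in F, ψ x * ∫ y, f y * K (x - y) =
        (∫ x in F, ψ x * ∫ y, (f y - B y) * K (x - y)) +
          ∫ x in F, ψ x * ∫ y, B y * K (x - y) := by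
      rw [← integral_add (hint _ hGi).integrableOn (hint _ hB).integrableOn]
      simp_rw [hsplit, mul_add]
    have e6 : ∫ x, F.indicator ψ x * ∫ y, (f y - B y) * K (x - y) =
        ∫ x in F, ψ x * ∫ y, (f y - B y) * K (x - y) := by
      rw [← integral_indicator hF]
      congr 1 with x
      by_cases hx : x ∈ F <;> simp [hx]
    rw [e4, e6, ← e1, ← e2, ← e3, e5]
    ring
  have b1 : ‖∫ x in Fᶜ, ψ x * ((∫ y, f y * K (x - y)) - g x)‖ ≤ δ * ∫ x, ‖ψ x‖ := by
    calc _ ≤ ∫ x in Fᶜ, ‖ψ x‖ * δ := by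
          refine norm_integral_le_of_norm_le (hψ.norm.mul_const δ).integrableOn ?_
          refine (ae_restrict_iff' hF.compl).2 (Eventually.of_forall fun x hx => ?_)
          rw [norm_mul]
          gcongr
          exact hAδ x fun h => hx (Or.inl h)
      _ ≤ ∫ x, ‖ψ x‖ * δ := setIntegral_le_integral (hψ.norm.mul_const δ)
          (Eventually.of_forall fun x => by positivity)
      _ = _ := by rw [integral_mul_const, mul_comm]
  have b2 : ‖∫ x in F, ψ x * g x‖ ≤ M * (∫ x in W, ‖g x‖) + ∫ x in A, ‖ψ x * g x‖ := by
    refine (norm_integral_le_integral_norm _).trans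
      ((setIntegral_union_norm_le hψg hA hW).trans ?_)
    rw [add_comm, ← integral_const_mul]
    refine add_le_add ?_ le_rfl
    refine integral_mono hψg.norm.integrableOn (hg.norm.const_mul M).integrableOn fun x => ?_
    simp only [norm_mul]
    gcongr
    exact hM x
  have b3 : ‖∫ x, F.indicator ψ x * ∫ y, (f y - B y) * K (x - y)‖ ≤
      √((M * (M * volume.real W + ∫ x in A, ‖ψ x‖)) *
        (l * ((∫ x, ‖f x‖) + ∫ x, ‖B x‖))) := by
    refine Real.le_sqrt_of_sq_le ?_
    have hVb : ∀ x, ‖F.indicator ψ x‖ ≤ M := fun x =>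
      (norm_indicator_le_norm_self _ _).trans (hM x)
    have hVi : Integrable (F.indicator ψ) := hψ.indicator hF
    refine (hL2 _ _ hVi hGi ⟨M, Eventually.of_forall hVb⟩ ⟨l, hG⟩).trans ?_
    refine mul_le_mul ?_ ?_ (integral_nonneg fun x => by positivity) ?_
    · refine (integral_norm_sq_le_mul hVi (Eventually.of_forall hVb)).trans ?_
      gcongr
      have : ∫ x, ‖F.indicator ψ x‖ = ∫ x in F, ‖ψ x‖ := by
        rw [← integral_indicator hF]
        congr 1 with x
        exact norm_indicator_eq_indicator_norm _ _
      rw [this]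
      refine (setIntegral_union_norm_le hψ hA hW).trans ?_
      rw [add_comm]
      gcongr
      have := setIntegral_mono_on (μ := volume) (s := W) hψ.norm.integrableOn
        (integrableOn_const hV) hW (fun x _ => hM x)
      rwa [setIntegral_const, smul_eq_mul, mul_comm] at this
    · refine (integral_norm_sq_le_mul hGi hG).trans ?_
      gcongr
      rw [← integral_add hf.norm hB.norm]
      exact integral_mono hGi.norm (hf.norm.add hB.norm) fun x => norm_sub_le _ _
    · exact mul_nonneg hM0 (add_nonneg (by positivity) (integral_nonneg fun x => norm_nonneg _))
  have b5 : ‖∫ x in Fᶜ, ψ x * ∫ y, B y * K (x - y)‖ ≤ M * (H * ∫ x, ‖B x‖) := by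
    have hl1 := lintegral_compl_enorm_conv_le hK hKb hH hr hQm hQd hQc hB hB0 hBs
    have hfin : (H : ℝ≥0∞) * ∫⁻ x, ‖B x‖ₑ ≠ ∞ := ENNReal.mul_ne_top ENNReal.coe_ne_top hB.2.ne
    have hcm := continuous_integral_mul_sub hK hKb hB
    have hBi : IntegrableOn (fun x => ∫ y, B y * K (x - y)) Wᶜ :=
      ⟨hcm.aestronglyMeasurable, lt_of_le_of_lt hl1 hfin.lt_top⟩
    have h3 : ∫ x in Wᶜ, ‖∫ y, B y * K (x - y)‖ ≤ H * ∫ x, ‖B x‖ := by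
      rw [integral_norm_eq_lintegral_enorm hcm.aestronglyMeasurable,
        integral_norm_eq_lintegral_enorm hB.aestronglyMeasurable]
      have := ENNReal.toReal_mono hfin hl1
      rwa [ENNReal.toReal_mul, ENNReal.coe_toReal] at this
    have hFW : Fᶜ ⊆ Wᶜ := compl_subset_compl.2 subset_union_right
    calc _ ≤ ∫ x in Fᶜ, M * ‖∫ y, B y * K (x - y)‖ := by
          refine norm_integral_le_of_norm_le ((hBi.mono_set hFW).norm.const_mul M) ?_
          refine Eventually.of_forall fun x => ?_
          rw [norm_mul]
          gcongr
          exact hM x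
      _ = M * ∫ x in Fᶜ, ‖∫ y, B y * K (x - y)‖ := integral_const_mul _ _
      _ ≤ M * (H * ∫ x, ‖B x‖) := by
          gcongr
          refine (setIntegral_mono_set hBi.norm
            (Eventually.of_forall fun x => norm_nonneg _) hFW.eventuallyLE).trans h3
  rw [hid]
  refine (norm_sub_le _ _).trans (add_le_add ?_ b5)
  refine (norm_add_le _ _).trans (add_le_add ?_ (hC B hB))
  refine (norm_add_le _ _).trans (add_le_add ?_ b3)
  exact (norm_sub_le _ _).trans (add_le_add b1 b2)

/-- Pairing a test function with approximate singular integrals converging a.e. to an integrable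
function. -/
theorem tendsto_integral_mul_conv {d : ℕ} {K : ℕ → (Fin d → ℝ) → ℂ} (hK : ∀ n, Continuous (K n))
    (hKb : ∀ n, ∃ C, ∀ x, ‖K n x‖ ≤ C)
    (hL2 : ∀ n, ∀ V G : (Fin d → ℝ) → ℂ, Integrable V → Integrable G →
      (∃ C, ∀ᵐ x, ‖V x‖ ≤ C) → (∃ C, ∀ᵐ x, ‖G x‖ ≤ C) →
      ‖∫ x, V x * ∫ y, G y * K n (x - y)‖ ^ 2 ≤ (∫ x, ‖V x‖ ^ 2) * ∫ x, ‖G x‖ ^ 2)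
    {H : ℝ≥0} (hH : ∀ n, ∀ r > 0, ∀ h : Fin d → ℝ, ‖h‖ ≤ r →
      ∫⁻ x in {x | 2 * r < ‖x‖}, ‖K n (x - h) - K n x‖ₑ ≤ H)
    {ψ : (Fin d → ℝ) → ℂ} (hψ : Integrable ψ) {M : ℝ} (hM : ∀ x, ‖ψ x‖ ≤ M) {C : ℝ}
    (hC : ∀ n, ∀ u : (Fin d → ℝ) → ℂ, Integrable u →
      ‖∫ x, ψ x * ∫ y, u y * K n (x - y)‖ ≤ C * ∫ x, ‖u x‖)
    {f g : (Fin d → ℝ) → ℂ} (hf : Integrable f) (hg : Integrable g)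
    (hlim : ∀ᵐ x, Tendsto (fun n => ∫ y, f y * K n (x - y)) atTop (𝓝 (g x))) :
    Tendsto (fun n => ∫ x, ψ x * ∫ y, f y * K n (x - y)) atTop (𝓝 (∫ x, ψ x * g x)) := by
  wlog hgm : StronglyMeasurable g generalizing g with hw
  · have h := hw (g := hg.1.mk g) (hg.congr hg.1.ae_eq_mk) (by
      filter_upwards [hlim, hg.1.ae_eq_mk] with x h1 h2
      rwa [← h2]) hg.1.stronglyMeasurable_mk
    have e : ∫ x, ψ x * g x = ∫ x, ψ x * hg.1.mk g x :=
      integral_congr_ae (by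
        filter_upwards [hg.1.ae_eq_mk] with x h2
        rw [← h2])
    rwa [e]
  rw [Metric.tendsto_atTop']
  simp_rw [dist_eq_norm]
  intro ε hε
  have hM0 : 0 ≤ M := (norm_nonneg _).trans (hM 0)
  have hψg : Integrable fun x => ψ x * g x :=
    hg.bdd_mul hψ.aestronglyMeasurable (Eventually.of_forall hM)
  set N := ∫ x, ‖f x‖
  have hN : 0 ≤ N := integral_nonneg fun x => norm_nonneg _
  let Φ : ℝ → ℝ := fun η => η * (∫ x, ‖ψ x‖) + (M * η + 0) +
    √((M * (M * η)) * (N + η)) + |C| * η + M * (H * η)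
  have hΦ : ∃ η > 0, Φ η < ε := by
    have hc : Continuous Φ := by fun_prop
    have h0 : Φ 0 < ε := by simpa [Φ] using hε
    have := (hc.continuousAt.eventually_lt continuousAt_const h0).filter_mono
      (nhdsWithin_le_nhds (s := Ioi 0))
    obtain ⟨η, h1, h2⟩ := (this.and self_mem_nhdsWithin).exists
    exact ⟨η, h2, h1⟩
  obtain ⟨η, hη, hΦη⟩ := hΦ
  obtain ⟨ι, hι, Q, c, r, B, l, hl, hr, hQm, hQd, hQc, hB, hB0, hBs, hBn, hG, hV, hVg⟩ :=
    exists_calderonZygmund_decomposition_small hf hg hη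
  have hcont : ∀ n, Continuous fun x => ∫ y, f y * K n (x - y) := fun n => by
    obtain ⟨c, hc⟩ := hKb n
    exact continuous_integral_mul_sub (hK n) hc hf
  let A : ℕ → Set (Fin d → ℝ) := fun n => {x | η < ‖(∫ y, f y * K n (x - y)) - g x‖}
  have hA : ∀ n, MeasurableSet (A n) := fun n =>
    measurableSet_lt measurable_const ((hcont n).measurable.sub hgm.measurable).norm
  have hAlim : ∀ u : (Fin d → ℝ) → ℂ, Integrable u →
      Tendsto (fun n => ∫ x in A n, ‖u x‖) atTop (𝓝 0) := by
    intro u hu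
    have : Tendsto (fun n => ∫ x, (A n).indicator (fun x => ‖u x‖) x) atTop
        (𝓝 (∫ x : Fin d → ℝ, (0 : ℝ))) := by
      refine tendsto_integral_of_dominated_convergence (fun x => ‖u x‖)
        (fun n => (hu.norm.indicator (hA n)).aestronglyMeasurable) hu.norm
        (fun n => Eventually.of_forall fun x => ?_) ?_
      · refine (norm_indicator_le_norm_self _ _).trans ?_
        rw [norm_norm]
      · filter_upwards [hlim] with x hx
        have h1 : Tendsto (fun n => ‖(∫ y, f y * K n (x - y)) - g x‖) atTop (𝓝 0) := by
          simpa using (hx.sub_const (g x)).norm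
        refine tendsto_const_nhds.congr' ?_
        filter_upwards [h1.eventually_lt_const hη] with n hn
        rw [indicator_of_notMem]
        simp only [A, mem_ofPred_eq, not_lt]
        exact hn.le
    simp only [integral_zero] at this
    refine this.congr fun n => integral_indicator (hA n)
  set W := ⋃ i, Metric.closedBall (c i) (2 * r i)
  have hW : volume W ≠ ∞ := (hV.trans_lt ENNReal.ofReal_lt_top).ne
  have hWr : volume.real W ≤ η / l := by
    have := ENNReal.toReal_mono ENNReal.ofReal_ne_top hV
    rwa [ENNReal.toReal_ofReal (by positivity)] at this
  have hn0 : 0 ≤ ∫ x, ‖B x‖ := integral_nonneg fun x => norm_nonneg _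
  have hbound : ∀ n, ‖(∫ x, ψ x * ∫ y, f y * K n (x - y)) - ∫ x, ψ x * g x‖ ≤
      η * (∫ x, ‖ψ x‖) + (M * η + ∫ x in A n, ‖ψ x * g x‖) +
      √((M * (M * η + l * ∫ x in A n, ‖ψ x‖)) * (N + η)) + |C| * η + M * (H * η) := by
    intro n
    obtain ⟨CK, hCK⟩ := hKb n
    have hAn : 0 ≤ ∫ x in A n, ‖ψ x‖ := integral_nonneg fun x => norm_nonneg _
    refine (norm_integral_mul_conv_sub_le (hK n) hCK (hL2 n) (hH n) hψ hM (hC n) hf hg hr hQm hQd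
      hQc hB hB0 hBs hl hG hW (hA n) hη.le fun x hx => not_lt.1 hx).trans ?_
    refine add_le_add (add_le_add (add_le_add (add_le_add le_rfl ?_) ?_) ?_) ?_
    · gcongr
    · refine Real.sqrt_le_sqrt ?_
      calc M * (M * volume.real W + ∫ x in A n, ‖ψ x‖) * (l * (N + ∫ x, ‖B x‖))
          ≤ M * (M * (η / l) + ∫ x in A n, ‖ψ x‖) * (l * (N + η)) := by gcongr
        _ = _ := by field_simp
    · exact mul_le_mul (le_abs_self C) hBn hn0 (abs_nonneg C)
    · gcongr
  have hlimb : Tendsto (fun n => η * (∫ x, ‖ψ x‖) + (M * η + ∫ x in A n, ‖ψ x * g x‖) +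
      √((M * (M * η + l * ∫ x in A n, ‖ψ x‖)) * (N + η)) + |C| * η + M * (H * η)) atTop
      (𝓝 (Φ η)) := by
    have h1 := hAlim _ hψg
    have h2 := hAlim _ hψ
    have h3 : Tendsto (fun n => √((M * (M * η + l * ∫ x in A n, ‖ψ x‖)) * (N + η))) atTop
        (𝓝 (√((M * (M * η + l * 0)) * (N + η)))) :=
      ((((h2.const_mul l).const_add _).const_mul M).mul_const _).sqrt
    have := ((((h1.const_add (M * η)).const_add (η * ∫ x, ‖ψ x‖)).add h3).add_const
      (|C| * η)).add_const (M * (H * η))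
    simpa [Φ] using this
  obtain ⟨n0, hn0⟩ := eventually_atTop.1 (hlimb.eventually_lt_const hΦη)
  exact ⟨n0, fun n hn => (hbound n).trans_lt (hn0 n hn.le)⟩

/-- The squared Euclidean norm. -/
def sqNorm {d : ℕ} (x : Fin d → ℝ) : ℝ := ∑ i, x i ^ 2

lemma sqNorm_nonneg {d : ℕ} (x : Fin d → ℝ) : 0 ≤ sqNorm x :=
  Finset.sum_nonneg fun _ _ => sq_nonneg _

lemma continuous_sqNorm {d : ℕ} : Continuous (sqNorm (d := d)) := by
  unfold sqNorm; fun_prop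

lemma continuous_dotP {d : ℕ} : Continuous fun p : (Fin d → ℝ) × (Fin d → ℝ) => dotP p.1 p.2 := by
  unfold dotP; fun_prop

/-- The character `e^{2πi ξ·x}`. -/
def chr {d : ℕ} (ξ x : Fin d → ℝ) : ℂ := Complex.exp (((2 * Real.pi * dotP ξ x : ℝ)) * Complex.I)

lemma norm_chr {d : ℕ} (ξ x : Fin d → ℝ) : ‖chr ξ x‖ = 1 := Complex.norm_exp_ofReal_mul_I _

lemma continuous_chr {d : ℕ} : Continuous fun p : (Fin d → ℝ) × (Fin d → ℝ) => chr p.1 p.2 := by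
  have := continuous_dotP (d := d)
  unfold chr; fun_prop

lemma continuous_chr_left {d : ℕ} (x : Fin d → ℝ) : Continuous fun ξ => chr ξ x :=
  continuous_chr.comp (by fun_prop : Continuous fun ξ => (ξ, x))

lemma continuous_chr_right {d : ℕ} (ξ : Fin d → ℝ) : Continuous fun x => chr ξ x :=
  continuous_chr.comp (by fun_prop : Continuous fun x => (ξ, x))

lemma dotP_comm {d : ℕ} (ξ x : Fin d → ℝ) : dotP ξ x = dotP x ξ := by
  simp only [dotP, mul_comm]

lemma chr_comm {d : ℕ} (ξ x : Fin d → ℝ) : chr ξ x = chr x ξ := by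
  simp only [chr, dotP_comm]

lemma chr_add {d : ℕ} (ξ x y : Fin d → ℝ) : chr ξ (x + y) = chr ξ x * chr ξ y := by
  simp only [chr, ← Complex.exp_add]
  congr 1
  simp only [dotP, Pi.add_apply, mul_add, Finset.sum_add_distrib]
  push_cast
  ring

lemma chr_neg {d : ℕ} (ξ x : Fin d → ℝ) : chr ξ (-x) = (starRingEnd ℂ) (chr ξ x) := by
  simp only [chr, ← Complex.exp_conj, map_mul, Complex.conj_ofReal, Complex.conj_I]
  congr 1
  simp only [dotP, Pi.neg_apply, mul_neg, Finset.sum_neg_distrib]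
  push_cast
  ring

lemma chr_sub {d : ℕ} (ξ x y : Fin d → ℝ) :
    chr ξ (x - y) = chr ξ x * (starRingEnd ℂ) (chr ξ y) := by
  rw [sub_eq_add_neg, chr_add, chr_neg]

lemma ftInv_eq {d : ℕ} (g : (Fin d → ℝ) → ℂ) (x : Fin d → ℝ) :
    ftInv g x = ∫ ξ, chr ξ x * g ξ := rfl

lemma ft_eq {d : ℕ} (f : (Fin d → ℝ) → ℂ) (ξ : Fin d → ℝ) :
    ft f ξ = ∫ x, (starRingEnd ℂ) (chr ξ x) * f x := by
  simp only [ft, chr, ← Complex.exp_conj, map_mul, Complex.conj_ofReal, Complex.conj_I]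
  congr 1 with x
  congr 2
  push_cast
  ring

lemma ftInv_conj {d : ℕ} (g : (Fin d → ℝ) → ℂ) (x : Fin d → ℝ) :
    ftInv (fun ξ => (starRingEnd ℂ) (g ξ)) x = (starRingEnd ℂ) (ft g x) := by
  rw [ftInv_eq, ft_eq, ← integral_conj]
  congr 1 with ξ
  rw [map_mul, Complex.conj_conj, chr_comm]

lemma norm_ft_le {d : ℕ} (f : (Fin d → ℝ) → ℂ) (ξ : Fin d → ℝ) : ‖ft f ξ‖ ≤ ∫ x, ‖f x‖ := by
  rw [ft_eq]
  refine (norm_integral_le_integral_norm _).trans (le_of_eq ?_)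
  simp_rw [norm_mul, RCLike.norm_conj, norm_chr, one_mul]

lemma norm_ftInv_le {d : ℕ} (f : (Fin d → ℝ) → ℂ) (ξ : Fin d → ℝ) :
    ‖ftInv f ξ‖ ≤ ∫ x, ‖f x‖ := by
  rw [ftInv_eq]
  refine (norm_integral_le_integral_norm _).trans (le_of_eq ?_)
  simp_rw [norm_mul, norm_chr, one_mul]

lemma continuous_ftInv {d : ℕ} {f : (Fin d → ℝ) → ℂ} (hf : Integrable f) :
    Continuous (ftInv f) := by
  refine continuous_of_dominated (bound := fun x => ‖f x‖) (fun ξ => ?_) (fun ξ => ?_) hf.norm ?_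
  · exact (continuous_chr_left ξ).aestronglyMeasurable.mul hf.1
  · refine Eventually.of_forall fun x => ?_
    show ‖chr x ξ * f x‖ ≤ _
    rw [norm_mul, norm_chr, one_mul]
  · exact Eventually.of_forall fun x => (continuous_chr_right x).mul_const _

lemma ft_eq_ftInv_neg {d : ℕ} (f : (Fin d → ℝ) → ℂ) (ξ : Fin d → ℝ) : ft f ξ = ftInv f (-ξ) := by
  rw [ft_eq, ftInv_eq]
  simp_rw [chr_neg, chr_comm]

lemma continuous_ft {d : ℕ} {f : (Fin d → ℝ) → ℂ} (hf : Integrable f) :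
    Continuous (ft f) := by
  have : ft f = fun ξ => ftInv f (-ξ) := funext fun ξ => ft_eq_ftInv_neg f ξ
  rw [this]
  exact (continuous_ftInv hf).comp continuous_neg

/-- Pairing with a convolution, on the Fourier side. -/
lemma integral_mul_conv_eq_ft {d : ℕ} {M V G : (Fin d → ℝ) → ℂ} (hM : Integrable M)
    (hV : Integrable V) (hG : Integrable G) :
    ∫ x, V x * ∫ y, G y * ftInv M (x - y) = ∫ ξ, M ξ * (ft G ξ * ftInv V ξ) := by
  have h1 : ∀ x, ∫ y, G y * ftInv M (x - y) = ∫ ξ, chr ξ x * (M ξ * ft G ξ) := by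
    intro x
    have hi : Integrable (fun p : (Fin d → ℝ) × (Fin d → ℝ) =>
        chr p.2 (x - p.1) * (G p.1 * M p.2)) (volume.prod volume) := by
      refine (hG.mul_prod hM).bdd_mul (c := 1) ?_ (Eventually.of_forall fun p => (norm_chr _ _).le)
      exact (continuous_chr.comp (by fun_prop : Continuous fun p : (Fin d → ℝ) × (Fin d → ℝ) =>
        (p.2, x - p.1))).aestronglyMeasurable
    have := integral_integral_swap (f := fun y ξ => chr ξ (x - y) * (G y * M ξ)) hi
    calc ∫ y, G y * ftInv M (x - y) = ∫ y, ∫ ξ, chr ξ (x - y) * (G y * M ξ) := by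
          congr 1 with y
          rw [ftInv_eq, ← integral_const_mul]
          congr 1 with ξ
          ring
      _ = ∫ ξ, ∫ y, chr ξ (x - y) * (G y * M ξ) := this
      _ = _ := by
          congr 1 with ξ
          rw [ft_eq, ← integral_const_mul, ← integral_const_mul]
          congr 1 with y
          rw [chr_sub]
          ring
  have hMG : Integrable fun ξ => M ξ * ft G ξ :=
    hM.mul_bdd (c := ∫ x, ‖G x‖) (continuous_ft hG).aestronglyMeasurable
      (Eventually.of_forall fun ξ => norm_ft_le G ξ)
  have hi : Integrable (fun p : (Fin d → ℝ) × (Fin d → ℝ) =>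
      chr p.2 p.1 * (V p.1 * (M p.2 * ft G p.2))) (volume.prod volume) := by
    refine (hV.mul_prod hMG).bdd_mul (c := 1) ?_ (Eventually.of_forall fun p => (norm_chr _ _).le)
    exact (continuous_chr.comp (by fun_prop : Continuous fun p : (Fin d → ℝ) × (Fin d → ℝ) =>
        (p.2, p.1))).aestronglyMeasurable
  have := integral_integral_swap (f := fun x ξ => chr ξ x * (V x * (M ξ * ft G ξ))) hi
  calc ∫ x, V x * ∫ y, G y * ftInv M (x - y)
      = ∫ x, ∫ ξ, chr ξ x * (V x * (M ξ * ft G ξ)) := by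
        congr 1 with x
        rw [h1, ← integral_const_mul]
        congr 1 with ξ
        ring
    _ = ∫ ξ, ∫ x, chr ξ x * (V x * (M ξ * ft G ξ)) := this
    _ = _ := by
        congr 1 with ξ
        rw [ftInv_eq, ← mul_assoc, ← integral_const_mul]
        congr 1 with x
        rw [chr_comm]
        ring

lemma integral_gaussian_chr_one {w : ℝ} (hw : 0 < w) (x : ℝ) :
    ∫ t : ℝ, Complex.exp (-(Real.pi * w ^ 2 : ℝ) * t ^ 2 + (2 * Real.pi * x * Complex.I) * t) =
      ((w⁻¹ * Real.exp (-(Real.pi * x ^ 2 / w ^ 2)) : ℝ) : ℂ) := by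
  have hre : (-((Real.pi * w ^ 2 : ℝ) : ℂ)).re < 0 := by
    rw [Complex.neg_re, Complex.ofReal_re]
    have := Real.pi_pos
    simp only [neg_lt_zero]; positivity
  have h := integral_cexp_quadratic hre (2 * Real.pi * x * Complex.I) 0
  simp only [add_zero] at h
  rw [h]
  have hπ := Real.pi_pos
  have h1 : ((Real.pi : ℂ) / - -((Real.pi * w ^ 2 : ℝ) : ℂ)) ^ (1 / 2 : ℂ) = ((w⁻¹ : ℝ) : ℂ) := by
    have : ((Real.pi : ℂ) / - -((Real.pi * w ^ 2 : ℝ) : ℂ)) = (((w⁻¹) ^ 2 : ℝ) : ℂ) := by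
      push_cast
      field_simp
    rw [this, show (1 / 2 : ℂ) = ((1 / 2 : ℝ) : ℂ) by push_cast; ring,
      ← Complex.ofReal_cpow (by positivity), ← Real.sqrt_eq_rpow, Real.sqrt_sq (by positivity)]
  rw [h1, Complex.ofReal_mul (w⁻¹), Complex.ofReal_exp]
  congr 2
  have : (Real.pi : ℂ) ≠ 0 := by exact_mod_cast hπ.ne'
  have hw' : (w : ℂ) ≠ 0 := by exact_mod_cast hw.ne'
  push_cast
  field_simp
  ring_nf
  rw [Complex.I_sq]
  ring

lemma integral_mul_gaussian_chr_one {w : ℝ} (hw : 0 < w) (x : ℝ) :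
    ∫ t : ℝ, (t : ℂ) *
      Complex.exp (-(Real.pi * w ^ 2 : ℝ) * t ^ 2 + (2 * Real.pi * x * Complex.I) * t) =
      Complex.I * (x / w ^ 2 : ℝ) * ((w⁻¹ * Real.exp (-(Real.pi * x ^ 2 / w ^ 2)) : ℝ) : ℂ) := by
  have hπ := Real.pi_pos
  have hre : 0 < (((Real.pi * w ^ 2 : ℝ) : ℂ)).re := by
    rw [Complex.ofReal_re]; positivity
  set e : ℝ → ℂ := fun t =>
    Complex.exp (-(Real.pi * w ^ 2 : ℝ) * t ^ 2 + (2 * Real.pi * x * Complex.I) * t) with he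
  have hei : Integrable e := by
    have := integrable_cexp_quadratic hre (2 * Real.pi * x * Complex.I) 0
    simpa only [add_zero] using this
  have hprod : ∀ t : ℝ, e t = Complex.exp (-(Real.pi * w ^ 2 : ℝ) * t ^ 2) *
      Complex.exp (((2 * Real.pi * x * t : ℝ) : ℂ) * Complex.I) := by
    intro t
    rw [he, ← Complex.exp_add]
    push_cast
    ring_nf
  have htei : Integrable fun t : ℝ => (t : ℂ) * e t := by
    have h := (integrable_mul_cexp_neg_mul_sq hre).mul_bdd (c := 1)
      (g := fun t : ℝ => Complex.exp (((2 * Real.pi * x * t : ℝ) : ℂ) * Complex.I))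
      (by fun_prop : Continuous fun t : ℝ =>
        Complex.exp (((2 * Real.pi * x * t : ℝ) : ℂ) * Complex.I)).aestronglyMeasurable
      (Eventually.of_forall fun t => (Complex.norm_exp_ofReal_mul_I _).le)
    refine h.congr (Eventually.of_forall fun t => ?_)
    simp only
    rw [hprod, mul_assoc]
  have hd : ∀ t : ℝ, HasDerivAt e ((-(2 * (Real.pi * w ^ 2 : ℝ)) : ℂ) * (t * e t) +
      (2 * Real.pi * x * Complex.I) * e t) t := by
    intro t
    have h1 : HasDerivAt (fun t : ℝ => (t : ℂ)) 1 t := Complex.ofRealCLM.hasDerivAt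
    have h2 := (((h1.pow 2).const_mul (-((Real.pi * w ^ 2 : ℝ) : ℂ))).add
      (h1.const_mul (2 * Real.pi * x * Complex.I))).cexp
    have h3 : HasDerivAt e (e t * (-((Real.pi * w ^ 2 : ℝ) : ℂ) *
      (((2 : ℕ) : ℂ) * (t : ℂ) ^ (2 - 1) * 1) + 2 * Real.pi * x * Complex.I * 1)) t := h2
    refine h3.congr_deriv ?_
    push_cast
    ring
  have h0 := integral_eq_zero_of_hasDerivAt_of_integrable hd
    ((htei.const_mul _).add (hei.const_mul _)) hei
  rw [integral_add (htei.const_mul _) (hei.const_mul _), integral_const_mul, integral_const_mul,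
    integral_gaussian_chr_one hw x] at h0
  have : (Real.pi : ℂ) ≠ 0 := by exact_mod_cast hπ.ne'
  have hw' : (w : ℂ) ≠ 0 := by exact_mod_cast hw.ne'
  have h3 := eq_neg_of_add_eq_zero_left h0
  refine mul_left_cancel₀ (a := (-(2 * (Real.pi * w ^ 2 : ℝ)) : ℂ)) (by
    push_cast
    exact neg_ne_zero.2 (mul_ne_zero two_ne_zero (mul_ne_zero this (pow_ne_zero _ hw')))) ?_
  rw [h3]
  push_cast
  field_simp

lemma chr_mul_gaussian_eq_prod {d : ℕ} (w : ℝ) (ξ x : Fin d → ℝ) :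
    chr ξ x * (Real.exp (-(Real.pi * w ^ 2 * sqNorm ξ)) : ℂ) =
      ∏ j, Complex.exp (-(Real.pi * w ^ 2 : ℝ) * (ξ j) ^ 2 +
        (2 * Real.pi * x j * Complex.I) * ξ j) := by
  rw [chr, Complex.ofReal_exp, ← Complex.exp_add, ← Complex.exp_sum]
  congr 1
  simp only [dotP, sqNorm, Finset.sum_add_distrib]
  push_cast
  simp only [Finset.mul_sum, Finset.sum_mul, ← Finset.sum_neg_distrib, ← Finset.sum_add_distrib]
  refine Finset.sum_congr rfl fun i _ => ?_
  ring

/-- Fourier transform of a Gaussian. -/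
lemma ftInv_gaussian {d : ℕ} {w : ℝ} (hw : 0 < w) (x : Fin d → ℝ) :
    ftInv (fun ξ => (Real.exp (-(Real.pi * w ^ 2 * sqNorm ξ)) : ℂ)) x =
      (((w⁻¹) ^ d * Real.exp (-(Real.pi / w ^ 2 * sqNorm x)) : ℝ) : ℂ) := by
  rw [ftInv_eq]
  simp_rw [chr_mul_gaussian_eq_prod]
  rw [integral_fintype_prod_volume_eq_prod (f := fun j (t : ℝ) =>
    Complex.exp (-(Real.pi * w ^ 2 : ℝ) * t ^ 2 + (2 * Real.pi * x j * Complex.I) * t))]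
  simp_rw [integral_gaussian_chr_one hw]
  rw [← Complex.ofReal_prod, Finset.prod_mul_distrib, ← Real.exp_sum, Finset.prod_const,
    Finset.card_univ, Fintype.card_fin]
  congr 4
  rw [sqNorm, Finset.sum_neg_distrib, Finset.mul_sum]
  congr 2 with i
  ring

/-- Fourier transform of a coordinate times a Gaussian. -/
lemma ftInv_coord_mul_gaussian {d : ℕ} {w : ℝ} (hw : 0 < w) (i : Fin d) (x : Fin d → ℝ) :
    ftInv (fun ξ => (ξ i : ℂ) * (Real.exp (-(Real.pi * w ^ 2 * sqNorm ξ)) : ℂ)) x =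
      Complex.I * ((x i * (w⁻¹) ^ (d + 2) * Real.exp (-(Real.pi / w ^ 2 * sqNorm x)) : ℝ) : ℂ) := by
  rw [ftInv_eq]
  have h1 : ∀ ξ : Fin d → ℝ, chr ξ x * ((ξ i : ℂ) * (Real.exp (-(Real.pi * w ^ 2 * sqNorm ξ)) : ℂ))
      = ∏ j, ((if j = i then (ξ j : ℂ) else 1) *
        Complex.exp (-(Real.pi * w ^ 2 : ℝ) * (ξ j) ^ 2 +
        (2 * Real.pi * x j * Complex.I) * ξ j)) := by
    intro ξ
    rw [Finset.prod_mul_distrib, Finset.prod_ite_eq' Finset.univ i, if_pos (Finset.mem_univ _),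
      ← chr_mul_gaussian_eq_prod]
    ring
  simp_rw [h1]
  rw [integral_fintype_prod_volume_eq_prod (f := fun j (t : ℝ) => (if j = i then (t : ℂ) else 1) *
    Complex.exp (-(Real.pi * w ^ 2 : ℝ) * t ^ 2 + (2 * Real.pi * x j * Complex.I) * t))]
  have h2 : ∀ j, ∫ t : ℝ, (if j = i then (t : ℂ) else 1) *
      Complex.exp (-(Real.pi * w ^ 2 : ℝ) * t ^ 2 + (2 * Real.pi * x j * Complex.I) * t) =
      (if j = i then Complex.I * (x j / w ^ 2 : ℝ) else 1) *
        ((w⁻¹ * Real.exp (-(Real.pi * x j ^ 2 / w ^ 2)) : ℝ) : ℂ) := by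
    intro j
    by_cases h : j = i
    · simp only [h, if_true]
      exact integral_mul_gaussian_chr_one hw _
    · simp only [h, if_false, one_mul]
      exact integral_gaussian_chr_one hw _
  simp_rw [h2]
  rw [Finset.prod_mul_distrib, Finset.prod_ite_eq' Finset.univ i, if_pos (Finset.mem_univ _)]
  have h3 := ftInv_gaussian hw x
  rw [ftInv_eq] at h3
  simp_rw [chr_mul_gaussian_eq_prod] at h3
  rw [integral_fintype_prod_volume_eq_prod (f := fun j (t : ℝ) =>
    Complex.exp (-(Real.pi * w ^ 2 : ℝ) * t ^ 2 + (2 * Real.pi * x j * Complex.I) * t))] at h3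
  simp_rw [integral_gaussian_chr_one hw] at h3
  rw [h3]
  push_cast
  rw [pow_add]
  field_simp

lemma integrable_gaussian {d : ℕ} {b : ℝ} (hb : 0 < b) :
    Integrable fun ξ : Fin d → ℝ => Real.exp (-(b * sqNorm ξ)) := by
  have h : Integrable fun ξ : Fin d → ℝ => ∏ i, Real.exp (-b * (ξ i) ^ 2) :=
    Integrable.fintype_prod (f := fun _ (t : ℝ) => Real.exp (-b * t ^ 2))
      fun _ => integrable_exp_neg_mul_sq hb
  refine h.congr (Eventually.of_forall fun ξ => ?_)
  simp only
  rw [← Real.exp_sum, sqNorm, Finset.mul_sum, ← Finset.sum_neg_distrib]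
  simp only [neg_mul]

lemma integrable_coord_mul_gaussian {d : ℕ} {b : ℝ} (hb : 0 < b) (i : Fin d) :
    Integrable fun ξ : Fin d → ℝ => ξ i * Real.exp (-(b * sqNorm ξ)) := by
  have h : Integrable fun ξ : Fin d → ℝ =>
      ∏ j, ((if j = i then ξ j else 1) * Real.exp (-b * (ξ j) ^ 2)) := by
    refine Integrable.fintype_prod (f := fun j (t : ℝ) =>
      (if j = i then t else 1) * Real.exp (-b * t ^ 2)) fun j => ?_
    by_cases hj : j = i
    · simpa only [hj, if_true] using integrable_mul_exp_neg_mul_sq hb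
    · simpa only [hj, if_false, one_mul] using integrable_exp_neg_mul_sq hb
  refine h.congr (Eventually.of_forall fun ξ => ?_)
  simp only
  rw [Finset.prod_mul_distrib, Finset.prod_ite_eq' Finset.univ i, if_pos (Finset.mem_univ _),
    ← Real.exp_sum, sqNorm, Finset.mul_sum, ← Finset.sum_neg_distrib]
  simp only [neg_mul]

lemma integral_gaussian_eq {d : ℕ} {w : ℝ} (hw : 0 < w) :
    ∫ x : Fin d → ℝ, (w⁻¹) ^ d * Real.exp (-(Real.pi / w ^ 2 * sqNorm x)) = 1 := by
  have h := ftInv_gaussian (d := d) (inv_pos.2 hw) 0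
  rw [ftInv_eq] at h
  have h1 : ∀ ξ : Fin d → ℝ, chr ξ 0 = 1 := fun ξ => by simp [chr, dotP]
  simp_rw [h1, one_mul] at h
  rw [integral_complex_ofReal] at h
  have h2 := Complex.ofReal_injective h
  rw [integral_const_mul]
  have h3 : ∀ x : Fin d → ℝ, Real.pi / w ^ 2 * sqNorm x = Real.pi * w⁻¹ ^ 2 * sqNorm x := fun x => by
    field_simp
  simp_rw [h3]
  rw [h2]
  simp [sqNorm]
  field_simp

lemma two_mul_enorm_mul_le (a b : ℂ) : 2 * (‖a‖ₑ * ‖b‖ₑ) ≤ ‖a‖ₑ ^ 2 + ‖b‖ₑ ^ 2 := by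
  have h : 2 * (‖a‖₊ * ‖b‖₊) ≤ ‖a‖₊ ^ 2 + ‖b‖₊ ^ 2 := by
    rw [← mul_assoc]; exact two_mul_le_add_sq _ _
  simp only [enorm]
  exact_mod_cast h

/-- Schur's test for a convolution kernel of mass one. -/
lemma lintegral_enorm_mul_conv_le {d : ℕ} {G : (Fin d → ℝ) → ℂ} (hG : AEStronglyMeasurable G)
    {γ : (Fin d → ℝ) → ℂ} (hγ : Continuous γ) (hγ1 : ∫⁻ x, ‖γ x‖ₑ = 1) :
    ∫⁻ x, ∫⁻ y, ‖G x‖ₑ * ‖G y‖ₑ * ‖γ (x - y)‖ₑ ≤ ∫⁻ x, ‖G x‖ₑ ^ 2 := by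
  have hm1 : AEMeasurable (fun p : (Fin d → ℝ) × (Fin d → ℝ) => ‖G p.1‖ₑ ^ 2 * ‖γ (p.1 - p.2)‖ₑ)
      (volume.prod volume) :=
    (hG.comp_fst.enorm.pow_const 2).mul
      (by fun_prop : Continuous fun p : (Fin d → ℝ) × (Fin d → ℝ) =>
        ‖γ (p.1 - p.2)‖ₑ).measurable.aemeasurable
  have hm2 : AEMeasurable (fun p : (Fin d → ℝ) × (Fin d → ℝ) => ‖G p.2‖ₑ ^ 2 * ‖γ (p.1 - p.2)‖ₑ)
      (volume.prod volume) :=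
    (hG.comp_snd.enorm.pow_const 2).mul
      (by fun_prop : Continuous fun p : (Fin d → ℝ) × (Fin d → ℝ) =>
        ‖γ (p.1 - p.2)‖ₑ).measurable.aemeasurable
  have hmm1 : ∀ x : Fin d → ℝ, AEMeasurable fun y => ‖G x‖ₑ ^ 2 * ‖γ (x - y)‖ₑ := fun x =>
    (by fun_prop : Continuous fun y => ‖γ (x - y)‖ₑ).measurable.aemeasurable.const_mul _
  have e1 : ∫⁻ x, ∫⁻ y, ‖G x‖ₑ ^ 2 * ‖γ (x - y)‖ₑ = ∫⁻ x, ‖G x‖ₑ ^ 2 := by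
    congr 1 with x
    rw [lintegral_const_mul' _ _ (by finiteness), lintegral_sub_left_eq_self (fun y => ‖γ y‖ₑ) x,
      hγ1, mul_one]
  have e2 : ∫⁻ x, ∫⁻ y, ‖G y‖ₑ ^ 2 * ‖γ (x - y)‖ₑ = ∫⁻ x, ‖G x‖ₑ ^ 2 := by
    rw [lintegral_lintegral_swap hm2]
    congr 1 with y
    rw [lintegral_const_mul' _ _ (by finiteness), lintegral_sub_right_eq_self (fun y => ‖γ y‖ₑ) y,
      hγ1, mul_one]
  have key : 2 * ∫⁻ x, ∫⁻ y, ‖G x‖ₑ * ‖G y‖ₑ * ‖γ (x - y)‖ₑ ≤ 2 * ∫⁻ x, ‖G x‖ₑ ^ 2 := by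
    calc 2 * ∫⁻ x, ∫⁻ y, ‖G x‖ₑ * ‖G y‖ₑ * ‖γ (x - y)‖ₑ
        = ∫⁻ x, ∫⁻ y, 2 * (‖G x‖ₑ * ‖G y‖ₑ * ‖γ (x - y)‖ₑ) := by
          rw [← lintegral_const_mul' _ _ (by finiteness)]
          congr 1 with x
          rw [lintegral_const_mul' _ _ (by finiteness)]
      _ ≤ ∫⁻ x, ∫⁻ y, (‖G x‖ₑ ^ 2 * ‖γ (x - y)‖ₑ + ‖G y‖ₑ ^ 2 * ‖γ (x - y)‖ₑ) := by
          refine lintegral_mono fun x => lintegral_mono fun y => ?_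
          simp only
          rw [← mul_assoc, ← add_mul]
          gcongr
          exact two_mul_enorm_mul_le _ _
      _ = ∫⁻ x, ((∫⁻ y, ‖G x‖ₑ ^ 2 * ‖γ (x - y)‖ₑ) + ∫⁻ y, ‖G y‖ₑ ^ 2 * ‖γ (x - y)‖ₑ) := by
          congr 1 with x
          exact lintegral_add_left' (hmm1 x) _
      _ = _ := by
          rw [lintegral_add_left' hm1.lintegral_prod_right', e1, e2, two_mul]
  exact (ENNReal.mul_le_mul_iff_right two_ne_zero (by finiteness)).1 key

/-- Bessel's inequality for the Fourier transform on `L¹ ∩ L²`. -/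
lemma lintegral_enorm_ft_sq_le {d : ℕ} {G : (Fin d → ℝ) → ℂ} (hG : Integrable G) :
    ∫⁻ ξ, ‖ft G ξ‖ₑ ^ 2 ≤ ∫⁻ x, ‖G x‖ₑ ^ 2 := by
  have hstep : ∀ w : ℝ, 0 < w →
      ∫⁻ ξ, ENNReal.ofReal (Real.exp (-(Real.pi * w ^ 2 * sqNorm ξ))) * ‖ft G ξ‖ₑ ^ 2 ≤
        ∫⁻ x, ‖G x‖ₑ ^ 2 := by
    intro w hw
    set M : (Fin d → ℝ) → ℂ := fun ξ => (Real.exp (-(Real.pi * w ^ 2 * sqNorm ξ)) : ℂ) with hMdef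
    have hMr : Integrable fun ξ : Fin d → ℝ => Real.exp (-(Real.pi * w ^ 2 * sqNorm ξ)) :=
      integrable_gaussian (mul_pos Real.pi_pos (pow_pos hw 2))
    have hM : Integrable M := hMr.ofReal
    have hγ : Continuous (ftInv M) := continuous_ftInv hM
    have hγe : ∀ x, ‖ftInv M x‖ₑ =
        ENNReal.ofReal ((w⁻¹) ^ d * Real.exp (-(Real.pi / w ^ 2 * sqNorm x))) := fun x => by
      rw [hMdef, ftInv_gaussian hw, ← ofReal_norm, Complex.norm_real,
        Real.norm_of_nonneg (by positivity)]
    have hγ1 : ∫⁻ x, ‖ftInv M x‖ₑ = 1 := by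
      simp_rw [hγe]
      rw [← ofReal_integral_eq_lintegral_ofReal, integral_gaussian_eq hw, ENNReal.ofReal_one]
      · exact (integrable_gaussian (div_pos Real.pi_pos (pow_pos hw 2))).const_mul _
      · exact Eventually.of_forall fun x => by positivity
    have hGc : Integrable fun x => (starRingEnd ℂ) (G x) :=
      (LinearIsometryEquiv.integrable_comp_iff Complex.conjLIE).2 hG
    have hpair := integral_mul_conv_eq_ft hM hGc hG
    have hr : ∀ ξ, M ξ * (ft G ξ * ftInv (fun x => (starRingEnd ℂ) (G x)) ξ) =
        ((Real.exp (-(Real.pi * w ^ 2 * sqNorm ξ)) * ‖ft G ξ‖ ^ 2 : ℝ) : ℂ) := by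
      intro ξ
      rw [ftInv_conj, Complex.mul_conj, Complex.normSq_eq_norm_sq, hMdef]
      push_cast
      rfl
    simp_rw [hr] at hpair
    rw [integral_complex_ofReal] at hpair
    have hint : Integrable fun ξ => Real.exp (-(Real.pi * w ^ 2 * sqNorm ξ)) * ‖ft G ξ‖ ^ 2 := by
      refine hMr.mul_bdd (c := (∫ x, ‖G x‖) ^ 2)
        ((continuous_ft hG).norm.pow 2).aestronglyMeasurable (Eventually.of_forall fun ξ => ?_)
      rw [norm_pow, norm_norm]
      gcongr
      exact norm_ft_le G ξ
    have hlhs : ∫⁻ ξ, ENNReal.ofReal (Real.exp (-(Real.pi * w ^ 2 * sqNorm ξ))) * ‖ft G ξ‖ₑ ^ 2 =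
        ‖∫ x, (starRingEnd ℂ) (G x) * ∫ y, G y * ftInv M (x - y)‖ₑ := by
      rw [hpair, ← ofReal_norm, Complex.norm_real, Real.norm_of_nonneg
        (integral_nonneg fun ξ => by positivity), ofReal_integral_eq_lintegral_ofReal hint
        (Eventually.of_forall fun ξ => by positivity)]
      congr 1 with ξ
      rw [ENNReal.ofReal_mul (by positivity), ENNReal.ofReal_pow (norm_nonneg _),
        ofReal_norm]
    rw [hlhs]
    refine le_trans ?_ (lintegral_enorm_mul_conv_le hG.1 hγ hγ1)
    refine (enorm_integral_le_lintegral_enorm _).trans (lintegral_mono fun x => ?_)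
    simp only
    rw [enorm_mul, RCLike.enorm_conj]
    calc ‖G x‖ₑ * ‖∫ y, G y * ftInv M (x - y)‖ₑ ≤ ‖G x‖ₑ * ∫⁻ y, ‖G y * ftInv M (x - y)‖ₑ := by
          gcongr
          exact enorm_integral_le_lintegral_enorm _
      _ = _ := by
          rw [← lintegral_const_mul' _ _ (by finiteness)]
          congr 1 with y
          rw [enorm_mul, mul_assoc]
  have hft := continuous_ft hG
  have hsq := continuous_sqNorm (d := d)
  have hlim : ∀ ξ : Fin d → ℝ, Tendsto (fun n : ℕ =>
      ENNReal.ofReal (Real.exp (-(Real.pi * (1 / ((n : ℝ) + 1)) ^ 2 * sqNorm ξ))) *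
        ‖ft G ξ‖ₑ ^ 2) atTop (𝓝 (‖ft G ξ‖ₑ ^ 2)) := by
    intro ξ
    have h1 : Tendsto (fun n : ℕ => Real.exp (-(Real.pi * (1 / ((n : ℝ) + 1)) ^ 2 * sqNorm ξ)))
        atTop (𝓝 (Real.exp (-(Real.pi * 0 ^ 2 * sqNorm ξ)))) :=
      (Real.continuous_exp.tendsto _).comp
        ((((tendsto_one_div_add_atTop_nhds_zero_nat.pow 2).const_mul _).mul_const _).neg)
    have h2 := ENNReal.Tendsto.mul_const (b := ‖ft G ξ‖ₑ ^ 2)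
      ((ENNReal.continuous_ofReal.tendsto _).comp h1) (Or.inr (by finiteness))
    simpa using h2
  calc ∫⁻ ξ, ‖ft G ξ‖ₑ ^ 2 = ∫⁻ ξ, liminf (fun n : ℕ =>
      ENNReal.ofReal (Real.exp (-(Real.pi * (1 / ((n : ℝ) + 1)) ^ 2 * sqNorm ξ))) *
        ‖ft G ξ‖ₑ ^ 2) atTop := by
        congr 1 with ξ
        exact (hlim ξ).liminf_eq.symm
    _ ≤ liminf (fun n : ℕ => ∫⁻ ξ,
      ENNReal.ofReal (Real.exp (-(Real.pi * (1 / ((n : ℝ) + 1)) ^ 2 * sqNorm ξ))) *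
        ‖ft G ξ‖ₑ ^ 2) atTop := by
        refine lintegral_liminf_le fun n => ?_
        exact (by fun_prop : Measurable fun ξ => ENNReal.ofReal
          (Real.exp (-(Real.pi * (1 / ((n : ℝ) + 1)) ^ 2 * sqNorm ξ)))).mul
          (hft.enorm.measurable.pow_const 2)
    _ ≤ liminf (fun _ : ℕ => ∫⁻ x, ‖G x‖ₑ ^ 2) atTop :=
        liminf_le_liminf (Eventually.of_forall fun n => hstep _ (by positivity))
    _ = _ := liminf_const _

lemma lintegral_enorm_ftInv_sq_le {d : ℕ} {G : (Fin d → ℝ) → ℂ} (hG : Integrable G) :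
    ∫⁻ ξ, ‖ftInv G ξ‖ₑ ^ 2 ≤ ∫⁻ x, ‖G x‖ₑ ^ 2 := by
  refine le_trans (le_of_eq ?_) (lintegral_enorm_ft_sq_le hG)
  rw [← lintegral_neg_eq_self]
  simp_rw [ft_eq_ftInv_neg]

lemma ofReal_integral_norm_sq {d : ℕ} {G : (Fin d → ℝ) → ℂ} (hG : Integrable G)
    (hb : ∃ C, ∀ᵐ x, ‖G x‖ ≤ C) :
    ENNReal.ofReal (∫ x, ‖G x‖ ^ 2) = ∫⁻ x, ‖G x‖ₑ ^ 2 := by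
  obtain ⟨C, hC⟩ := hb
  have hi : Integrable fun x => ‖G x‖ ^ 2 := by
    simp_rw [sq]
    exact hG.norm.mul_bdd (c := C) hG.norm.1 (by simpa using hC)
  rw [ofReal_integral_eq_lintegral_ofReal hi (Eventually.of_forall fun x => by positivity)]
  congr 1 with x
  rw [ENNReal.ofReal_pow (norm_nonneg _), ofReal_norm]

/-- Convolution with a kernel whose Fourier multiplier is bounded by one is an `L²` contraction. -/
lemma norm_integral_mul_conv_sq_le {d : ℕ} {M V G : (Fin d → ℝ) → ℂ} (hM : Integrable M)
    (hM1 : ∀ ξ, ‖M ξ‖ ≤ 1) (hV : Integrable V) (hG : Integrable G)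
    (hVb : ∃ C, ∀ᵐ x, ‖V x‖ ≤ C) (hGb : ∃ C, ∀ᵐ x, ‖G x‖ ≤ C) :
    ‖∫ x, V x * ∫ y, G y * ftInv M (x - y)‖ ^ 2 ≤ (∫ x, ‖V x‖ ^ 2) * ∫ x, ‖G x‖ ^ 2 := by
  rw [integral_mul_conv_eq_ft hM hV hG]
  have h1 : ‖∫ ξ, M ξ * (ft G ξ * ftInv V ξ)‖ₑ ≤ ∫⁻ ξ, ‖ft G ξ‖ₑ * ‖ftInv V ξ‖ₑ := by
    refine (enorm_integral_le_lintegral_enorm _).trans (lintegral_mono fun ξ => ?_)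
    simp only
    rw [enorm_mul, enorm_mul]
    refine mul_le_of_le_one_left' ?_
    rw [← ofReal_norm]
    exact ENNReal.ofReal_le_one.2 (hM1 ξ)
  have h2 := ENNReal.lintegral_mul_le_Lp_mul_Lq volume Real.HolderConjugate.two_two
    (continuous_ft hG).enorm.measurable.aemeasurable
    (continuous_ftInv hV).enorm.measurable.aemeasurable
  simp only [Pi.mul_apply, ENNReal.rpow_two] at h2
  have h3 : ‖∫ ξ, M ξ * (ft G ξ * ftInv V ξ)‖ₑ ^ 2 ≤
      (∫⁻ x, ‖V x‖ₑ ^ 2) * ∫⁻ x, ‖G x‖ₑ ^ 2 := by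
    calc _ ≤ ((∫⁻ ξ, ‖ft G ξ‖ₑ ^ 2) ^ (1 / 2 : ℝ) * (∫⁻ ξ, ‖ftInv V ξ‖ₑ ^ 2) ^ (1 / 2 : ℝ)) ^ 2 := by
          gcongr
          exact h1.trans h2
      _ = (∫⁻ ξ, ‖ft G ξ‖ₑ ^ 2) * ∫⁻ ξ, ‖ftInv V ξ‖ₑ ^ 2 := by
          rw [mul_pow, ← ENNReal.rpow_two, ← ENNReal.rpow_two, ← ENNReal.rpow_mul,
            ← ENNReal.rpow_mul]
          norm_num
      _ ≤ (∫⁻ x, ‖G x‖ₑ ^ 2) * ∫⁻ x, ‖V x‖ₑ ^ 2 :=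
          mul_le_mul' (lintegral_enorm_ft_sq_le hG) (lintegral_enorm_ftInv_sq_le hV)
      _ = _ := mul_comm _ _
  rw [← ofReal_integral_norm_sq hV hVb, ← ofReal_integral_norm_sq hG hGb,
    ← ENNReal.ofReal_mul (integral_nonneg fun x => by positivity), ← ofReal_norm,
    ← ENNReal.ofReal_pow (norm_nonneg _)] at h3
  exact (ENNReal.ofReal_le_ofReal_iff (mul_nonneg (integral_nonneg fun x => by positivity)
    (integral_nonneg fun x => by positivity))).1 h3

lemma eucNorm_eq {d : ℕ} (x : Fin d → ℝ) : eucNorm x = √(sqNorm x) := rfl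

lemma eucNorm_sq {d : ℕ} (x : Fin d → ℝ) : eucNorm x ^ 2 = sqNorm x :=
  Real.sq_sqrt (sqNorm_nonneg x)

lemma eucNorm_nonneg {d : ℕ} (x : Fin d → ℝ) : 0 ≤ eucNorm x := Real.sqrt_nonneg _

lemma continuous_eucNorm {d : ℕ} : Continuous (eucNorm (d := d)) :=
  Real.continuous_sqrt.comp continuous_sqNorm

lemma abs_apply_le_eucNorm {d : ℕ} (x : Fin d → ℝ) (i : Fin d) : |x i| ≤ eucNorm x := by
  refine Real.abs_le_sqrt ?_
  exact Finset.single_le_sum (f := fun i => x i ^ 2) (fun _ _ => sq_nonneg _) (Finset.mem_univ i)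

lemma norm_le_eucNorm {d : ℕ} (x : Fin d → ℝ) : ‖x‖ ≤ eucNorm x :=
  (pi_norm_le_iff_of_nonneg (eucNorm_nonneg x)).2 fun i => abs_apply_le_eucNorm x i

lemma eucNorm_pos {d : ℕ} {x : Fin d → ℝ} (hx : x ≠ 0) : 0 < eucNorm x :=
  (norm_pos_iff.2 hx).trans_le (norm_le_eucNorm x)

/-- Truncated Riesz multiplier: a superposition of coordinates times Gaussians. -/
def truncMult {d : ℕ} (i : Fin d) (a A : ℝ) (ξ : Fin d → ℝ) : ℂ :=
  (-2 * Complex.I) * ∫ w in Ioc a A, (ξ i : ℂ) * (Real.exp (-(Real.pi * w ^ 2 * sqNorm ξ)) : ℂ)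

/-- The smooth Riesz kernel associated with `truncMult`. -/
def truncKernel {d : ℕ} (i : Fin d) (a A : ℝ) (x : Fin d → ℝ) : ℝ :=
  2 * ∫ w in Ioc a A, x i * (w⁻¹) ^ (d + 2) * Real.exp (-(Real.pi / w ^ 2 * sqNorm x))

lemma integrable_coord_mul_gaussian_prod {d : ℕ} (i : Fin d) {a : ℝ} (ha : 0 < a) (A : ℝ) :
    Integrable (fun p : (Fin d → ℝ) × ℝ =>
      (p.1 i : ℂ) * (Real.exp (-(Real.pi * p.2 ^ 2 * sqNorm p.1)) : ℂ))
      (volume.prod (volume.restrict (Ioc a A))) := by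
  have h1 : Integrable (fun p : (Fin d → ℝ) × ℝ =>
      (p.1 i * Real.exp (-(Real.pi * a ^ 2 * sqNorm p.1))) * (1 : ℝ))
      (volume.prod (volume.restrict (Ioc a A))) :=
    (integrable_coord_mul_gaussian (mul_pos Real.pi_pos (pow_pos ha 2)) i).mul_prod
      (integrable_const _)
  have hsq := continuous_sqNorm (d := d)
  refine h1.mono (by fun_prop : Continuous _).aestronglyMeasurable ?_
  have e : (volume : Measure (Fin d → ℝ)).prod (volume.restrict (Ioc a A)) =
      (volume.prod volume).restrict (univ ×ˢ Ioc a A) := by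
    rw [← Measure.prod_restrict, Measure.restrict_univ]
  rw [e]
  refine (ae_restrict_iff' (MeasurableSet.univ.prod measurableSet_Ioc)).2
    (Eventually.of_forall fun p hp => ?_)
  have hw : a < p.2 := hp.2.1
  rw [norm_mul, Complex.norm_real, Complex.norm_real, mul_one, norm_mul, Real.norm_eq_abs (Real.exp _),
    Real.norm_eq_abs (Real.exp _), Real.abs_exp, Real.abs_exp]
  have := sqNorm_nonneg p.1
  have := Real.pi_pos
  gcongr

lemma integrable_truncMult {d : ℕ} (i : Fin d) {a : ℝ} (ha : 0 < a) (A : ℝ) :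
    Integrable (truncMult (d := d) i a A) :=
  (integrable_coord_mul_gaussian_prod i ha A).integral_prod_left.const_mul _

lemma ftInv_truncMult {d : ℕ} (i : Fin d) {a : ℝ} (ha : 0 < a) (A : ℝ) (x : Fin d → ℝ) :
    ftInv (truncMult i a A) x = (truncKernel i a A x : ℂ) := by
  have hi : Integrable (fun p : (Fin d → ℝ) × ℝ => chr p.1 x *
      ((p.1 i : ℂ) * (Real.exp (-(Real.pi * p.2 ^ 2 * sqNorm p.1)) : ℂ)))
      (volume.prod (volume.restrict (Ioc a A))) :=
    (integrable_coord_mul_gaussian_prod i ha A).bdd_mul (c := 1)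
      ((continuous_chr_left x).comp continuous_fst).aestronglyMeasurable
      (Eventually.of_forall fun p => (norm_chr _ _).le)
  have hs := integral_integral_swap (f := fun (ξ : Fin d → ℝ) (w : ℝ) => chr ξ x *
      ((ξ i : ℂ) * (Real.exp (-(Real.pi * w ^ 2 * sqNorm ξ)) : ℂ))) hi
  calc ftInv (truncMult i a A) x = ∫ ξ, (-2 * Complex.I) * ∫ w in Ioc a A, chr ξ x *
      ((ξ i : ℂ) * (Real.exp (-(Real.pi * w ^ 2 * sqNorm ξ)) : ℂ)) := by
        rw [ftInv_eq]
        congr 1 with ξ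
        rw [integral_const_mul, truncMult]
        ring
    _ = (-2 * Complex.I) * ∫ w in Ioc a A, Complex.I *
        ((x i * (w⁻¹) ^ (d + 2) * Real.exp (-(Real.pi / w ^ 2 * sqNorm x)) : ℝ) : ℂ) := by
        rw [integral_const_mul, hs]
        congr 1
        refine setIntegral_congr_fun measurableSet_Ioc fun w hw => ?_
        exact ftInv_coord_mul_gaussian (ha.trans hw.1) i x
    _ = _ := by
        rw [integral_const_mul, integral_complex_ofReal, truncKernel, ← mul_assoc,
          mul_assoc (-2), Complex.I_mul_I]
        push_cast
        ring

lemma continuous_truncKernel {d : ℕ} (i : Fin d) {a : ℝ} (ha : 0 < a) (A : ℝ) :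
    Continuous fun x : Fin d → ℝ => (truncKernel i a A x : ℂ) := by
  simp_rw [← ftInv_truncMult i ha A]
  exact continuous_ftInv (integrable_truncMult i ha A)

lemma norm_truncKernel_le {d : ℕ} (i : Fin d) {a : ℝ} (ha : 0 < a) (A : ℝ) (x : Fin d → ℝ) :
    ‖(truncKernel i a A x : ℂ)‖ ≤ ∫ ξ, ‖truncMult (d := d) i a A ξ‖ := by
  rw [← ftInv_truncMult i ha A]
  exact norm_ftInv_le _ _

lemma truncMult_eq {d : ℕ} (i : Fin d) (a A : ℝ) (ξ : Fin d → ℝ) :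
    truncMult i a A ξ =
      (-2 * Complex.I * ξ i) * ((∫ w in Ioc a A, Real.exp (-(Real.pi * w ^ 2 * sqNorm ξ)) : ℝ) : ℂ) := by
  rw [truncMult, integral_const_mul, integral_complex_ofReal]
  ring

lemma integrableOn_gaussian_radial {q : ℝ} (hq : 0 < q) :
    IntegrableOn (fun w : ℝ => Real.exp (-(Real.pi * w ^ 2 * q))) (Ioi 0) := by
  refine ((integrable_exp_neg_mul_sq (mul_pos Real.pi_pos hq)).congr
    (Eventually.of_forall fun w => ?_)).integrableOn
  simp only
  congr 1
  ring

lemma integral_gaussian_radial (q : ℝ) :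
    ∫ w in Ioi 0, Real.exp (-(Real.pi * w ^ 2 * q)) = 1 / (2 * √q) := by
  have h := integral_gaussian_Ioi (Real.pi * q)
  have e : ∀ w : ℝ, -(Real.pi * w ^ 2 * q) = -(Real.pi * q) * w ^ 2 := fun w => by ring
  simp_rw [e]
  rw [h, div_mul_eq_div_div, div_self Real.pi_pos.ne', Real.sqrt_div zero_le_one, Real.sqrt_one]
  rw [div_div, mul_comm]

lemma norm_truncMult_le_one {d : ℕ} (i : Fin d) {a : ℝ} (ha : 0 < a) (A : ℝ) (ξ : Fin d → ℝ) :
    ‖truncMult i a A ξ‖ ≤ 1 := by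
  rw [truncMult_eq]
  by_cases hξ : ξ = 0
  · simp [hξ]
  have hq : 0 < sqNorm ξ := by
    rw [← eucNorm_sq]; exact pow_pos (eucNorm_pos hξ) 2
  have hsub : Ioc a A ⊆ Ioi 0 := fun w hw => ha.trans hw.1
  have h1 : ∫ w in Ioc a A, Real.exp (-(Real.pi * w ^ 2 * sqNorm ξ)) ≤ 1 / (2 * eucNorm ξ) := by
    rw [eucNorm_eq, ← integral_gaussian_radial]
    exact setIntegral_mono_set (integrableOn_gaussian_radial hq)
      (Eventually.of_forall fun w => (Real.exp_pos _).le)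
      hsub.eventuallyLE
  have h0 : 0 ≤ ∫ w in Ioc a A, Real.exp (-(Real.pi * w ^ 2 * sqNorm ξ)) :=
    integral_nonneg fun w => (Real.exp_pos _).le
  have hpos := eucNorm_pos hξ
  rw [norm_mul, norm_mul, norm_mul, Complex.norm_real, Complex.norm_real, Complex.norm_I,
    Real.norm_of_nonneg h0, norm_neg, Complex.norm_ofNat, mul_one, Real.norm_eq_abs]
  calc 2 * |ξ i| * ∫ w in Ioc a A, Real.exp (-(Real.pi * w ^ 2 * sqNorm ξ))
      ≤ 2 * eucNorm ξ * (1 / (2 * eucNorm ξ)) := by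
        gcongr
        exact abs_apply_le_eucNorm ξ i
    _ = 1 := by field_simp

lemma tendsto_setIntegral_Ioc_nat {E : Type*} [NormedAddCommGroup E] [NormedSpace ℝ E]
    {f : ℝ → E} (hf : IntegrableOn f (Ioi 0)) :
    Tendsto (fun n : ℕ => ∫ w in Ioc (1 / ((n : ℝ) + 1)) ((n : ℝ) + 1), f w) atTop
      (𝓝 (∫ w in Ioi 0, f w)) := by
  have hU : ⋃ n : ℕ, Ioc (1 / ((n : ℝ) + 1)) ((n : ℝ) + 1) = Ioi 0 := by
    ext w
    simp only [mem_iUnion, mem_Ioc, mem_Ioi]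
    constructor
    · rintro ⟨n, h1, -⟩
      exact lt_trans (by positivity) h1
    · intro hw
      obtain ⟨n, hn⟩ := exists_nat_one_div_lt hw
      obtain ⟨m, hm⟩ := exists_nat_ge w
      refine ⟨max n m, lt_of_le_of_lt ?_ hn, hm.trans ?_⟩
      · gcongr
        exact le_max_left _ _
      · have : (m : ℝ) ≤ (max n m : ℕ) := by exact_mod_cast le_max_right _ _
        linarith
  rw [← hU] at hf ⊢
  refine tendsto_setIntegral_of_monotone (fun n => measurableSet_Ioc) ?_ hf
  intro m n hmn
  have : (m : ℝ) ≤ n := by exact_mod_cast hmn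
  refine Ioc_subset_Ioc ?_ (by linarith)
  gcongr

/-- The Riesz multiplier `-i ξ_i / |ξ|`. -/
def rieszMult {d : ℕ} (i : Fin d) (ξ : Fin d → ℝ) : ℂ :=
  -Complex.I * ((ξ i / eucNorm ξ : ℝ) : ℂ)

lemma tendsto_truncMult {d : ℕ} (i : Fin d) (ξ : Fin d → ℝ) :
    Tendsto (fun n : ℕ => truncMult i (1 / ((n : ℝ) + 1)) ((n : ℝ) + 1) ξ) atTop
      (𝓝 (rieszMult i ξ)) := by
  by_cases hξ : ξ = 0
  · simp [truncMult_eq, hξ, rieszMult]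
  have hq : 0 < sqNorm ξ := by
    rw [← eucNorm_sq]; exact pow_pos (eucNorm_pos hξ) 2
  have h := tendsto_setIntegral_Ioc_nat (integrableOn_gaussian_radial hq)
  rw [integral_gaussian_radial, ← eucNorm_eq] at h
  have h2 := ((Complex.continuous_ofReal.tendsto _).comp h).const_mul (-2 * Complex.I * (ξ i : ℂ))
  simp_rw [truncMult_eq]
  have hpos := eucNorm_pos hξ
  have e : rieszMult i ξ = -2 * Complex.I * (ξ i : ℂ) * ((1 / (2 * eucNorm ξ) : ℝ) : ℂ) := by
    have : (eucNorm ξ : ℂ) ≠ 0 := by exact_mod_cast hpos.ne'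
    rw [rieszMult]
    push_cast
    field_simp
  rw [e]
  exact h2

lemma radial_eq_rpow (d : ℕ) (s : ℝ) {w : ℝ} (hw : 0 < w) :
    (|(-1 : ℝ)| * w ^ ((-1 : ℝ) - 1)) •
        ((w ^ (-1 : ℝ)) ^ (d : ℝ) * Real.exp (-(Real.pi * s ^ 2) * (w ^ (-1 : ℝ)) ^ (2 : ℝ))) =
      (w⁻¹) ^ (d + 2) * Real.exp (-(Real.pi / w ^ 2 * s ^ 2)) := by
  have e : w ^ ((-1 : ℝ) - 1) = (w⁻¹) ^ 2 := by
    rw [show ((-1 : ℝ) - 1) = -((2 : ℕ) : ℝ) by norm_num, Real.rpow_neg hw.le, Real.rpow_natCast,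
      inv_pow]
  rw [e, Real.rpow_neg_one, Real.rpow_natCast, Real.rpow_two, abs_neg, abs_one, one_mul, smul_eq_mul,
    pow_add, ← mul_assoc, mul_comm ((w⁻¹) ^ 2)]
  congr 2
  rw [inv_pow]
  ring

lemma integrableOn_radial (d : ℕ) {s : ℝ} (hs : 0 < s) :
    IntegrableOn (fun w : ℝ => (w⁻¹) ^ (d + 2) * Real.exp (-(Real.pi / w ^ 2 * s ^ 2))) (Ioi 0) := by
  have h := integrableOn_rpow_mul_exp_neg_mul_rpow (p := 2) (s := (d : ℝ))
    (b := Real.pi * s ^ 2) (by have : (0 : ℝ) ≤ d := d.cast_nonneg; linarith) two_pos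
    (by positivity)
  refine ((integrableOn_Ioi_comp_rpow_iff _ (p := -1) (by norm_num)).2 h).congr_fun
    (fun w hw => ?_) measurableSet_Ioi
  exact radial_eq_rpow d s hw

lemma integral_radial (d : ℕ) {s : ℝ} (hs : 0 < s) :
    ∫ w in Ioi 0, (w⁻¹) ^ (d + 2) * Real.exp (-(Real.pi / w ^ 2 * s ^ 2)) =
      rieszConst d / 2 / s ^ (d + 1) := by
  have h := integral_rpow_mul_exp_neg_mul_rpow (p := 2) (q := (d : ℝ))
    (b := Real.pi * s ^ 2) two_pos (by have : (0 : ℝ) ≤ d := d.cast_nonneg; linarith)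
    (by positivity)
  rw [← integral_comp_rpow_Ioi _ (p := -1) (by norm_num)] at h
  rw [setIntegral_congr_fun measurableSet_Ioi fun w hw => (radial_eq_rpow d s hw).symm]
  rw [h, Real.mul_rpow Real.pi_pos.le (by positivity), ← Real.rpow_natCast s 2, ← Real.rpow_mul hs.le,
    rieszConst, neg_div, Real.rpow_neg Real.pi_pos.le,
    show ((2 : ℕ) : ℝ) * -(((d : ℝ) + 1) / 2) = -((d + 1 : ℕ) : ℝ) by push_cast; ring,
    Real.rpow_neg hs.le, Real.rpow_natCast]
  ring

lemma rieszConst_pos (d : ℕ) : 0 < rieszConst d := by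
  rw [rieszConst]
  have : 0 < Real.Gamma (((d : ℝ) + 1) / 2) := Real.Gamma_pos_of_pos (by positivity)
  have := Real.pi_pos
  positivity

lemma sqNorm_ge_norm_sq {d : ℕ} (x : Fin d → ℝ) : ‖x‖ ^ 2 ≤ sqNorm x := by
  rw [← eucNorm_sq]
  gcongr
  exact norm_le_eucNorm x

lemma abs_mul_abs_le_sqNorm {d : ℕ} (x : Fin d → ℝ) (i j : Fin d) :
    |x i| * |x j| ≤ sqNorm x := by
  rw [← eucNorm_sq, sq]
  exact mul_le_mul (abs_apply_le_eucNorm x i) (abs_apply_le_eucNorm x j) (abs_nonneg _)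
    (eucNorm_nonneg x)

lemma one_add_mul_exp_neg_le {D t : ℝ} (hD : 0 ≤ D) (ht : 0 ≤ t) :
    (1 + 2 * D * t) * Real.exp (-t) ≤ (1 + 4 * D) * Real.exp (-(t / 2)) := by
  have e : Real.exp (-t) = Real.exp (-(t / 2)) * Real.exp (-(t / 2)) := by
    rw [← Real.exp_add]; congr 1; ring
  have h1 : Real.exp (-(t / 2)) ≤ 1 := Real.exp_le_one_iff.2 (by linarith)
  have h2 : t / 2 * Real.exp (-(t / 2)) ≤ 1 := by
    have := Real.add_one_le_exp (t / 2)
    rw [Real.exp_neg, ← div_eq_mul_inv, div_le_one (Real.exp_pos _)]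
    linarith
  rw [e, ← mul_assoc]
  gcongr
  nlinarith

lemma norm_coord_mul_gaussian_sub_le {d : ℕ} (i : Fin d) {w : ℝ} {x h : Fin d → ℝ}
    (hxh : 2 * ‖h‖ ≤ ‖x‖) :
    ‖(x - h) i * Real.exp (-(Real.pi / w ^ 2 * sqNorm (x - h))) -
        x i * Real.exp (-(Real.pi / w ^ 2 * sqNorm x))‖ ≤
      ‖h‖ * ((1 + 4 * d) * Real.exp (-(Real.pi / w ^ 2 * (‖x‖ / 3) ^ 2))) := by
  have hq : ∀ t : ℝ, HasDerivAt (fun t : ℝ => sqNorm (x - t • h))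
      (∑ j, 2 * (x j - t * h j) * (-h j)) t := by
    intro t
    unfold sqNorm
    refine HasDerivAt.fun_sum fun j _ => ?_
    have := (((hasDerivAt_id t).mul_const (h j)).const_sub (x j)).fun_pow 2
    simpa using this
  have hd : ∀ t : ℝ, HasDerivAt (fun t : ℝ => (x - t • h) i *
      Real.exp (-(Real.pi / w ^ 2 * sqNorm (x - t • h))))
      (-h i * Real.exp (-(Real.pi / w ^ 2 * sqNorm (x - t • h))) + (x - t • h) i *
        (Real.exp (-(Real.pi / w ^ 2 * sqNorm (x - t • h))) *
          -(Real.pi / w ^ 2 * ∑ j, 2 * (x j - t * h j) * (-h j)))) t := by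
    intro t
    refine HasDerivAt.mul ?_ (((hq t).const_mul _).neg.exp)
    simpa using ((hasDerivAt_id t).mul_const (h i)).const_sub (x i)
  have key := norm_image_sub_le_of_norm_deriv_le_segment_01'
    (C := ‖h‖ * ((1 + 4 * d) * Real.exp (-(Real.pi / w ^ 2 * (‖x‖ / 3) ^ 2))))
    (fun t _ => (hd t).hasDerivWithinAt) ?_
  · simpa using key
  intro t ht
  set y := x - t • h with hy
  have hyx : ‖x‖ / 2 ≤ ‖y‖ := by
    have h1 := norm_sub_norm_le x (t • h)
    rw [norm_smul, Real.norm_of_nonneg ht.1] at h1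
    have h2 : t * ‖h‖ ≤ 1 * ‖h‖ := by have := ht.2.le; gcongr
    linarith
  have hc : 0 ≤ Real.pi / w ^ 2 := by have := Real.pi_pos; positivity
  have hqy : (‖x‖ / 2) ^ 2 ≤ sqNorm y :=
    (pow_le_pow_left₀ (by positivity) hyx 2).trans (sqNorm_ge_norm_sq y)
  have hq0 := sqNorm_nonneg y
  set E := Real.exp (-(Real.pi / w ^ 2 * sqNorm y)) with hE
  have hE0 : 0 ≤ E := (Real.exp_pos _).le
  have hsum : |y i * ∑ j, 2 * (x j - t * h j) * (-h j)| ≤ ‖h‖ * (2 * d * sqNorm y) := by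
    rw [Finset.mul_sum]
    refine (Finset.abs_sum_le_sum_abs _ _).trans ?_
    calc ∑ j, |y i * (2 * (x j - t * h j) * (-h j))| ≤ ∑ _j : Fin d, 2 * sqNorm y * ‖h‖ := by
          refine Finset.sum_le_sum fun j _ => ?_
          have e : |y i * (2 * (x j - t * h j) * (-h j))| = 2 * (|y i| * |y j|) * |h j| := by
            have : y j = x j - t * h j := by simp [hy]
            rw [← this, abs_mul, abs_mul, abs_mul, abs_neg, abs_two]
            ring
          rw [e]
          have h1 := abs_mul_abs_le_sqNorm y i j
          have h2 : |h j| ≤ ‖h‖ := norm_le_pi_norm h j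
          gcongr
      _ = _ := by simp; ring
  calc ‖-h i * E + y i * (E * -(Real.pi / w ^ 2 * ∑ j, 2 * (x j - t * h j) * (-h j)))‖
      ≤ ‖-h i * E‖ + ‖y i * (E * -(Real.pi / w ^ 2 * ∑ j, 2 * (x j - t * h j) * (-h j)))‖ :=
        norm_add_le _ _
    _ = |h i| * E + Real.pi / w ^ 2 * |y i * ∑ j, 2 * (x j - t * h j) * (-h j)| * E := by
        simp only [Real.norm_eq_abs, abs_mul, abs_neg, abs_of_nonneg hE0, abs_of_nonneg hc]
        ring
    _ ≤ ‖h‖ * E + Real.pi / w ^ 2 * (‖h‖ * (2 * d * sqNorm y)) * E := by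
        have h2 : |h i| ≤ ‖h‖ := norm_le_pi_norm h i
        gcongr
    _ = ‖h‖ * ((1 + 2 * d * (Real.pi / w ^ 2 * sqNorm y)) * E) := by ring
    _ ≤ ‖h‖ * ((1 + 4 * d) * Real.exp (-(Real.pi / w ^ 2 * sqNorm y / 2))) := by
        refine mul_le_mul_of_nonneg_left ?_ (norm_nonneg h)
        exact one_add_mul_exp_neg_le (Nat.cast_nonneg d) (mul_nonneg hc hq0)
    _ ≤ _ := by
        have : (‖x‖ / 3) ^ 2 ≤ sqNorm y / 2 := by nlinarith [norm_nonneg x]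
        rw [mul_div_assoc]
        gcongr

lemma integrableOn_truncKernel {d : ℕ} (i : Fin d) {a : ℝ} (ha : 0 < a) (A : ℝ) (x : Fin d → ℝ) :
    IntegrableOn (fun w : ℝ => x i * (w⁻¹) ^ (d + 2) *
      Real.exp (-(Real.pi / w ^ 2 * sqNorm x))) (Ioc a A) := by
  refine (ContinuousOn.integrableOn_Icc ?_).mono_set Ioc_subset_Icc_self
  have h0 : ∀ w ∈ Icc a A, w ≠ 0 := fun w hw => (ha.trans_le hw.1).ne'
  have h1 : ∀ w ∈ Icc a A, w ^ 2 ≠ 0 := fun w hw => pow_ne_zero 2 (h0 w hw)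
  fun_prop (disch := assumption)

/-- Constant in the Hörmander condition. -/
def hormanderConst (d : ℕ) : ℝ := (1 + 4 * d) * rieszConst d * 3 ^ (d + 1)

lemma norm_truncKernel_sub_le {d : ℕ} (i : Fin d) {a : ℝ} (ha : 0 < a) (A : ℝ) {x h : Fin d → ℝ}
    (hx : x ≠ 0) (hxh : 2 * ‖h‖ ≤ ‖x‖) :
    ‖truncKernel i a A (x - h) - truncKernel i a A x‖ ≤
      hormanderConst d * ‖h‖ / ‖x‖ ^ (d + 1) := by
  have hx0 : 0 < ‖x‖ / 3 := div_pos (norm_pos_iff.2 hx) (by norm_num)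
  have hsub : Ioc a A ⊆ Ioi 0 := fun w hw => ha.trans hw.1
  have hint : IntegrableOn (fun w => ‖h‖ * (1 + 4 * d) *
      ((w⁻¹) ^ (d + 2) * Real.exp (-(Real.pi / w ^ 2 * (‖x‖ / 3) ^ 2)))) (Ioi 0) :=
    (integrableOn_radial d hx0).const_mul _
  rw [truncKernel, truncKernel, ← mul_sub, ← integral_sub (integrableOn_truncKernel i ha A _)
    (integrableOn_truncKernel i ha A _), norm_mul, Real.norm_two]
  calc 2 * ‖∫ w in Ioc a A, ((x - h) i * (w⁻¹) ^ (d + 2) *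
        Real.exp (-(Real.pi / w ^ 2 * sqNorm (x - h))) - x i * (w⁻¹) ^ (d + 2) *
        Real.exp (-(Real.pi / w ^ 2 * sqNorm x)))‖
      ≤ 2 * ∫ w in Ioc a A, ‖h‖ * (1 + 4 * d) *
        ((w⁻¹) ^ (d + 2) * Real.exp (-(Real.pi / w ^ 2 * (‖x‖ / 3) ^ 2))) := by
        gcongr
        refine norm_integral_le_of_norm_le (hint.mono_set hsub)
          ((ae_restrict_iff' measurableSet_Ioc).2 (Eventually.of_forall fun w hw => ?_))
        have hw0 : 0 < w := hsub hw
        have h1 := norm_coord_mul_gaussian_sub_le i (w := w) hxh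
        calc _ = (w⁻¹) ^ (d + 2) * ‖(x - h) i * Real.exp (-(Real.pi / w ^ 2 * sqNorm (x - h))) -
              x i * Real.exp (-(Real.pi / w ^ 2 * sqNorm x))‖ := by
              rw [← Real.norm_of_nonneg (show 0 ≤ (w⁻¹) ^ (d + 2) by positivity), ← norm_mul,
                Real.norm_of_nonneg (show 0 ≤ (w⁻¹) ^ (d + 2) by positivity)]
              congr 1
              ring
          _ ≤ _ := by
              rw [mul_comm (‖h‖ * (1 + 4 * (d : ℝ))), mul_assoc]
              refine mul_le_mul_of_nonneg_left (h1.trans (le_of_eq ?_)) (by positivity)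
              ring
    _ ≤ 2 * ∫ w in Ioi 0, ‖h‖ * (1 + 4 * d) *
        ((w⁻¹) ^ (d + 2) * Real.exp (-(Real.pi / w ^ 2 * (‖x‖ / 3) ^ 2))) := by
        refine mul_le_mul_of_nonneg_left (setIntegral_mono_set hint ?_ hsub.eventuallyLE) two_pos.le
        refine (ae_restrict_iff' measurableSet_Ioi).2 (Eventually.of_forall fun w hw => ?_)
        have hw0 : 0 < w := hw
        simp only [Pi.zero_apply]
        positivity
    _ = _ := by
        rw [integral_const_mul, integral_radial d hx0, hormanderConst, div_pow]
        field_simp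

lemma truncKernel_hormander_pointwise {d : ℕ} {r : ℝ} (hr : 0 < r) {x : Fin d → ℝ}
    (hx : 2 * r < ‖x‖) :
    r / ‖x‖ ^ (d + 1) ≤ 2 ^ (d + 1) * (r⁻¹) ^ d * (1 + ‖r⁻¹ • x‖) ^ (-((d : ℝ) + 1)) := by
  have hx0 : 0 < ‖x‖ := by linarith
  rw [Real.rpow_neg (by positivity), show (d : ℝ) + 1 = ((d + 1 : ℕ) : ℝ) by push_cast; ring,
    Real.rpow_natCast, norm_smul, norm_inv, Real.norm_of_nonneg hr.le]
  have h1 : 1 + r⁻¹ * ‖x‖ ≤ 2 * (r⁻¹ * ‖x‖) := by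
    have : 1 ≤ r⁻¹ * ‖x‖ := by
      rw [inv_mul_eq_div, one_le_div hr]; linarith
    linarith
  calc r / ‖x‖ ^ (d + 1) = 2 ^ (d + 1) * (r⁻¹) ^ d * ((2 * (r⁻¹ * ‖x‖)) ^ (d + 1))⁻¹ := by
        rw [mul_pow, mul_pow, pow_succ r⁻¹ d]
        field_simp
    _ ≤ _ := by gcongr

/-- The Hörmander bound holds uniformly in the truncation parameters. -/
lemma exists_lintegral_truncKernel_sub_le (d : ℕ) : ∃ H : ℝ≥0, ∀ (i : Fin d) (a A : ℝ), 0 < a →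
    ∀ r > 0, ∀ h : Fin d → ℝ, ‖h‖ ≤ r →
      ∫⁻ x in {x | 2 * r < ‖x‖}, ‖(truncKernel i a A (x - h) : ℂ) - truncKernel i a A x‖ₑ ≤ H := by
  have hJ : Integrable (fun x : Fin d → ℝ => (1 + ‖x‖) ^ (-((d : ℝ) + 1))) :=
    integrable_one_add_norm (by simp)
  have hc : 0 ≤ hormanderConst d := by
    have := rieszConst_pos d
    rw [hormanderConst]; positivity
  refine ⟨(hormanderConst d * 2 ^ (d + 1) *
    ∫ x : Fin d → ℝ, (1 + ‖x‖) ^ (-((d : ℝ) + 1))).toNNReal, fun i a A ha r hr h hh => ?_⟩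
  have hJr : Integrable (fun x : Fin d → ℝ => (1 + ‖r⁻¹ • x‖) ^ (-((d : ℝ) + 1))) :=
    hJ.comp_smul (inv_ne_zero hr.ne')
  calc ∫⁻ x in {x | 2 * r < ‖x‖}, ‖(truncKernel i a A (x - h) : ℂ) - truncKernel i a A x‖ₑ
      ≤ ∫⁻ x in {x | 2 * r < ‖x‖}, ENNReal.ofReal (hormanderConst d * 2 ^ (d + 1) * (r⁻¹) ^ d *
          (1 + ‖r⁻¹ • x‖) ^ (-((d : ℝ) + 1))) := by
        refine setLIntegral_mono' (measurableSet_lt measurable_const measurable_norm) fun x hx => ?_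
        have hx : 2 * r < ‖x‖ := hx
        rw [← ofReal_norm, ← Complex.ofReal_sub, Complex.norm_real]
        refine ENNReal.ofReal_le_ofReal ?_
        refine (norm_truncKernel_sub_le i ha A (norm_pos_iff.1 (by linarith)) (by linarith)).trans ?_
        calc hormanderConst d * ‖h‖ / ‖x‖ ^ (d + 1) ≤ hormanderConst d * (r / ‖x‖ ^ (d + 1)) := by
              rw [mul_div_assoc]
              gcongr
          _ ≤ _ := by
              refine (mul_le_mul_of_nonneg_left
                (truncKernel_hormander_pointwise hr hx) hc).trans (le_of_eq ?_)
              ring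
    _ ≤ ∫⁻ x, ENNReal.ofReal (hormanderConst d * 2 ^ (d + 1) * (r⁻¹) ^ d *
          (1 + ‖r⁻¹ • x‖) ^ (-((d : ℝ) + 1))) := setLIntegral_le_lintegral _ _
    _ = ENNReal.ofReal (∫ x : Fin d → ℝ, hormanderConst d * 2 ^ (d + 1) * (r⁻¹) ^ d *
          (1 + ‖r⁻¹ • x‖) ^ (-((d : ℝ) + 1))) := by
        refine (ofReal_integral_eq_lintegral_ofReal (hJr.const_mul _)
          (Eventually.of_forall fun x => ?_)).symm
        simp only [Pi.zero_apply]
        positivity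
    _ = _ := by
        rw [integral_const_mul, Measure.integral_comp_smul_of_nonneg _
          (fun x : Fin d → ℝ => (1 + ‖x‖) ^ (-((d : ℝ) + 1))) _ (hR := (inv_pos.2 hr).le)]
        rw [Module.finrank_fin_fun, smul_eq_mul, ENNReal.ofReal]
        congr 2
        field_simp

lemma rieszKernel_apply {d : ℕ} (y : Fin d → ℝ) (i : Fin d) :
    rieszKernel d y i = rieszConst d * y i / eucNorm y ^ (d + 1) := by
  rw [rieszKernel]
  split_ifs with h
  · simp [h]
  · rfl

lemma measurable_rieszKernel_apply {d : ℕ} (i : Fin d) :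
    Measurable fun y : Fin d → ℝ => ((rieszKernel d y i : ℝ) : ℂ) := by
  simp_rw [rieszKernel_apply]
  have := (continuous_eucNorm (d := d)).measurable
  fun_prop

lemma norm_rieszKernel_apply_le {d : ℕ} (i : Fin d) {y : Fin d → ℝ} {s : ℝ} (hs : 0 < s)
    (hy : s ≤ eucNorm y) : ‖((rieszKernel d y i : ℝ) : ℂ)‖ ≤ rieszConst d * (s⁻¹) ^ d := by
  have h0 : 0 < eucNorm y := hs.trans_le hy
  have hC := rieszConst_pos d
  rw [Complex.norm_real, rieszKernel_apply, norm_div, norm_mul, Real.norm_of_nonneg hC.le,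
    Real.norm_of_nonneg (by positivity : 0 ≤ eucNorm y ^ (d + 1)), Real.norm_eq_abs]
  calc rieszConst d * |y i| / eucNorm y ^ (d + 1)
      ≤ rieszConst d * eucNorm y / eucNorm y ^ (d + 1) := by
        gcongr
        exact abs_apply_le_eucNorm y i
    _ = rieszConst d * ((eucNorm y)⁻¹) ^ d := by
        rw [pow_succ, inv_pow]; field_simp
    _ ≤ _ := by gcongr

/-- The `i`-th coordinate of a truncated Riesz integral at the origin. -/
def truncInt {d : ℕ} (i : Fin d) (F : (Fin d → ℝ) → ℂ) (ε : ℝ) : ℂ :=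
  ∫ y in {y : Fin d → ℝ | ε < eucNorm y}, F y * ((rieszKernel d y i : ℝ) : ℂ)

lemma measurableSet_lt_eucNorm {d : ℕ} (ε : ℝ) : MeasurableSet {y : Fin d → ℝ | ε < eucNorm y} :=
  measurableSet_lt measurable_const continuous_eucNorm.measurable

lemma integrableOn_mul_rieszKernel {d : ℕ} (i : Fin d) {F : (Fin d → ℝ) → ℂ} (hF : Integrable F)
    {ε : ℝ} (hε : 0 < ε) :
    IntegrableOn (fun y => F y * ((rieszKernel d y i : ℝ) : ℂ)) {y | ε < eucNorm y} := by
  refine hF.integrableOn.mul_bdd (c := rieszConst d * (ε⁻¹) ^ d)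
    (measurable_rieszKernel_apply i).aestronglyMeasurable ?_
  refine (ae_restrict_iff' (measurableSet_lt_eucNorm ε)).2 (Eventually.of_forall fun y hy => ?_)
  exact norm_rieszKernel_apply_le i hε (le_of_lt hy)

lemma truncRiesz_apply {d : ℕ} (i : Fin d) {f : (Fin d → ℝ) → ℂ} (hf : Integrable f)
    (x : Fin d → ℝ) {ε : ℝ} (hε : 0 < ε) :
    truncRiesz f x ε i = truncInt i (fun y => f (x - y)) ε := by
  rw [truncRiesz, truncInt]
  exact (eval_integral fun j => integrableOn_mul_rieszKernel j (hf.comp_sub_left x) hε) i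

lemma norm_truncInt_le {d : ℕ} (i : Fin d) {F : (Fin d → ℝ) → ℂ} (hF : Integrable F)
    {ε : ℝ} (hε : 0 < ε) :
    ‖truncInt i F ε‖ ≤ (∫ y, ‖F y‖) * (rieszConst d * (ε⁻¹) ^ d) := by
  have hC := rieszConst_pos d
  have hi : Integrable fun y => ‖F y‖ * (rieszConst d * (ε⁻¹) ^ d) := hF.norm.mul_const _
  rw [← integral_mul_const]
  refine (norm_integral_le_of_norm_le hi.integrableOn ((ae_restrict_iff'
    (measurableSet_lt_eucNorm ε)).2 (Eventually.of_forall fun y hy => ?_))).trans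
    (setIntegral_le_integral hi (Eventually.of_forall fun y => ?_))
  · rw [norm_mul]
    gcongr
    exact norm_rieszKernel_apply_le i hε (le_of_lt hy)
  · simp only [Pi.zero_apply]
    positivity

/-- The radial density `v^{-d-2} e^{-π / v²}`. -/
def radialDensity (d : ℕ) (v : ℝ) : ℝ :=
  (v⁻¹) ^ (d + 2) * Real.exp (-(Real.pi / v ^ 2 * 1 ^ 2))

lemma radialDensity_nonneg (d : ℕ) {v : ℝ} (hv : 0 < v) : 0 ≤ radialDensity d v := by
  rw [radialDensity]; positivity

lemma measurable_radialDensity (d : ℕ) : Measurable (radialDensity d) := by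
  unfold radialDensity; fun_prop

lemma truncKernel_eq_radial {d : ℕ} (i : Fin d) {a : ℝ} (ha : 0 < a) (A : ℝ) (y : Fin d → ℝ) :
    truncKernel i a A y = 2 / rieszConst d * (rieszKernel d y i *
      ∫ v in Ioi 0, if a < eucNorm y * v ∧ eucNorm y * v ≤ A then radialDensity d v else 0) := by
  rw [rieszKernel_apply]
  by_cases hy : y = 0
  · simp [hy, truncKernel]
  have hn := eucNorm_pos hy
  have hC := rieszConst_pos d
  set G : ℝ → ℝ := (Ioc a A).indicator fun w => y i * (w⁻¹) ^ (d + 2) *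
    Real.exp (-(Real.pi / w ^ 2 * sqNorm y)) with hG
  have h1 : ∫ w in Ioc a A, y i * (w⁻¹) ^ (d + 2) * Real.exp (-(Real.pi / w ^ 2 * sqNorm y)) =
      ∫ w in Ioi 0, G w := by
    rw [hG, setIntegral_indicator measurableSet_Ioc]
    congr 2
    ext w
    simp only [mem_inter_iff, mem_Ioi, mem_Ioc]
    exact ⟨fun h => ⟨ha.trans h.1, h⟩, fun h => h.2⟩
  have h2 := integral_comp_mul_left_Ioi' G 0 hn
  rw [mul_zero] at h2
  rw [truncKernel, h1, ← h2, smul_eq_mul]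
  have h3 : ∀ v ∈ Ioi (0 : ℝ), G (eucNorm y * v) = y i * ((eucNorm y)⁻¹) ^ (d + 2) *
      if a < eucNorm y * v ∧ eucNorm y * v ≤ A then radialDensity d v else 0 := by
    intro v hv
    have hv : 0 < v := hv
    simp only [hG, indicator, mem_Ioc]
    split_ifs
    · rw [radialDensity, mul_inv, mul_pow, ← eucNorm_sq]
      have : Real.pi / (eucNorm y * v) ^ 2 * eucNorm y ^ 2 = Real.pi / v ^ 2 * 1 ^ 2 := by
        field_simp
      rw [this]
      ring
    · simp
  rw [setIntegral_congr_fun measurableSet_Ioi h3, integral_const_mul]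
  rw [inv_pow, pow_succ _ (d + 1)]
  field_simp

lemma integrable_truncKernel_fubini {d : ℕ} (i : Fin d) {F : (Fin d → ℝ) → ℂ} (hF : Integrable F)
    {a : ℝ} (ha : 0 < a) (A : ℝ) :
    Integrable (fun p : (Fin d → ℝ) × ℝ => F p.1 * (((rieszKernel d p.1 i : ℝ) : ℂ) *
      ((if a < eucNorm p.1 * p.2 ∧ eucNorm p.1 * p.2 ≤ A then radialDensity d p.2 else 0 : ℝ) : ℂ)))
      (volume.prod (volume.restrict (Ioi (0 : ℝ)))) := by
  have h0 : Integrable (fun p : (Fin d → ℝ) × ℝ => F p.1 *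
      ((rieszConst d * (a⁻¹) ^ d * ((p.2⁻¹) ^ (0 + 2) *
        Real.exp (-(Real.pi / p.2 ^ 2 * 1 ^ 2))) : ℝ) : ℂ))
      (volume.prod (volume.restrict (Ioi (0 : ℝ)))) :=
    hF.mul_prod (((integrableOn_radial 0 one_pos).const_mul (rieszConst d * (a⁻¹) ^ d)).ofReal)
  have hm : Measurable fun p : (Fin d → ℝ) × ℝ => eucNorm p.1 * p.2 :=
    (continuous_eucNorm.measurable.comp measurable_fst).mul measurable_snd
  refine h0.mono ?_ ?_
  · refine hF.aestronglyMeasurable.comp_fst.mul (Measurable.aestronglyMeasurable ?_)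
    refine ((measurable_rieszKernel_apply i).comp measurable_fst).mul
      (Complex.measurable_ofReal.comp (Measurable.ite ?_
        ((measurable_radialDensity d).comp measurable_snd) measurable_const))
    exact (measurableSet_lt measurable_const hm).inter (measurableSet_le hm measurable_const)
  · have e : (volume : Measure (Fin d → ℝ)).prod (volume.restrict (Ioi (0 : ℝ))) =
        (volume.prod volume).restrict (univ ×ˢ Ioi (0 : ℝ)) := by
      rw [← Measure.prod_restrict, Measure.restrict_univ]
    rw [e]
    refine (ae_restrict_iff' (MeasurableSet.univ.prod measurableSet_Ioi)).2
      (Eventually.of_forall fun p hp => ?_)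
    have hv : 0 < p.2 := hp.2
    have hC := rieszConst_pos d
    rw [norm_mul (F p.1), norm_mul (F p.1)]
    refine mul_le_mul_of_nonneg_left ?_ (norm_nonneg _)
    split_ifs with hcond
    · rw [norm_mul, Complex.norm_real (radialDensity d p.2),
        Real.norm_of_nonneg (radialDensity_nonneg d hv),
        Complex.norm_real (_ * _), Real.norm_of_nonneg (by positivity)]
      have h1 : a / p.2 ≤ eucNorm p.1 := by
        rw [div_le_iff₀ hv]; exact hcond.1.le
      have h2 := radialDensity_nonneg d hv
      calc _ ≤ rieszConst d * ((a / p.2)⁻¹) ^ d * radialDensity d p.2 := by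
            gcongr
            exact norm_rieszKernel_apply_le i (div_pos ha hv) h1
        _ = _ := by
            rw [radialDensity, inv_div, div_pow, pow_add, inv_pow a, zero_add, inv_pow p.2 d]
            field_simp
    · rw [Complex.ofReal_zero, mul_zero, norm_zero]
      exact norm_nonneg _

lemma setIntegral_annulus {d : ℕ} (i : Fin d) {F : (Fin d → ℝ) → ℂ} (hF : Integrable F)
    {a A v : ℝ} (ha : 0 < a) (haA : a ≤ A) (hv : 0 < v) :
    ∫ y, F y * (((rieszKernel d y i : ℝ) : ℂ) *
      ((if a < eucNorm y * v ∧ eucNorm y * v ≤ A then radialDensity d v else 0 : ℝ) : ℂ)) =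
      (radialDensity d v : ℂ) * (truncInt i F (a / v) - truncInt i F (A / v)) := by
  have hsub : {y : Fin d → ℝ | A / v < eucNorm y} ⊆ {y | a / v < eucNorm y} := fun y hy =>
    lt_of_le_of_lt (div_le_div_of_nonneg_right haA hv.le) hy
  rw [truncInt, truncInt, ← setIntegral_sdiff (measurableSet_lt_eucNorm _)
    (integrableOn_mul_rieszKernel i hF (div_pos ha hv)) hsub, ← integral_const_mul,
    ← integral_indicator ((measurableSet_lt_eucNorm _).diff (measurableSet_lt_eucNorm _))]
  congr 1 with y
  have hiff : (a < eucNorm y * v ∧ eucNorm y * v ≤ A) ↔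
      y ∈ {y : Fin d → ℝ | a / v < eucNorm y} \ {y | A / v < eucNorm y} := by
    simp only [Set.mem_sdiff, Set.mem_ofPred_eq, not_lt]
    rw [div_lt_iff₀ hv, le_div_iff₀ hv]
  by_cases h : a < eucNorm y * v ∧ eucNorm y * v ≤ A
  · rw [if_pos h, indicator_of_mem (hiff.1 h)]
    ring
  · rw [if_neg h, indicator_of_notMem (fun h' => h (hiff.2 h'))]
    simp

lemma integral_mul_truncKernel {d : ℕ} (i : Fin d) {F : (Fin d → ℝ) → ℂ} (hF : Integrable F)
    {a A : ℝ} (ha : 0 < a) (haA : a ≤ A) :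
    ∫ y, F y * (truncKernel i a A y : ℂ) = (2 / rieszConst d : ℝ) * ∫ v in Ioi 0,
      (radialDensity d v : ℂ) * (truncInt i F (a / v) - truncInt i F (A / v)) := by
  have hs := integral_integral_swap (f := fun (y : Fin d → ℝ) (v : ℝ) =>
    F y * (((rieszKernel d y i : ℝ) : ℂ) *
      ((if a < eucNorm y * v ∧ eucNorm y * v ≤ A then radialDensity d v else 0 : ℝ) : ℂ)))
    (integrable_truncKernel_fubini i hF ha A)
  rw [← setIntegral_congr_fun measurableSet_Ioi fun v hv => setIntegral_annulus i hF ha haA hv,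
    ← hs, ← integral_const_mul]
  congr 1 with y
  rw [integral_const_mul, integral_const_mul, integral_complex_ofReal, truncKernel_eq_radial i ha]
  push_cast
  ring

lemma tendsto_truncInt_atTop {d : ℕ} (i : Fin d) {F : (Fin d → ℝ) → ℂ} (hF : Integrable F) :
    Tendsto (truncInt i F) atTop (𝓝 0) := by
  have hd : d ≠ 0 := fun h => (h ▸ i : Fin 0).elim0
  have h : Tendsto (fun ε : ℝ => (∫ y, ‖F y‖) * (rieszConst d * (ε⁻¹) ^ d)) atTop (𝓝 0) := by
    simpa [hd] using ((tendsto_inv_atTop_zero.pow d).const_mul (rieszConst d)).const_mul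
      (∫ y, ‖F y‖)
  refine squeeze_zero_norm' ?_ h
  filter_upwards [eventually_gt_atTop 0] with ε hε
  exact norm_truncInt_le i hF hε

lemma exists_norm_truncInt_le {d : ℕ} (i : Fin d) {F : (Fin d → ℝ) → ℂ} (hF : Integrable F)
    {c : ℂ} (h : Tendsto (truncInt i F) (𝓝[>] 0) (𝓝 c)) :
    ∃ B, ∀ ε > 0, ‖truncInt i F ε‖ ≤ B := by
  have h1 : ∀ᶠ ε in 𝓝[>] (0 : ℝ), ‖truncInt i F ε‖ < ‖c‖ + 1 :=
    h.norm.eventually (gt_mem_nhds (lt_add_one _))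
  obtain ⟨δ, hδ, hδ'⟩ := mem_nhdsGT_iff_exists_Ioo_subset.1 h1
  have hδ : 0 < δ := hδ
  refine ⟨max (‖c‖ + 1) ((∫ y, ‖F y‖) * (rieszConst d * (δ⁻¹) ^ d)), fun ε hε => ?_⟩
  rcases lt_or_ge ε δ with h | h
  · exact (le_of_lt (hδ' ⟨hε, h⟩)).trans (le_max_left _ _)
  · refine ((norm_truncInt_le i hF hε).trans ?_).trans (le_max_right _ _)
    have := rieszConst_pos d
    gcongr

/-- Smooth truncations of the Riesz kernel converge wherever the sharp truncations do. -/
lemma tendsto_integral_mul_truncKernel {d : ℕ} (i : Fin d) {F : (Fin d → ℝ) → ℂ}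
    (hF : Integrable F) {c : ℂ} (h : Tendsto (truncInt i F) (𝓝[>] 0) (𝓝 c)) :
    Tendsto (fun n : ℕ => ∫ y, F y * (truncKernel i (1 / ((n : ℝ) + 1)) ((n : ℝ) + 1) y : ℂ))
      atTop (𝓝 c) := by
  obtain ⟨B, hB⟩ := exists_norm_truncInt_le i hF h
  have ha : ∀ n : ℕ, 0 < 1 / ((n : ℝ) + 1) := fun n => by positivity
  have haA : ∀ n : ℕ, 1 / ((n : ℝ) + 1) ≤ (n : ℝ) + 1 := fun n => by
    have hn : (0 : ℝ) ≤ n := n.cast_nonneg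
    rw [div_le_iff₀ (by positivity)]
    nlinarith
  have hA : Tendsto (fun n : ℕ => (n : ℝ) + 1) atTop atTop :=
    tendsto_atTop_add_const_right _ _ tendsto_natCast_atTop_atTop
  simp_rw [fun n : ℕ => integral_mul_truncKernel i hF (ha n) (haA n)]
  have hint : IntegrableOn (radialDensity d) (Ioi 0) := integrableOn_radial d one_pos
  have hlim : Tendsto (fun n : ℕ => ∫ v in Ioi 0, (radialDensity d v : ℂ) *
      (truncInt i F (1 / ((n : ℝ) + 1) / v) - truncInt i F (((n : ℝ) + 1) / v))) atTop
      (𝓝 (∫ v in Ioi 0, (radialDensity d v : ℂ) * (c - 0))) := by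
    refine tendsto_integral_of_dominated_convergence (fun v => radialDensity d v * (B + B))
      (fun n => ?_) (hint.mul_const _) (fun n => ?_) ?_
    · refine (integrable_truncKernel_fubini i hF (ha n)
        ((n : ℝ) + 1)).integral_prod_right.aestronglyMeasurable.congr ?_
      exact (ae_restrict_iff' measurableSet_Ioi).2 (Eventually.of_forall fun v hv =>
        setIntegral_annulus i hF (ha n) (haA n) hv)
    · refine (ae_restrict_iff' measurableSet_Ioi).2 (Eventually.of_forall fun v hv => ?_)
      have hv : 0 < v := hv
      rw [norm_mul, Complex.norm_real, Real.norm_of_nonneg (radialDensity_nonneg d hv)]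
      refine mul_le_mul_of_nonneg_left ((norm_sub_le _ _).trans (add_le_add (hB _ ?_) (hB _ ?_)))
        (radialDensity_nonneg d hv)
      · positivity
      · positivity
    · refine (ae_restrict_iff' measurableSet_Ioi).2 (Eventually.of_forall fun v hv => ?_)
      have hv : 0 < v := hv
      refine Tendsto.const_mul _ (Tendsto.sub (h.comp ?_)
        ((tendsto_truncInt_atTop i hF).comp (hA.atTop_div_const hv)))
      refine tendsto_nhdsWithin_iff.2 ⟨?_, Eventually.of_forall fun n => ?_⟩
      · simpa using (tendsto_one_div_add_atTop_nhds_zero_nat (𝕜 := ℝ)).div_const v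
      · exact div_pos (ha n) hv
  have hfin := hlim.const_mul ((2 / rieszConst d : ℝ) : ℂ)
  rw [sub_zero, integral_mul_const, integral_complex_ofReal] at hfin
  have hval : ∫ v in Ioi 0, radialDensity d v = rieszConst d / 2 := by
    have := integral_radial d one_pos
    rw [one_pow (M := ℝ) (d + 1), div_one] at this
    exact this
  have hC : (rieszConst d : ℂ) ≠ 0 := by exact_mod_cast (rieszConst_pos d).ne'
  rw [hval] at hfin
  convert hfin using 2
  push_cast
  field_simp

lemma tendsto_conv_truncKernel {d : ℕ} (i : Fin d) {f : (Fin d → ℝ) → ℂ}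
    {g : (Fin d → ℝ) → Fin d → ℂ} (hf : Integrable f) (hg : HasRiesz f g) :
    ∀ᵐ x, Tendsto (fun n : ℕ => ∫ y, f y *
      (truncKernel i (1 / ((n : ℝ) + 1)) ((n : ℝ) + 1) (x - y) : ℂ)) atTop (𝓝 (g x i)) := by
  filter_upwards [hg] with x hx
  have h1 : Tendsto (truncInt i fun y => f (x - y)) (𝓝[>] 0) (𝓝 (g x i)) := by
    refine (((continuous_apply i).tendsto _).comp hx).congr' ?_
    filter_upwards [self_mem_nhdsWithin] with ε hε
    exact truncRiesz_apply i hf x hε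
  refine (tendsto_integral_mul_truncKernel i (hf.comp_sub_left x) h1).congr fun n => ?_
  rw [← integral_sub_left_eq_self _ volume x]
  simp

/-- The Riesz transform of an `L¹` function acts by its multiplier when paired with a function
with integrable Fourier transform, provided it is itself in `L¹`. -/
theorem integral_mul_riesz {d : ℕ} (i : Fin d) {f : (Fin d → ℝ) → ℂ} {g : (Fin d → ℝ) → Fin d → ℂ}
    (hf : Integrable f) (hg : HasRiesz f g) (hgi : Integrable g) {ψ : (Fin d → ℝ) → ℂ}
    (hψ : Integrable ψ) {M : ℝ} (hM : ∀ x, ‖ψ x‖ ≤ M) (hψ' : Integrable (ftInv ψ)) :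
    ∫ x, ψ x * g x i = ∫ ξ, rieszMult i ξ * (ft f ξ * ftInv ψ ξ) := by
  obtain ⟨H, hH⟩ := exists_lintegral_truncKernel_sub_le d
  have ha : ∀ n : ℕ, 0 < 1 / ((n : ℝ) + 1) := fun n => by positivity
  set m : ℕ → (Fin d → ℝ) → ℂ := fun n => truncMult i (1 / ((n : ℝ) + 1)) ((n : ℝ) + 1) with hm
  set K : ℕ → (Fin d → ℝ) → ℂ := fun n x =>
    (truncKernel i (1 / ((n : ℝ) + 1)) ((n : ℝ) + 1) x : ℂ) with hK
  have hmi : ∀ n, Integrable (m n) := fun n => integrable_truncMult i (ha n) _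
  have hm1 : ∀ n ξ, ‖m n ξ‖ ≤ 1 := fun n ξ => norm_truncMult_le_one i (ha n) _ ξ
  have hKm : ∀ n x, K n x = ftInv (m n) x := fun n x => (ftInv_truncMult i (ha n) _ x).symm
  have hpair : ∀ n (u V : (Fin d → ℝ) → ℂ), Integrable V → Integrable u →
      ∫ x, V x * ∫ y, u y * K n (x - y) = ∫ ξ, m n ξ * (ft u ξ * ftInv V ξ) := by
    intro n u V hV hu
    simp_rw [hKm]
    exact integral_mul_conv_eq_ft (hmi n) hV hu
  have hbound : ∀ n (u : (Fin d → ℝ) → ℂ), ∀ ξ,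
      ‖m n ξ * (ft u ξ * ftInv ψ ξ)‖ ≤ (∫ x, ‖u x‖) * ‖ftInv ψ ξ‖ := by
    intro n u ξ
    rw [norm_mul, norm_mul]
    refine (mul_le_of_le_one_left (by positivity) (hm1 n ξ)).trans ?_
    gcongr
    exact norm_ft_le u ξ
  have h1 := tendsto_integral_mul_conv (K := K) (H := H) (f := f) (g := fun x => g x i) (ψ := ψ)
    (M := M) (C := ∫ ξ, ‖ftInv ψ ξ‖)
    (fun n => continuous_truncKernel i (ha n) _)
    (fun n => ⟨_, norm_truncKernel_le i (ha n) _⟩)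
    (fun n V G hV hG hVb hGb => by
      simp_rw [hKm]
      exact norm_integral_mul_conv_sq_le (hmi n) (hm1 n) hV hG hVb hGb)
    (fun n r hr h hh => hH i _ _ (ha n) r hr h hh) hψ hM
    (fun n u hu => by
      rw [hpair n u ψ hψ hu, mul_comm, ← integral_const_mul]
      exact norm_integral_le_of_norm_le (hψ'.norm.const_mul _)
        (Eventually.of_forall (hbound n u)))
    hf (hgi.eval i) (tendsto_conv_truncKernel i hf hg)
  simp_rw [fun n => hpair n f ψ hψ hf] at h1
  refine tendsto_nhds_unique h1 ?_
  refine tendsto_integral_of_dominated_convergence (fun ξ => (∫ x, ‖f x‖) * ‖ftInv ψ ξ‖)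
    (fun n => (hmi n).aestronglyMeasurable.mul
      ((continuous_ft hf).aestronglyMeasurable.mul hψ'.aestronglyMeasurable))
    (hψ'.norm.const_mul _) (fun n => Eventually.of_forall (hbound n f))
    (Eventually.of_forall fun ξ => (tendsto_truncMult i ξ).mul_const _)

/-- Integral of `F` over the unit cube against a character of `ℤ^d`. -/
def cubeCoeff {d : ℕ} (F : (Fin d → ℝ) → ℂ) (k : Fin d → ℤ) : ℂ :=
  ∫ ξ in centeredCube d, chr ξ (intVec k) * F ξ

lemma centeredCube_ae_eq (d : ℕ) : ({x : Fin d → ℝ | ∀ i, x i ∈ Ioc (-(1 / 2) : ℝ) (-(1 / 2) + 1)} :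
    Set (Fin d → ℝ)) =ᵐ[volume] centeredCube d := by
  have h1 : {x : Fin d → ℝ | ∀ i, x i ∈ Ioc (-(1 / 2) : ℝ) (-(1 / 2) + 1)} =
      univ.pi fun _ => Ioc (-(1 / 2) : ℝ) (1 / 2) := by
    ext x
    norm_num [Set.mem_pi]
  rw [h1]
  exact (Measure.univ_pi_Ioc_ae_eq_Icc (μ := fun _ => volume)).trans
    (Measure.univ_pi_Ioo_ae_eq_Icc (μ := fun _ => volume)).symm

lemma mFourier_neg_coe {d : ℕ} (n : Fin d → ℤ) (x : Fin d → ℝ) :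
    UnitAddTorus.mFourier (-n) (fun i => (x i : UnitAddCircle)) = chr x (intVec (-n)) := by
  simp only [UnitAddTorus.mFourier, ContinuousMap.coe_mk, fourier_coe_apply, chr, dotP, intVec]
  rw [← Complex.exp_sum]
  congr 1
  push_cast
  rw [Finset.mul_sum, Finset.sum_mul]
  refine Finset.sum_congr rfl fun i _ => ?_
  simp
  ring

/-- Representative in the half-open unit cube of a point of the torus. -/
def torusRep {d : ℕ} (t : UnitAddTorus (Fin d)) : Fin d → ℝ :=
  (UnitAddTorus.measurableEquivPiIoc (fun _ : Fin d => (-(1 / 2) : ℝ)) t).1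

lemma measurable_torusRep {d : ℕ} : Measurable (torusRep (d := d)) :=
  measurable_subtype_coe.comp (UnitAddTorus.measurableEquivPiIoc _).measurable

lemma torusRep_coe {d : ℕ} {x : Fin d → ℝ} (hx : ∀ i, x i ∈ Ioc (-(1 / 2) : ℝ) (-(1 / 2) + 1)) :
    torusRep (fun i => (x i : UnitAddCircle)) = x := by
  have := (UnitAddTorus.measurableEquivPiIoc (fun _ : Fin d => (-(1 / 2) : ℝ))).apply_symm_apply
    ⟨x, hx⟩
  rw [UnitAddTorus.coe_symm_measurableEquivPiIoc_apply] at this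
  rw [torusRep, this]

/-- Parseval's identity on the unit cube. -/
lemma hasSum_cubeCoeff {d : ℕ} {F G : (Fin d → ℝ) → ℂ} (hF : Measurable F) (hG : Measurable G)
    {A B : ℝ} (hFb : ∀ ξ, ‖F ξ‖ ≤ A) (hGb : ∀ ξ, ‖G ξ‖ ≤ B) :
    HasSum (fun k => (starRingEnd ℂ) (cubeCoeff F k) * cubeCoeff G k)
      (∫ ξ in centeredCube d, (starRingEnd ℂ) (F ξ) * G ξ) := by
  let _ : MeasureSpace UnitAddCircle := ⟨AddCircle.haarAddCircle⟩
  have _ : IsProbabilityMeasure (volume : Measure UnitAddCircle) :=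
    inferInstanceAs (IsProbabilityMeasure AddCircle.haarAddCircle)
  have hmem : ∀ {F : (Fin d → ℝ) → ℂ} {A : ℝ}, Measurable F → (∀ ξ, ‖F ξ‖ ≤ A) →
      MemLp (fun t : UnitAddTorus (Fin d) => F (torusRep t)) 2 volume := fun hF hFb =>
    MemLp.of_bound (hF.comp measurable_torusRep).aestronglyMeasurable _
      (Eventually.of_forall fun t => hFb _)
  have hint : ∀ {H : UnitAddTorus (Fin d) → ℂ} {J : (Fin d → ℝ) → ℂ},
      (∀ x : Fin d → ℝ, torusRep (fun i => (x i : UnitAddCircle)) = x →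
        H (fun i => (x i : UnitAddCircle)) = J x) →
      ∫ t, H t = ∫ ξ in centeredCube d, J ξ := by
    intro H J h
    rw [UnitAddTorus.integral_preimage H (fun _ => -(1 / 2)),
      ← setIntegral_congr_set (centeredCube_ae_eq d)]
    exact setIntegral_congr_fun (MeasurableSet.univ_pi' fun i => measurableSet_Ioc)
      fun x hx => h x (torusRep_coe hx)
  have hcoef : ∀ {F : (Fin d → ℝ) → ℂ} {A : ℝ} (hF : Measurable F) (hFb : ∀ ξ, ‖F ξ‖ ≤ A)
      (n : Fin d → ℤ), UnitAddTorus.mFourierCoeff ((hmem hF hFb).toLp _) n =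
        cubeCoeff F (-n) := by
    intro F A hF hFb n
    rw [UnitAddTorus.mFourierCoeff, cubeCoeff]
    rw [integral_congr_ae (g := fun t => UnitAddTorus.mFourier (-n) t • F (torusRep t)) (by
      filter_upwards [(hmem hF hFb).coeFn_toLp] with t ht
      rw [ht])]
    refine hint fun x hx => ?_
    rw [mFourier_neg_coe, hx, smul_eq_mul]
  have h := UnitAddTorus.hasSum_prod_mFourierCoeff ((hmem hF hFb).toLp _) ((hmem hG hGb).toLp _)
  simp_rw [hcoef hF hFb, hcoef hG hGb] at h
  rw [← (Equiv.neg (Fin d → ℤ)).hasSum_iff]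
  convert h using 1
  · rfl
  · rw [integral_congr_ae (g := fun t => (starRingEnd ℂ) (F (torusRep t)) * G (torusRep t)) (by
      filter_upwards [(hmem hF hFb).coeFn_toLp, (hmem hG hGb).coeFn_toLp] with t ht ht'
      rw [ht, ht'])]
    exact (hint fun x hx => by rw [hx]).symm

lemma map_mulVec_volume {d : ℕ} {b : Matrix (Fin d) (Fin d) ℝ} (hb : b.det ≠ 0) :
    Measure.map (fun v => b *ᵥ v) (volume : Measure (Fin d → ℝ)) =
      ENNReal.ofReal |b.det⁻¹| • volume :=
  Real.map_matrix_volume_pi_eq_smul_volume_pi hb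

/-- Multiplication by an invertible matrix, as a measurable equivalence. -/
def mulVecEquiv {d : ℕ} (b : Matrix (Fin d) (Fin d) ℝ) (hb : b.det ≠ 0) :
    (Fin d → ℝ) ≃ᵐ (Fin d → ℝ) where
  toFun v := b *ᵥ v
  invFun v := b⁻¹ *ᵥ v
  left_inv v := by simp [Matrix.mulVec_mulVec, Matrix.nonsing_inv_mul _ (isUnit_iff_ne_zero.2 hb)]
  right_inv v := by simp [Matrix.mulVec_mulVec, Matrix.mul_nonsing_inv _ (isUnit_iff_ne_zero.2 hb)]
  measurable_toFun := (Continuous.matrix_mulVec continuous_const continuous_id).measurable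
  measurable_invFun := (Continuous.matrix_mulVec continuous_const continuous_id).measurable

/-- Linear change of variables. -/
lemma integral_comp_mulVec {d : ℕ} {b : Matrix (Fin d) (Fin d) ℝ} (hb : b.det ≠ 0)
    {E : Type*} [NormedAddCommGroup E] [NormedSpace ℝ E] (F : (Fin d → ℝ) → E) :
    ∫ v, F (b *ᵥ v) = |b.det|⁻¹ • ∫ x, F x := by
  have := (mulVecEquiv b hb).measurableEmbedding.integral_map (μ := volume) F
  change ∫ y, F y ∂(Measure.map (fun v => b *ᵥ v) volume) = ∫ v, F (b *ᵥ v) at this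
  rw [← this, map_mulVec_volume hb, integral_smul_measure, abs_inv,
    ENNReal.toReal_ofReal (inv_nonneg.2 (abs_nonneg _))]

lemma integrable_comp_mulVec {d : ℕ} {b : Matrix (Fin d) (Fin d) ℝ} (hb : b.det ≠ 0)
    {E : Type*} [NormedAddCommGroup E] {F : (Fin d → ℝ) → E} (hF : Integrable F) :
    Integrable fun v => F (b *ᵥ v) := by
  refine (integrable_map_equiv (μ := volume) (mulVecEquiv b hb) F).1 ?_
  change Integrable F (Measure.map (fun v => b *ᵥ v) volume)
  rw [map_mulVec_volume hb]
  exact hF.smul_measure ENNReal.ofReal_ne_top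

lemma det_nonsing_inv_ne_zero {d : ℕ} {b : Matrix (Fin d) (Fin d) ℝ} (hb : b.det ≠ 0) :
    b⁻¹.det ≠ 0 := by
  rw [Matrix.det_nonsing_inv, Ring.inverse_eq_inv']
  exact inv_ne_zero hb

lemma vecMul_mul_inv {d : ℕ} {b : Matrix (Fin d) (Fin d) ℝ} (hb : b.det ≠ 0) (ξ : Fin d → ℝ) :
    (ξ ᵥ* b) ᵥ* b⁻¹ = ξ := by
  simp [Matrix.vecMul_vecMul, Matrix.mul_nonsing_inv _ (isUnit_iff_ne_zero.2 hb)]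

/-- Linear change of variables acting on row vectors. -/
lemma integral_comp_vecMul {d : ℕ} {b : Matrix (Fin d) (Fin d) ℝ} (hb : b.det ≠ 0)
    {E : Type*} [NormedAddCommGroup E] [NormedSpace ℝ E] (F : (Fin d → ℝ) → E) :
    ∫ v, F (v ᵥ* b) = |b.det|⁻¹ • ∫ x, F x := by
  simp_rw [← Matrix.mulVec_transpose]
  rw [integral_comp_mulVec (by rwa [Matrix.det_transpose]) F, Matrix.det_transpose]

lemma dotP_vecMul {d : ℕ} (b : Matrix (Fin d) (Fin d) ℝ) (ξ x : Fin d → ℝ) :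
    dotP (ξ ᵥ* b) x = dotP ξ (b *ᵥ x) :=
  (Matrix.dotProduct_mulVec ξ b x).symm

lemma chr_vecMul {d : ℕ} (b : Matrix (Fin d) (Fin d) ℝ) (ξ x : Fin d → ℝ) :
    chr (ξ ᵥ* b) x = chr ξ (b *ᵥ x) := by
  rw [chr, chr, dotP_vecMul]

lemma chr_smul {d : ℕ} (c : ℝ) (ξ x : Fin d → ℝ) : chr (c • ξ) x = chr ξ (c • x) := by
  simp only [chr, dotP, Pi.smul_apply, smul_eq_mul, mul_left_comm, mul_assoc]

section SchwartzFourier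

open scoped FourierTransform SchwartzMap

/-- A Schwartz function on `Fin d → ℝ`, viewed on Euclidean space. -/
def euclSchwartz {d : ℕ} (Φ : SchwartzMap (Fin d → ℝ) ℂ) :
    SchwartzMap (EuclideanSpace ℝ (Fin d)) ℂ :=
  SchwartzMap.compCLMOfContinuousLinearEquiv ℂ (PiLp.continuousLinearEquiv 2 ℝ _) Φ

lemma euclSchwartz_apply {d : ℕ} (Φ : SchwartzMap (Fin d → ℝ) ℂ) (v : EuclideanSpace ℝ (Fin d)) :
    euclSchwartz Φ v = Φ v.ofLp := rfl

/-- A Schwartz function on Euclidean space, viewed on `Fin d → ℝ`. -/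
def piSchwartz {d : ℕ} (Φ : SchwartzMap (EuclideanSpace ℝ (Fin d)) ℂ) :
    SchwartzMap (Fin d → ℝ) ℂ :=
  SchwartzMap.compCLMOfContinuousLinearEquiv ℂ (PiLp.continuousLinearEquiv 2 ℝ _).symm Φ

lemma piSchwartz_apply {d : ℕ} (Φ : SchwartzMap (EuclideanSpace ℝ (Fin d)) ℂ) (x : Fin d → ℝ) :
    piSchwartz Φ x = Φ (WithLp.toLp 2 x) := rfl

lemma integral_ofLp {d : ℕ} (F : (Fin d → ℝ) → ℂ) :
    ∫ v : EuclideanSpace ℝ (Fin d), F v.ofLp = ∫ x, F x :=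
  (PiLp.volume_preserving_ofLp (Fin d)).integral_comp
    (MeasurableEquiv.toLp 2 (Fin d → ℝ)).symm.measurableEmbedding F

lemma inner_eq_dotP {d : ℕ} (v w : EuclideanSpace ℝ (Fin d)) :
    inner ℝ v w = dotP w.ofLp v.ofLp := by
  simp [PiLp.inner_apply, dotP]

lemma ft_schwartz {d : ℕ} (Φ : SchwartzMap (Fin d → ℝ) ℂ) :
    ft Φ = piSchwartz (𝓕 (euclSchwartz Φ)) := by
  ext ξ
  rw [piSchwartz_apply, SchwartzMap.fourier_coe, Real.fourier_eq', ft, ← integral_ofLp]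
  congr 1 with v
  rw [inner_eq_dotP, euclSchwartz_apply, smul_eq_mul, neg_mul, neg_mul]

lemma ftInv_schwartz {d : ℕ} (Φ : SchwartzMap (Fin d → ℝ) ℂ) :
    ftInv Φ = piSchwartz (𝓕⁻ (euclSchwartz Φ)) := by
  ext ξ
  rw [piSchwartz_apply, SchwartzMap.fourierInv_coe, Real.fourierInv_eq', ftInv, ← integral_ofLp]
  congr 1 with v
  rw [inner_eq_dotP, euclSchwartz_apply, smul_eq_mul, dotP_comm]

lemma euclSchwartz_piSchwartz {d : ℕ} (Φ : SchwartzMap (EuclideanSpace ℝ (Fin d)) ℂ) :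
    euclSchwartz (piSchwartz Φ) = Φ := by
  ext v
  rfl

lemma piSchwartz_euclSchwartz {d : ℕ} (Φ : SchwartzMap (Fin d → ℝ) ℂ) :
    piSchwartz (euclSchwartz Φ) = Φ := by
  ext v
  rfl

lemma ftInv_ft_schwartz {d : ℕ} (Φ : SchwartzMap (Fin d → ℝ) ℂ) : ftInv (ft Φ) = Φ := by
  rw [ft_schwartz, ftInv_schwartz, euclSchwartz_piSchwartz, FourierTransform.fourierInv_fourier_eq,
    piSchwartz_euclSchwartz]

lemma ft_ftInv_schwartz {d : ℕ} (Φ : SchwartzMap (Fin d → ℝ) ℂ) : ft (ftInv Φ) = Φ := by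
  rw [ftInv_schwartz, ft_schwartz, euclSchwartz_piSchwartz, FourierTransform.fourier_fourierInv_eq,
    piSchwartz_euclSchwartz]

lemma integrable_ft_schwartz {d : ℕ} (Φ : SchwartzMap (Fin d → ℝ) ℂ) : Integrable (ft Φ) := by
  rw [ft_schwartz]
  exact (piSchwartz _).integrable

lemma integrable_ftInv_schwartz {d : ℕ} (Φ : SchwartzMap (Fin d → ℝ) ℂ) :
    Integrable (ftInv Φ) := by
  rw [ftInv_schwartz]
  exact (piSchwartz _).integrable

lemma IsCutoff.exists_schwartz {d : ℕ} {ν : (Fin d → ℝ) → ℝ} (hν : IsCutoff d ν) :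
    ∃ Φ : SchwartzMap (Fin d → ℝ) ℂ, (fun ξ => ((ν ξ : ℝ) : ℂ)) = Φ := by
  have hb : Bornology.IsBounded (centeredCube d) :=
    Bornology.IsBounded.pi fun _ => Metric.isBounded_Ioo _ _
  have hc : HasCompactSupport ν :=
    Metric.isCompact_of_isClosed_isBounded (isClosed_tsupport ν) (hb.subset hν.supp)
  have hc' : HasCompactSupport fun ξ => ((ν ξ : ℝ) : ℂ) :=
    hc.comp_left (g := fun r : ℝ => (r : ℂ)) Complex.ofReal_zero
  exact ⟨hc'.toSchwartzMap (Complex.ofRealCLM.contDiff.comp hν.smooth), rfl⟩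

lemma IsCutoff.integrable_ftInv {d : ℕ} {ν : (Fin d → ℝ) → ℝ} (hν : IsCutoff d ν) :
    Integrable (ftInv fun ξ => ((ν ξ : ℝ) : ℂ)) := by
  obtain ⟨Φ, hΦ⟩ := hν.exists_schwartz
  rw [hΦ]
  exact integrable_ftInv_schwartz Φ

lemma IsCutoff.ft_ftInv {d : ℕ} {ν : (Fin d → ℝ) → ℝ} (hν : IsCutoff d ν) :
    ft (ftInv fun ξ => ((ν ξ : ℝ) : ℂ)) = fun ξ => ((ν ξ : ℝ) : ℂ) := by
  obtain ⟨Φ, hΦ⟩ := hν.exists_schwartz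
  rw [hΦ]
  exact ft_ftInv_schwartz Φ

lemma IsCutoff.apply_zero {d : ℕ} {ν : (Fin d → ℝ) → ℝ} (hν : IsCutoff d ν) : ν 0 = 1 :=
  hν.one_near_zero.self_of_nhds

lemma IsCutoff.norm_le {d : ℕ} {ν : (Fin d → ℝ) → ℝ} (hν : IsCutoff d ν) (ξ : Fin d → ℝ) :
    ‖((ν ξ : ℝ) : ℂ)‖ ≤ ∫ x, ‖ftInv (fun ξ => ((ν ξ : ℝ) : ℂ)) x‖ := by
  refine le_trans (le_of_eq ?_) (norm_ft_le _ ξ)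
  rw [hν.ft_ftInv]

lemma IsCutoff.one_le_integral_norm {d : ℕ} {ν : (Fin d → ℝ) → ℝ} (hν : IsCutoff d ν) :
    1 ≤ ∫ x, ‖ftInv (fun ξ => ((ν ξ : ℝ) : ℂ)) x‖ := by
  refine le_trans (le_of_eq ?_) (hν.norm_le 0)
  rw [hν.apply_zero]
  simp

end SchwartzFourier

lemma integrable_conv_integrand {d : ℕ} {f g : (Fin d → ℝ) → ℂ} (hf : Integrable f)
    (hg : Integrable g) : Integrable (fun p : (Fin d → ℝ) × (Fin d → ℝ) => f p.2 * g (p.1 - p.2))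
      (volume.prod volume) :=
  hf.convolution_integrand (ContinuousLinearMap.mul ℝ ℂ) hg

lemma integrable_conv {d : ℕ} {f g : (Fin d → ℝ) → ℂ} (hf : Integrable f)
    (hg : Integrable g) : Integrable (conv f g) :=
  (integrable_conv_integrand hf hg).integral_prod_left

lemma ft_conv {d : ℕ} {f g : (Fin d → ℝ) → ℂ} (hf : Integrable f) (hg : Integrable g)
    (ξ : Fin d → ℝ) : ft (conv f g) ξ = ft f ξ * ft g ξ := by
  have hi : Integrable (fun p : (Fin d → ℝ) × (Fin d → ℝ) =>
      (starRingEnd ℂ) (chr ξ p.1) * (f p.2 * g (p.1 - p.2))) (volume.prod volume) := by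
    refine (integrable_conv_integrand hf hg).bdd_mul (c := 1) ?_
      (Eventually.of_forall fun p => by rw [RCLike.norm_conj, norm_chr])
    exact (Complex.continuous_conj.comp
      ((continuous_chr_right ξ).comp continuous_fst)).aestronglyMeasurable
  calc ft (conv f g) ξ
      = ∫ x, ∫ y, (starRingEnd ℂ) (chr ξ x) * (f y * g (x - y)) := by
        rw [ft_eq]
        congr 1 with x
        rw [conv, integral_const_mul]
    _ = ∫ y, ∫ x, (starRingEnd ℂ) (chr ξ x) * (f y * g (x - y)) :=
        integral_integral_swap
          (f := fun x y => (starRingEnd ℂ) (chr ξ x) * (f y * g (x - y))) hi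
    _ = ∫ y, (starRingEnd ℂ) (chr ξ y) * f y * ft g ξ := by
        congr 1 with y
        rw [ft_eq, ← integral_const_mul, ← integral_add_right_eq_self _ y]
        congr 1 with x
        rw [add_sub_cancel_right, chr_add, map_mul]
        ring
    _ = _ := by rw [integral_mul_const, ← ft_eq]

lemma norm_conv_le {d : ℕ} {f g : (Fin d → ℝ) → ℂ} (hf : Integrable f) {M : ℝ}
    (hM : ∀ x, ‖g x‖ ≤ M) (x : Fin d → ℝ) : ‖conv f g x‖ ≤ (∫ y, ‖f y‖) * M := by
  rw [← integral_mul_const]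
  refine norm_integral_le_of_norm_le (hf.norm.mul_const _) (Eventually.of_forall fun y => ?_)
  rw [norm_mul]
  exact mul_le_mul_of_nonneg_left (hM _) (norm_nonneg _)

/-- The `L¹` kernel whose Fourier transform is `η ↦ ν (η b)`. -/
def smoothKer {d : ℕ} (b : Matrix (Fin d) (Fin d) ℝ) (ν : (Fin d → ℝ) → ℝ) (w : Fin d → ℝ) : ℂ :=
  |b.det|⁻¹ • ftInv (fun ξ => ((ν ξ : ℝ) : ℂ)) (b⁻¹ *ᵥ w)

lemma inv_mulVec_mulVec {d : ℕ} {b : Matrix (Fin d) (Fin d) ℝ} (hb : b.det ≠ 0) (v : Fin d → ℝ) :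
    b⁻¹ *ᵥ (b *ᵥ v) = v := by
  simp [Matrix.mulVec_mulVec, Matrix.nonsing_inv_mul _ (isUnit_iff_ne_zero.2 hb)]

lemma integrable_smoothKer {d : ℕ} {b : Matrix (Fin d) (Fin d) ℝ} (hb : b.det ≠ 0)
    {ν : (Fin d → ℝ) → ℝ} (hν : IsCutoff d ν) : Integrable (smoothKer b ν) :=
  (integrable_comp_mulVec (det_nonsing_inv_ne_zero hb) hν.integrable_ftInv).smul (|b.det|⁻¹)

lemma integral_norm_smoothKer {d : ℕ} {b : Matrix (Fin d) (Fin d) ℝ} (hb : b.det ≠ 0)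
    (ν : (Fin d → ℝ) → ℝ) :
    ∫ w, ‖smoothKer b ν w‖ = ∫ x, ‖ftInv (fun ξ => ((ν ξ : ℝ) : ℂ)) x‖ := by
  have h := integral_comp_mulVec hb
    (fun w => ‖ftInv (fun ξ => ((ν ξ : ℝ) : ℂ)) (b⁻¹ *ᵥ w)‖)
  simp_rw [inv_mulVec_mulVec hb] at h
  simp_rw [smoothKer, norm_smul, Real.norm_eq_abs, abs_inv, abs_abs]
  rw [integral_const_mul, h, smul_eq_mul]

lemma ft_smoothKer {d : ℕ} {b : Matrix (Fin d) (Fin d) ℝ} (hb : b.det ≠ 0)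
    {ν : (Fin d → ℝ) → ℝ} (hν : IsCutoff d ν) (η : Fin d → ℝ) :
    ft (smoothKer b ν) η = ((ν (η ᵥ* b) : ℝ) : ℂ) := by
  have h := integral_comp_mulVec hb (fun w => (starRingEnd ℂ) (chr η w) *
    ftInv (fun ξ => ((ν ξ : ℝ) : ℂ)) (b⁻¹ *ᵥ w))
  simp_rw [inv_mulVec_mulVec hb, ← chr_vecMul] at h
  rw [← ft_eq, hν.ft_ftInv] at h
  beta_reduce at h
  rw [ft_eq, h, ← integral_smul]
  congr 1 with w
  rw [smoothKer, mul_smul_comm]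

lemma intVec_injective {d : ℕ} : Function.Injective (intVec (d := d)) := fun _ _ h =>
  funext fun i => Int.cast_injective (congrFun h i)

/-- The basis of `ℝ^d` given by the columns of an invertible matrix. -/
def colBasis {d : ℕ} (b : Matrix (Fin d) (Fin d) ℝ) (hb : b.det ≠ 0) :
    Module.Basis (Fin d) ℝ (Fin d → ℝ) :=
  (Pi.basisFun ℝ (Fin d)).map (Matrix.toLin'OfInv
    (Matrix.nonsing_inv_mul b (isUnit_iff_ne_zero.2 hb))
    (Matrix.mul_nonsing_inv b (isUnit_iff_ne_zero.2 hb)))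

lemma mulVec_intVec_mem_span {d : ℕ} (b : Matrix (Fin d) (Fin d) ℝ) (hb : b.det ≠ 0)
    (k : Fin d → ℤ) : b *ᵥ intVec k ∈ Submodule.span ℤ (Set.range (colBasis b hb)) := by
  have h : b *ᵥ intVec k = ∑ i, k i • colBasis b hb i := by
    have : intVec k = ∑ i, k i • (Pi.basisFun ℝ (Fin d)) i := by
      ext j
      simp [intVec, Finset.sum_apply, Pi.single_apply]
    rw [this, Matrix.mulVec_sum]
    refine Finset.sum_congr rfl fun i _ => ?_
    rw [← Int.cast_smul_eq_zsmul ℝ, ← Int.cast_smul_eq_zsmul ℝ, Matrix.mulVec_smul, colBasis,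
      Module.Basis.map_apply]
    exact congrArg _ (Matrix.toLin'_apply b _).symm
  rw [h]
  exact Submodule.sum_mem _ fun i _ =>
    Submodule.smul_mem _ _ (Submodule.subset_span (Set.mem_range_self i))

lemma mulVec_intVec_injective {d : ℕ} {b : Matrix (Fin d) (Fin d) ℝ} (hb : b.det ≠ 0) :
    Function.Injective fun k => b *ᵥ intVec k := fun k l h => intVec_injective <| by
  rw [← inv_mulVec_mulVec hb (intVec k), ← inv_mulVec_mulVec hb (intVec l)]
  exact congrArg _ h

/-- The lattice translates of a Schwartz function are summable at every point. -/
lemma summable_schwartz_translates {d : ℕ} {b : Matrix (Fin d) (Fin d) ℝ} (hb : b.det ≠ 0)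
    (Φ : SchwartzMap (Fin d → ℝ) ℂ) (y : Fin d → ℝ) :
    Summable fun k : Fin d → ℤ => ‖Φ (y - b *ᵥ intVec k)‖ := by
  set L := Submodule.span ℤ (Set.range (colBasis b hb))
  obtain ⟨C, -, hC⟩ := Φ.decay (Module.finrank ℤ L + 1) 0
  have h1 := ZLattice.summable_norm_sub_inv_pow L (Module.finrank ℤ L + 1) (Nat.lt_succ_self _) y
  have hinj : Function.Injective fun k : Fin d → ℤ =>
      (⟨b *ᵥ intVec k, mulVec_intVec_mem_span b hb k⟩ : L) := fun k l h =>
    mulVec_intVec_injective hb (congrArg Subtype.val h)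
  have h2 := (h1.comp_injective hinj).mul_left C
  refine Summable.of_norm_bounded_eventually h2 ?_
  have hfin : {k : Fin d → ℤ | b *ᵥ intVec k = y}.Finite :=
    Set.Subsingleton.finite fun k hk l hl => mulVec_intVec_injective hb (hk.trans hl.symm)
  filter_upwards [hfin.compl_mem_cofinite] with k hk
  have hpos : 0 < ‖y - b *ᵥ intVec k‖ := norm_pos_iff.2 (sub_ne_zero.2 (Ne.symm hk))
  have := hC (y - b *ᵥ intVec k)
  rw [norm_iteratedFDeriv_zero] at this
  rw [norm_norm, Function.comp_apply, norm_sub_rev, inv_pow, ← div_eq_mul_inv,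
    le_div_iff₀ (by positivity), mul_comm]
  exact this

/-- The periodization of `‖χ‖`, with values in `[0,∞]`. -/
def ePeriodization {d : ℕ} (b : Matrix (Fin d) (Fin d) ℝ) (χ : (Fin d → ℝ) → ℂ)
    (y : Fin d → ℝ) : ℝ≥0∞ :=
  ENNReal.ofReal |b.det| * ∑' k : Fin d → ℤ, ‖χ (y - b *ᵥ intVec k)‖ₑ

lemma ePeriodization_schwartz_le {d : ℕ} {b : Matrix (Fin d) (Fin d) ℝ} (hb : b.det ≠ 0)
    (Φ : SchwartzMap (Fin d → ℝ) ℂ) :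
    ∀ᵐ y, ePeriodization b Φ y ≤ eLpNorm (periodization b fun x => ‖Φ x‖) ⊤ volume := by
  rw [eLpNorm_exponent_top]
  filter_upwards [ae_le_eLpNormEssSup (f := periodization b fun x => ‖Φ x‖) (μ := volume)]
    with y hy
  refine le_trans (le_of_eq ?_) hy
  have hs := summable_schwartz_translates hb Φ y
  rw [ePeriodization, periodization, Real.enorm_eq_ofReal
    (mul_nonneg (abs_nonneg _) (tsum_nonneg fun k => norm_nonneg _)),
    ENNReal.ofReal_mul (abs_nonneg _), ENNReal.ofReal_tsum_of_nonneg (fun k => norm_nonneg _) hs]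
  simp_rw [ofReal_norm]

/-- Periodization bound for a convolution. -/
lemma ePeriodization_conv_le {d : ℕ} (b : Matrix (Fin d) (Fin d) ℝ) {κ χ : (Fin d → ℝ) → ℂ}
    (hκ : AEStronglyMeasurable κ) (hχ : Measurable χ) {B : ℝ≥0∞}
    (hB : ∀ᵐ y, ePeriodization b χ y ≤ B) (y : Fin d → ℝ) :
    ePeriodization b (conv κ χ) y ≤ (∫⁻ w, ‖κ w‖ₑ) * B := by
  have h1 : ∀ k : Fin d → ℤ, ‖conv κ χ (y - b *ᵥ intVec k)‖ₑ ≤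
      ∫⁻ w, ‖κ w‖ₑ * ‖χ (y - w - b *ᵥ intVec k)‖ₑ := fun k => by
    refine (enorm_integral_le_lintegral_enorm _).trans (le_of_eq ?_)
    simp_rw [enorm_mul, sub_right_comm y]
  have hm : ∀ k : Fin d → ℤ, Measurable fun w => ‖χ (y - w - b *ᵥ intVec k)‖ₑ := fun k =>
    (hχ.comp ((measurable_id.const_sub y).sub_const _)).enorm
  have hB' : ∀ᵐ w, ePeriodization b χ (y - w) ≤ B :=
    (quasiMeasurePreserving_sub_left_of_right_invariant volume y).ae hB
  calc ePeriodization b (conv κ χ) y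
      ≤ ENNReal.ofReal |b.det| * ∑' k : Fin d → ℤ,
          ∫⁻ w, ‖κ w‖ₑ * ‖χ (y - w - b *ᵥ intVec k)‖ₑ :=
        mul_le_mul_right (ENNReal.tsum_le_tsum h1) _
    _ = ∫⁻ w, ‖κ w‖ₑ * ePeriodization b χ (y - w) := by
        rw [← lintegral_tsum fun k => hκ.enorm.fun_mul (hm k).aemeasurable,
          ← lintegral_const_mul' _ _ ENNReal.ofReal_ne_top]
        congr 1 with w
        rw [ENNReal.tsum_mul_left, ePeriodization, mul_left_comm]
    _ ≤ ∫⁻ w, ‖κ w‖ₑ * B := lintegral_mono_ae (by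
        filter_upwards [hB'] with w hw
        exact mul_le_mul_right hw _)
    _ = _ := lintegral_mul_const'' _ hκ.enorm

/-- The `ℓ¹` bound for an analysis operator in terms of the periodization. -/
lemma tsum_enorm_analysis_le {d : ℕ} (b : Matrix (Fin d) (Fin d) ℝ) {χ : (Fin d → ℝ) → ℂ}
    (hχ : Measurable χ) {B : ℝ≥0∞} (hB : ∀ᵐ y, ePeriodization b χ y ≤ B) {a : ℝ} (ha : a ≠ 0)
    {E : Type*} [NormedAddCommGroup E] [NormedSpace ℂ E] {u : (Fin d → ℝ) → E}
    (hu : AEStronglyMeasurable u) :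
    ∑' k : Fin d → ℤ, ‖((|b.det| : ℝ) : ℂ) •
      ∫ x, (starRingEnd ℂ) (χ (a • x - b *ᵥ intVec k)) • u x‖ₑ ≤ B * ∫⁻ x, ‖u x‖ₑ := by
  have hm : ∀ k : Fin d → ℤ, Measurable fun x => ‖χ (a • x - b *ᵥ intVec k)‖ₑ := fun k =>
    (hχ.comp ((measurable_id.const_smul a).sub_const _)).enorm
  have hB' : ∀ᵐ x, ePeriodization b χ (a • x) ≤ B :=
    (Measure.quasiMeasurePreserving_smul volume ha).ae hB
  have h1 : ∀ k : Fin d → ℤ, ‖((|b.det| : ℝ) : ℂ) •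
      ∫ x, (starRingEnd ℂ) (χ (a • x - b *ᵥ intVec k)) • u x‖ₑ ≤
        ENNReal.ofReal |b.det| * ∫⁻ x, ‖χ (a • x - b *ᵥ intVec k)‖ₑ * ‖u x‖ₑ := fun k => by
    rw [enorm_smul, ← ofReal_norm, Complex.norm_real, Real.norm_eq_abs, abs_abs]
    refine mul_le_mul_right ((enorm_integral_le_lintegral_enorm _).trans (le_of_eq ?_)) _
    simp_rw [enorm_smul, ← ofReal_norm, RCLike.norm_conj]
  calc _ ≤ ∑' k : Fin d → ℤ,
        ENNReal.ofReal |b.det| * ∫⁻ x, ‖χ (a • x - b *ᵥ intVec k)‖ₑ * ‖u x‖ₑ :=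
        ENNReal.tsum_le_tsum h1
    _ = ∫⁻ x, ePeriodization b χ (a • x) * ‖u x‖ₑ := by
        rw [ENNReal.tsum_mul_left, ← lintegral_tsum fun k => (hm k).aemeasurable.fun_mul hu.enorm,
          ← lintegral_const_mul' _ _ ENNReal.ofReal_ne_top]
        congr 1 with x
        rw [ENNReal.tsum_mul_right, ePeriodization, mul_assoc]
    _ ≤ ∫⁻ x, B * ‖u x‖ₑ := lintegral_mono_ae (by
        filter_upwards [hB'] with x hx
        exact mul_le_mul_left hx _)
    _ = _ := lintegral_const_mul'' _ hu.enorm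

/-- The Fourier symbol on the unit cube of an analysis sequence. -/
def analysisSymbol {d : ℕ} (b : Matrix (Fin d) (Fin d) ℝ) (a : ℝ) (φ f : (Fin d → ℝ) → ℂ)
    (ξ : Fin d → ℝ) : ℂ :=
  (starRingEnd ℂ) (ft φ (ξ ᵥ* b⁻¹)) * ft f (a • (ξ ᵥ* b⁻¹))

lemma continuous_vecMul_const {d : ℕ} (b : Matrix (Fin d) (Fin d) ℝ) :
    Continuous fun ξ : Fin d → ℝ => ξ ᵥ* b :=
  Continuous.matrix_vecMul continuous_id continuous_const

lemma continuous_analysisSymbol {d : ℕ} (b : Matrix (Fin d) (Fin d) ℝ) (a : ℝ)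
    {φ f : (Fin d → ℝ) → ℂ} (hφ : Integrable φ) (hf : Integrable f) :
    Continuous (analysisSymbol b a φ f) :=
  (Complex.continuous_conj.comp ((continuous_ft hφ).comp (continuous_vecMul_const _))).mul
    ((continuous_ft hf).comp ((continuous_vecMul_const _).const_smul a))

lemma norm_analysisSymbol_le {d : ℕ} (b : Matrix (Fin d) (Fin d) ℝ) (a : ℝ)
    (φ f : (Fin d → ℝ) → ℂ) (ξ : Fin d → ℝ) :
    ‖analysisSymbol b a φ f ξ‖ ≤ (∫ x, ‖φ x‖) * ∫ x, ‖f x‖ := by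
  rw [analysisSymbol, norm_mul, RCLike.norm_conj]
  exact mul_le_mul (norm_ft_le _ _) (norm_ft_le _ _) (norm_nonneg _)
    (integral_nonneg fun _ => norm_nonneg _)

lemma analysisSymbol_vecMul {d : ℕ} {b : Matrix (Fin d) (Fin d) ℝ} (hb : b.det ≠ 0) (a : ℝ)
    (φ f : (Fin d → ℝ) → ℂ) (η : Fin d → ℝ) :
    analysisSymbol b a φ f (η ᵥ* b) = (starRingEnd ℂ) (ft φ η) * ft f (a • η) := by
  rw [analysisSymbol, vecMul_mul_inv hb]

lemma vecMul_inv_mul {d : ℕ} {b : Matrix (Fin d) (Fin d) ℝ} (hb : b.det ≠ 0) (ξ : Fin d → ℝ) :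
    (ξ ᵥ* b⁻¹) ᵥ* b = ξ := by
  simp [Matrix.vecMul_vecMul, Matrix.nonsing_inv_mul _ (isUnit_iff_ne_zero.2 hb)]

lemma analysisSymbol_eq_zero {d : ℕ} {b : Matrix (Fin d) (Fin d) ℝ} (hb : b.det ≠ 0) (a : ℝ)
    {φ : (Fin d → ℝ) → ℂ} (f : (Fin d → ℝ) → ℂ)
    (hφ : Function.support (ft φ) ⊆ {ξ : Fin d → ℝ | ξ ᵥ* b ∈ centeredCube d})
    {ξ : Fin d → ℝ} (hξ : ξ ∉ centeredCube d) : analysisSymbol b a φ f ξ = 0 := by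
  have : ft φ (ξ ᵥ* b⁻¹) = 0 := by
    by_contra h
    have h' : (ξ ᵥ* b⁻¹) ᵥ* b ∈ centeredCube d := hφ h
    rw [vecMul_inv_mul hb] at h'
    exact hξ h'
  rw [analysisSymbol, this, map_zero, zero_mul]

/-- The analysis coefficients are the Fourier coefficients of the symbol. -/
lemma analysis_eq_cubeCoeff {d : ℕ} {b : Matrix (Fin d) (Fin d) ℝ} (hb : b.det ≠ 0) (a : ℝ)
    (Φ : SchwartzMap (Fin d → ℝ) ℂ)
    (hΦ : Function.support (ft Φ) ⊆ {ξ : Fin d → ℝ | ξ ᵥ* b ∈ centeredCube d})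
    {f : (Fin d → ℝ) → ℂ} (hf : Integrable f) (k : Fin d → ℤ) :
    ((|b.det| : ℝ) : ℂ) * ∫ x, f x * (starRingEnd ℂ) (Φ (a • x - b *ᵥ intVec k)) =
      cubeCoeff (analysisSymbol b a Φ f) k := by
  set p := b *ᵥ intVec k with hp
  have hint : Integrable (fun q : (Fin d → ℝ) × (Fin d → ℝ) =>
      (starRingEnd ℂ) (chr q.2 (a • q.1 - p)) * (f q.1 * (starRingEnd ℂ) (ft Φ q.2)))
      (volume.prod volume) := by
    refine (hf.mul_prod ((LinearIsometryEquiv.integrable_comp_iff Complex.conjLIE).2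
      (integrable_ft_schwartz Φ))).bdd_mul (c := 1) ?_
      (Eventually.of_forall fun q => by rw [RCLike.norm_conj, norm_chr])
    exact (Complex.continuous_conj.comp (continuous_chr.comp
      (by fun_prop : Continuous fun q : (Fin d → ℝ) × (Fin d → ℝ) =>
        (q.2, a • q.1 - p)))).aestronglyMeasurable
  have h1 : ∫ x, f x * (starRingEnd ℂ) (Φ (a • x - p)) =
      ∫ η, chr η p * ((starRingEnd ℂ) (ft Φ η) * ft f (a • η)) := by
    calc ∫ x, f x * (starRingEnd ℂ) (Φ (a • x - p))
        = ∫ x, ∫ η, (starRingEnd ℂ) (chr η (a • x - p)) * (f x * (starRingEnd ℂ) (ft Φ η)) := by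
          congr 1 with x
          rw [← ftInv_ft_schwartz Φ, ftInv_eq, ftInv_ft_schwartz Φ, ← integral_conj,
            ← integral_const_mul]
          congr 1 with η
          rw [map_mul]
          ring
      _ = ∫ η, ∫ x, (starRingEnd ℂ) (chr η (a • x - p)) * (f x * (starRingEnd ℂ) (ft Φ η)) :=
          integral_integral_swap (f := fun x η =>
            (starRingEnd ℂ) (chr η (a • x - p)) * (f x * (starRingEnd ℂ) (ft Φ η))) hint
      _ = _ := by
          congr 1 with η
          rw [← mul_assoc, ft_eq f, ← integral_const_mul]
          congr 1 with x
          rw [chr_sub, map_mul, Complex.conj_conj, chr_smul]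
          ring
  have h2 := integral_comp_vecMul hb
    (fun ξ => chr ξ (intVec k) * analysisSymbol b a Φ f ξ)
  simp_rw [analysisSymbol_vecMul hb, chr_vecMul, ← hp] at h2
  rw [h1, h2, cubeCoeff, setIntegral_eq_integral_of_forall_compl_eq_zero (fun ξ hξ => by
    rw [analysisSymbol_eq_zero hb a f hΦ hξ, mul_zero]), Complex.real_smul, ← mul_assoc,
    ← Complex.ofReal_mul, mul_inv_cancel₀ (abs_ne_zero.2 hb), Complex.ofReal_one, one_mul]

lemma zetaFn_vecMul {d : ℕ} {b : Matrix (Fin d) (Fin d) ℝ} (hb : b.det ≠ 0)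
    (ν : (Fin d → ℝ) → ℝ) (η : Fin d → ℝ) (i : Fin d) :
    zetaFn b ν (η ᵥ* b) i = rieszMult i η * ((ν (η ᵥ* b) : ℝ) : ℂ) := by
  rw [zetaFn, vecMul_mul_inv hb, rieszMult]

lemma norm_rieszMult_le_one {d : ℕ} (i : Fin d) (ξ : Fin d → ℝ) : ‖rieszMult i ξ‖ ≤ 1 := by
  rw [rieszMult, norm_mul, norm_neg, Complex.norm_I, one_mul, Complex.norm_real, Real.norm_eq_abs,
    abs_div, abs_of_nonneg (show 0 ≤ eucNorm ξ from Real.sqrt_nonneg _)]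
  exact div_le_one_of_le₀ (abs_apply_le_eucNorm ξ i) (Real.sqrt_nonneg _)

lemma measurable_rieszMult {d : ℕ} (i : Fin d) : Measurable (rieszMult i) := by
  have h : Measurable fun ξ : Fin d → ℝ => ξ i / eucNorm ξ :=
    (measurable_pi_apply i).div continuous_eucNorm.measurable
  exact (Complex.measurable_ofReal.comp h).const_mul _

lemma norm_zetaFn_le {d : ℕ} {b : Matrix (Fin d) (Fin d) ℝ} (hb : b.det ≠ 0)
    {ν : (Fin d → ℝ) → ℝ} (hν : IsCutoff d ν) (i : Fin d) (ξ : Fin d → ℝ) :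
    ‖zetaFn b ν ξ i‖ ≤ ∫ x, ‖ftInv (fun ξ => ((ν ξ : ℝ) : ℂ)) x‖ := by
  conv_lhs => rw [← vecMul_inv_mul hb ξ]
  rw [zetaFn_vecMul hb, norm_mul]
  exact (mul_le_of_le_one_left (norm_nonneg _) (norm_rieszMult_le_one _ _)).trans (hν.norm_le _)

lemma measurable_zetaFn {d : ℕ} (b : Matrix (Fin d) (Fin d) ℝ)
    {ν : (Fin d → ℝ) → ℝ} (hν : IsCutoff d ν) (i : Fin d) :
    Measurable fun ξ => zetaFn b ν ξ i :=
  ((measurable_rieszMult i).comp (continuous_vecMul_const b⁻¹).measurable).mul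
    (Complex.measurable_ofReal.comp hν.smooth.continuous.measurable)

lemma volume_centeredCube_ne_top (d : ℕ) : volume (centeredCube d) ≠ ⊤ :=
  (Bornology.IsBounded.pi fun _ => Metric.isBounded_Ioo _ _).measure_lt_top.ne

lemma zKernel_apply {d : ℕ} {b : Matrix (Fin d) (Fin d) ℝ} (hb : b.det ≠ 0)
    {ν : (Fin d → ℝ) → ℝ} (hν : IsCutoff d ν) (k : Fin d → ℤ) (i : Fin d) :
    zKernel b ν k i = cubeCoeff (fun ξ => zetaFn b ν ξ i) k := by
  rw [zKernel, eval_integral]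
  · rfl
  · intro i
    have : IntegrableOn (fun ξ => chr ξ (intVec k) * zetaFn b ν ξ i) (centeredCube d) := by
      refine Measure.integrableOn_of_bounded (M := ∫ x, ‖ftInv (fun ξ => ((ν ξ : ℝ) : ℂ)) x‖)
        (volume_centeredCube_ne_top d) ?_ (Eventually.of_forall fun ξ => ?_)
      · exact ((continuous_chr_left _).measurable.mul
          (measurable_zetaFn b hν i)).aestronglyMeasurable
      · rw [norm_mul, norm_chr, one_mul]
        exact norm_zetaFn_le hb hν i ξ
    exact this

lemma intVec_sub {d : ℕ} (k l : Fin d → ℤ) : intVec (k - l) = intVec k - intVec l := by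
  ext i
  simp [intVec]

/-- Convolution with the discrete Riesz kernel multiplies Fourier symbols. -/
lemma dConv_zKernel {d : ℕ} {b : Matrix (Fin d) (Fin d) ℝ} (hb : b.det ≠ 0)
    {ν : (Fin d → ℝ) → ℝ} (hν : IsCutoff d ν) {S : (Fin d → ℝ) → ℂ} (hS : Continuous S) {A : ℝ}
    (hA : ∀ ξ, ‖S ξ‖ ≤ A) (k : Fin d → ℤ) :
    dConv (cubeCoeff S) (zKernel b ν) k =
      fun i => ∫ ξ in centeredCube d, chr ξ (intVec k) * S ξ * zetaFn b ν ξ i := by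
  refine HasSum.tsum_eq (Pi.hasSum.2 fun i => ?_)
  have hF : Continuous fun ξ => (starRingEnd ℂ) (chr ξ (intVec k) * S ξ) :=
    Complex.continuous_conj.comp ((continuous_chr_left _).mul hS)
  have h := hasSum_cubeCoeff hF.measurable (measurable_zetaFn b hν i) (A := A)
    (fun ξ => by rw [RCLike.norm_conj, norm_mul, norm_chr, one_mul]; exact hA ξ)
    (norm_zetaFn_le hb hν i)
  simp_rw [Complex.conj_conj] at h
  convert h using 2 with l
  rw [Pi.smul_apply, zKernel_apply hb hν, smul_eq_mul]
  congr 1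
  rw [cubeCoeff, cubeCoeff, ← integral_conj]
  congr 1 with ξ
  rw [map_mul, Complex.conj_conj, intVec_sub, chr_sub]
  ring

lemma integral_comp_smul_pi {d : ℕ} (a : ℝ) (F : (Fin d → ℝ) → ℂ) :
    ∫ x, F (a • x) = |(a ^ d)⁻¹| • ∫ x, F x := by
  rw [Measure.integral_comp_smul, Module.finrank_fin_fun]

lemma ftInv_conj_dilate {d : ℕ} {a : ℝ} (ha : a ≠ 0) (χ : (Fin d → ℝ) → ℂ) (p ξ : Fin d → ℝ) :
    ftInv (fun x => (starRingEnd ℂ) (χ (a • x - p))) ξ =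
      |(a ^ d)⁻¹| • (chr (a⁻¹ • ξ) p * (starRingEnd ℂ) (ft χ (a⁻¹ • ξ))) := by
  have h := integral_comp_smul_pi a
    fun y => (starRingEnd ℂ) (chr (a⁻¹ • ξ) y) * χ (y - p)
  simp_rw [chr_smul, inv_smul_smul₀ ha] at h
  rw [ftInv_conj, ft_eq, h, Complex.real_smul, map_mul, Complex.conj_ofReal, Complex.real_smul]
  congr 1
  rw [← integral_add_right_eq_self _ p, ft_eq, ← Complex.conj_conj (chr (a⁻¹ • ξ) p), ← map_mul,
    ← integral_const_mul]
  congr 2 with y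
  rw [add_sub_cancel_right, ← chr_smul, chr_add, map_mul]
  ring

lemma eucNorm_smul_eq {d : ℕ} (a : ℝ) (ξ : Fin d → ℝ) : eucNorm (a • ξ) = |a| * eucNorm ξ := by
  simp only [eucNorm, Pi.smul_apply, smul_eq_mul, mul_pow, ← Finset.mul_sum]
  rw [Real.sqrt_mul (sq_nonneg a), Real.sqrt_sq_eq_abs]

lemma rieszMult_smul {d : ℕ} (a : ℝ) (i : Fin d) (ξ : Fin d → ℝ) :
    rieszMult i (a • ξ) = ((a / |a| : ℝ) : ℂ) * rieszMult i ξ := by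
  rw [rieszMult, rieszMult, eucNorm_smul_eq, Pi.smul_apply, smul_eq_mul, mul_div_mul_comm]
  push_cast
  ring

/-- Pairing the Riesz transform with a dilated and translated test function. -/
lemma integral_conj_mul_riesz {d : ℕ} (i : Fin d) {f : (Fin d → ℝ) → ℂ}
    {g : (Fin d → ℝ) → Fin d → ℂ} (hf : Integrable f) (hg : HasRiesz f g) (hgi : Integrable g)
    {χ : (Fin d → ℝ) → ℂ} (hχ : Integrable χ) {M : ℝ} (hM : ∀ x, ‖χ x‖ ≤ M)
    (hχ' : Integrable (ft χ)) {a : ℝ} (ha : a ≠ 0) (p : Fin d → ℝ) :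
    ∫ x, (starRingEnd ℂ) (χ (a • x - p)) * g x i =
      ((a / |a| : ℝ) : ℂ) *
        ∫ η, rieszMult i η * (ft f (a • η) * (chr η p * (starRingEnd ℂ) (ft χ η))) := by
  have hψ : Integrable fun x => (starRingEnd ℂ) (χ (a • x - p)) :=
    (LinearIsometryEquiv.integrable_comp_iff Complex.conjLIE).2
      ((hχ.comp_sub_right p).comp_smul ha)
  have hψ' : Integrable (ftInv fun x => (starRingEnd ℂ) (χ (a • x - p))) := by
    have h1 : Integrable fun η => chr η p * (starRingEnd ℂ) (ft χ η) :=
      ((LinearIsometryEquiv.integrable_comp_iff Complex.conjLIE).2 hχ').bdd_mul (c := 1)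
        (continuous_chr_left p).aestronglyMeasurable
        (Eventually.of_forall fun η => (norm_chr _ _).le)
    have h2 := (h1.comp_smul (inv_ne_zero ha)).smul |(a ^ d)⁻¹|
    exact h2.congr (Eventually.of_forall fun ξ => (ftInv_conj_dilate ha χ p ξ).symm)
  rw [integral_mul_riesz i hf hg hgi hψ (fun x => by rw [RCLike.norm_conj]; exact hM _) hψ']
  have h := integral_comp_smul_pi a fun ξ =>
    rieszMult i ξ * (ft f ξ * (chr (a⁻¹ • ξ) p * (starRingEnd ℂ) (ft χ (a⁻¹ • ξ))))
  simp_rw [inv_smul_smul₀ ha, rieszMult_smul a, mul_assoc] at h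
  rw [integral_const_mul] at h
  rw [h, ← integral_smul]
  congr 1 with ξ
  rw [ftInv_conj_dilate ha, mul_smul_comm, mul_smul_comm]

/-- Convolving the analysis sequence with the discrete Riesz kernel amounts to analyzing the
Riesz transform with a smoothed analyzer. -/
lemma dConv_analysis {d : ℕ} {b : Matrix (Fin d) (Fin d) ℝ} (hb : b.det ≠ 0)
    {ν : (Fin d → ℝ) → ℝ} (hν : IsCutoff d ν) (Φ : SchwartzMap (Fin d → ℝ) ℂ)
    (hΦ : Function.support (ft Φ) ⊆ {ξ : Fin d → ℝ | ξ ᵥ* b ∈ centeredCube d})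
    {f : (Fin d → ℝ) → ℂ} {g : (Fin d → ℝ) → Fin d → ℂ} (hf : Integrable f) (hg : HasRiesz f g)
    (hgi : Integrable g) {a : ℝ} (ha : a ≠ 0) (k : Fin d → ℤ) :
    dConv (fun k => ((|b.det| : ℝ) : ℂ) *
        ∫ x, f x * (starRingEnd ℂ) (Φ (a • x - b *ᵥ intVec k))) (zKernel b ν) k =
      ((a / |a| : ℝ) : ℂ) • ((|b.det| : ℝ) : ℂ) •
        ∫ x, (starRingEnd ℂ) (conv (smoothKer b ν) Φ (a • x - b *ᵥ intVec k)) • g x := by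
  obtain ⟨M, -, hM⟩ := Φ.decay 0 0
  simp_rw [pow_zero, one_mul, norm_iteratedFDeriv_zero] at hM
  have hκ := integrable_smoothKer hb hν
  have hχ : Integrable (conv (smoothKer b ν) Φ) := integrable_conv hκ Φ.integrable
  have hχb := norm_conv_le hκ hM
  have hft : ft (conv (smoothKer b ν) Φ) = fun η => ((ν (η ᵥ* b) : ℝ) : ℂ) * ft Φ η := by
    ext η
    rw [ft_conv hκ Φ.integrable, ft_smoothKer hb hν]
  have hχ' : Integrable (ft (conv (smoothKer b ν) Φ)) := by
    rw [hft]
    exact (integrable_ft_schwartz Φ).bdd_mul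
      (Complex.continuous_ofReal.comp
        (hν.smooth.continuous.comp (continuous_vecMul_const b))).aestronglyMeasurable
      (Eventually.of_forall fun η => hν.norm_le _)
  have hgk : Integrable fun x =>
      (starRingEnd ℂ) (conv (smoothKer b ν) Φ (a • x - b *ᵥ intVec k)) • g x := by
    refine hgi.bdd_smul ((∫ y, ‖smoothKer b ν y‖) * M) (((LinearIsometryEquiv.integrable_comp_iff Complex.conjLIE).2
      ((hχ.comp_sub_right (b *ᵥ intVec k)).comp_smul ha)).aestronglyMeasurable)
      (Eventually.of_forall fun x => ?_)
    exact (RCLike.norm_conj _).le.trans (hχb _)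
  simp_rw [analysis_eq_cubeCoeff hb a Φ hΦ hf]
  rw [dConv_zKernel hb hν (continuous_analysisSymbol b a Φ.integrable hf)
    (norm_analysisSymbol_le b a Φ f)]
  ext i
  rw [Pi.smul_apply, Pi.smul_apply, eval_integral fun i => hgk.eval i,
    setIntegral_eq_integral_of_forall_compl_eq_zero (fun ξ hξ => by
      rw [analysisSymbol_eq_zero hb a f hΦ hξ, mul_zero, zero_mul])]
  simp_rw [Pi.smul_apply, smul_eq_mul]
  rw [integral_conj_mul_riesz i hf hg hgi hχ hχb hχ' ha]
  have h := integral_comp_vecMul hb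
    (fun ξ => chr ξ (intVec k) * analysisSymbol b a Φ f ξ * zetaFn b ν ξ i)
  simp_rw [analysisSymbol_vecMul hb, chr_vecMul, zetaFn_vecMul hb] at h
  have hsgn : ((a / |a| : ℝ) : ℂ) * ((a / |a| : ℝ) : ℂ) = 1 := by
    rw [← Complex.ofReal_mul, div_mul_div_comm, abs_mul_abs_self, div_self (mul_self_ne_zero.2 ha),
      Complex.ofReal_one]
  have hdet : ((|b.det| : ℝ) : ℂ) * ((|b.det|⁻¹ : ℝ) : ℂ) = 1 := by
    rw [← Complex.ofReal_mul, mul_inv_cancel₀ (abs_ne_zero.2 hb), Complex.ofReal_one]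
  have h2 : ∫ η, rieszMult i η * (ft f (a • η) * (chr η (b *ᵥ intVec k) *
      (starRingEnd ℂ) (ft (conv (smoothKer b ν) Φ) η))) = ((|b.det|⁻¹ : ℝ) : ℂ) *
        ∫ ξ, chr ξ (intVec k) * analysisSymbol b a Φ f ξ * zetaFn b ν ξ i := by
    rw [← Complex.real_smul, ← h, hft]
    congr 1 with η
    rw [map_mul, Complex.conj_ofReal]
    ring
  rw [h2]
  linear_combination (-(∫ ξ, chr ξ (intVec k) * analysisSymbol b a Φ f ξ * zetaFn b ν ξ i)) *
    (hsgn + ((a / |a| : ℝ) : ℂ) * ((a / |a| : ℝ) : ℂ) * hdet)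

lemma continuous_smoothKer {d : ℕ} (b : Matrix (Fin d) (Fin d) ℝ) {ν : (Fin d → ℝ) → ℝ}
    (hν : IsCutoff d ν) : Continuous (smoothKer b ν) := by
  obtain ⟨Ψ, hΨ⟩ := hν.exists_schwartz
  have h : Continuous (ftInv fun ξ => ((ν ξ : ℝ) : ℂ)) := by
    rw [hΨ]
    exact continuous_ftInv Ψ.integrable
  have h' : Continuous fun w : Fin d → ℝ => b⁻¹ *ᵥ w :=
    Continuous.matrix_mulVec continuous_const continuous_id
  exact (h.comp h').const_smul |b.det|⁻¹

lemma measurable_conv {d : ℕ} {κ χ : (Fin d → ℝ) → ℂ} (hκ : Continuous κ) (hχ : Continuous χ) :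
    Measurable (conv κ χ) := by
  have h : Continuous fun p : (Fin d → ℝ) × (Fin d → ℝ) => κ p.2 * χ (p.1 - p.2) := by fun_prop
  exact h.stronglyMeasurable.integral_prod_right'.measurable

/-- Proposition: Analysis into `h¹`.
Isotropic dilations `a_j = α_j I`; analyzer `φ` Schwartz with `φ̂` supported in `C₀ b⁻¹`,
and `ν` the cut-off defining the discrete Riesz kernel.  Then for each `j` and every
`f ∈ H¹` (with Riesz transform `g`),
`‖T_j f‖_{h¹} ≤ ‖P|φ|‖_∞ ‖ν̌‖₁ ‖f‖_{H¹}`. -/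
theorem statement13
    (d : ℕ) (b : Matrix (Fin d) (Fin d) ℝ) (hb : b.det ≠ 0)
    (α : ℕ → ℝ) (hα : ∀ j, α j ≠ 0)
    (ν : (Fin d → ℝ) → ℝ) (hν : IsCutoff d ν)
    (φ : (Fin d → ℝ) → ℂ) (hφS : IsSchwartz φ)
    (hφsupp : Function.support (ft φ) ⊆ {ξ : Fin d → ℝ | ξ ᵥ* b ∈ centeredCube d})
    (j : ℕ) (f : (Fin d → ℝ) → ℂ) (g : (Fin d → ℝ) → Fin d → ℂ)
    (hf : Integrable f volume) (hg : HasRiesz f g) (hgInt : Integrable g volume) :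
    h1Norm b ν (fun k => TjH α b φ f j k) ≤
      eLpNorm (periodization b fun x => ‖φ x‖) ⊤ volume *
        ENNReal.ofReal (∫ x : Fin d → ℝ, ‖ftInv (fun ξ => ((ν ξ : ℝ) : ℂ)) x‖) *
        ENNReal.ofReal ((∫ x : Fin d → ℝ, ‖f x‖) + ∫ x : Fin d → ℝ, ‖g x‖) := by
  obtain ⟨Φ, hΦ⟩ := hφS
  obtain rfl : φ = Φ := funext hΦ
  have ha := hα j
  have hκ := integrable_smoothKer hb hν
  set B := eLpNorm (periodization b fun x => ‖Φ x‖) ⊤ volume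
  set N := ENNReal.ofReal (∫ x : Fin d → ℝ, ‖ftInv (fun ξ => ((ν ξ : ℝ) : ℂ)) x‖) with hN
  have hN1 : 1 ≤ N := ENNReal.one_le_ofReal.2 hν.one_le_integral_norm
  have hNκ : ∫⁻ w, ‖smoothKer b ν w‖ₑ = N := by
    rw [← ofReal_integral_norm_eq_lintegral_enorm hκ, integral_norm_smoothKer hb]
  have hB := ePeriodization_schwartz_le hb Φ
  have hχm := measurable_conv (continuous_smoothKer b hν) Φ.continuous
  have h1 := tsum_enorm_analysis_le b Φ.continuous.measurable hB ha hf.aestronglyMeasurable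
  have h2 := tsum_enorm_analysis_le b hχm (Eventually.of_forall
    (ePeriodization_conv_le b hκ.aestronglyMeasurable Φ.continuous.measurable hB)) ha
    hgInt.aestronglyMeasurable
  rw [hNκ, ← ofReal_integral_norm_eq_lintegral_enorm hgInt] at h2
  rw [← ofReal_integral_norm_eq_lintegral_enorm hf] at h1
  have hsgn : ‖((α j / |α j| : ℝ) : ℂ)‖ₑ = 1 := by
    rw [← ofReal_norm, Complex.norm_real, Real.norm_eq_abs, abs_div, abs_abs,
      div_self (abs_ne_zero.2 ha), ENNReal.ofReal_one]
  have e1 : ∑' k : Fin d → ℤ, (‖TjH α b Φ f j k‖₊ : ℝ≥0∞) ≤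
      B * ENNReal.ofReal (∫ x, ‖f x‖) := by
    refine le_trans (le_of_eq ?_) h1
    simp_rw [TjH, smul_eq_mul, mul_comm (f _)]
    rfl
  have e2 : ∑' k : Fin d → ℤ, (‖dConv (fun k => TjH α b Φ f j k) (zKernel b ν) k‖₊ : ℝ≥0∞) ≤
      N * B * ENNReal.ofReal (∫ x, ‖g x‖) := by
    refine le_trans (le_of_eq ?_) h2
    refine tsum_congr fun k => ?_
    simp_rw [TjH]
    rw [dConv_analysis hb hν Φ hφsupp hf hg hgInt ha, ← enorm_eq_nnnorm, enorm_smul, hsgn, one_mul]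
  rw [h1Norm, ENNReal.ofReal_add (integral_nonneg fun _ => norm_nonneg _)
    (integral_nonneg fun _ => norm_nonneg _), mul_add, mul_comm B N]
  refine add_le_add (e1.trans (mul_le_mul_left ?_ _)) e2
  exact le_mul_of_one_le_left' hN1

end AffinePaper
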